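/- Every planar graph on n ≥ 11 vertices with more than (12n−33)/5 edges contains a cycle of length 5. -/

import Mathlib

/-- `H` is a minor of `G`: branch sets are nonempty, connected, pairwise
disjoint, and adjacencies of `H` are realized between branch sets. -/
def SimpleGraph.IsMinorOf {α β : Type} (H : SimpleGraph α) (G : SimpleGraph β) : Prop :=
  ∃ φ : α → Set β,
    (∀ a, (φ a).Nonempty) ∧
    (∀ a, ((G.induce (φ a)).Connected)) ∧
    (∀ a b, a ≠ b → Disjoint (φ a) (φ b)) ∧
    (∀ a b, H.Adj a b → ∃ x ∈ φ a, ∃ y ∈ φ b, G.Adj x y)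

/-- Planarity via Wagner's theorem: no `K₅` minor and no `K₃,₃` minor. -/
def SimpleGraph.IsPlanar {β : Type} (G : SimpleGraph β) : Prop :=
  ¬ (completeGraph (Fin 5)).IsMinorOf G ∧
  ¬ (completeBipartiteGraph (Fin 3) (Fin 3)).IsMinorOf G

namespace Dow

open scoped Classical

noncomputable section

set_option linter.unusedSectionVars false

variable {V : Type}

/-! ### Connectivity of vertex sets, stated as an induction principle -/

/-- The vertex set `R` is (pre)connected in `G`. -/
def Cj (G : SimpleGraph V) (R : Set V) : Prop :=
  ∀ D : V → Prop, (∃ v, v ∈ R ∧ D v) →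
    (∀ v w, v ∈ R → w ∈ R → G.Adj v w → D v → D w) → ∀ v, v ∈ R → D v

theorem Cj.induce_connected {G : SimpleGraph V} {R : Set V} (h : Cj G R) (hne : R.Nonempty) :
    (G.induce R).Connected := by
  obtain ⟨a, ha⟩ := hne
  have key : ∀ v, v ∈ R → ∃ hv : v ∈ R, (G.induce R).Reachable ⟨a, ha⟩ ⟨v, hv⟩ := by
    apply h
    · exact ⟨a, ha, ha, SimpleGraph.Reachable.refl _⟩
    · rintro v w hv hw hvw ⟨_, hr⟩
      refine ⟨hw, hr.trans (SimpleGraph.Adj.reachable ?_)⟩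
      simpa using hvw
  rw [SimpleGraph.connected_iff_exists_forall_reachable]
  exact ⟨⟨a, ha⟩, fun w => (key w.1 w.2).2⟩

theorem Cj.of_induce {G : SimpleGraph V} {R : Set V} (h : (G.induce R).Connected) : Cj G R := by
  intro D ⟨v, hv, hD⟩ hcl w hw
  obtain ⟨p⟩ := h.preconnected ⟨v, hv⟩ ⟨w, hw⟩
  have : ∀ (x y : R) (p : (G.induce R).Walk x y), D x → D y := by
    intro x y p
    induction p with
    | nil => exact id
    | @cons u v w huv p ih =>
      intro hu
      exact ih (hcl u v u.2 v.2 (by simpa using huv) hu)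
  exact this _ _ p hD

theorem Cj.mono {G H : SimpleGraph V} (hGH : G ≤ H) {R : Set V} (h : Cj G R) : Cj H R :=
  fun D h1 h2 => h D h1 fun v w hv hw hvw => h2 v w hv hw (hGH hvw)

theorem Cj.singleton (G : SimpleGraph V) (a : V) : Cj G {a} := by
  rintro D ⟨v, hv, hD⟩ _ w hw
  rw [Set.mem_singleton_iff] at hv hw
  subst hv; subst hw; exact hD

/-- Transitivity of minors, for targets without isolated vertices. -/
theorem minor_trans {α : Type} {K : SimpleGraph α} (hK : ∀ a, ∃ b, K.Adj a b)
    {G' G : SimpleGraph V} (ψ : V → Set V)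
    (h1 : ∀ v, (∃ u, G'.Adj v u) → (ψ v).Nonempty ∧ Cj G (ψ v))
    (h2 : ∀ u v, u ≠ v → (∃ w, G'.Adj u w) → (∃ w, G'.Adj v w) → Disjoint (ψ u) (ψ v))
    (h3 : ∀ u v, G'.Adj u v → ∃ x ∈ ψ u, ∃ y ∈ ψ v, G.Adj x y)
    (hm : K.IsMinorOf G') : K.IsMinorOf G := by
  obtain ⟨φ, p1, p2, p3, p4⟩ := hm
  have hsupp : ∀ a, ∀ v ∈ φ a, ∃ u, G'.Adj v u := by
    intro a v hv
    by_contra hno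
    push Not at hno
    have : ∀ w, w ∈ φ a → w = v := by
      apply Cj.of_induce (p2 a) (fun w => w = v) ⟨v, hv, rfl⟩
      rintro x y hx hy hxy rfl
      exact absurd hxy (hno y)
    obtain ⟨b, hb⟩ := hK a
    obtain ⟨x, hx, y, hy, hxy⟩ := p4 a b hb
    rw [this x hx] at hxy
    exact hno y hxy
  refine ⟨fun a => ⋃ v ∈ φ a, ψ v, ?_, ?_, ?_, ?_⟩
  · intro a
    obtain ⟨v, hv⟩ := p1 a
    obtain ⟨x, hx⟩ := (h1 v (hsupp a v hv)).1
    exact ⟨x, Set.mem_biUnion hv hx⟩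
  · intro a
    apply Cj.induce_connected
    · rintro D ⟨x, hx, hD⟩ hcl y hy
      simp only [Set.mem_iUnion, exists_prop] at hx hy
      obtain ⟨v, hv, hxv⟩ := hx
      obtain ⟨w, hw, hyw⟩ := hy
      have full : ∀ v ∈ φ a, (∃ x ∈ ψ v, D x) → ∀ x ∈ ψ v, D x := by
        intro v hv ⟨x, hx, hD⟩
        apply (h1 v (hsupp a v hv)).2 D ⟨x, hx, hD⟩
        intro s t hs ht hst
        exact hcl s t (Set.mem_biUnion hv hs) (Set.mem_biUnion hv ht) hst
      have := Cj.of_induce (p2 a) (fun v => ∃ x ∈ ψ v, D x) ⟨v, hv, x, hxv, hD⟩ (by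
        intro s t hs ht hst hDs
        obtain ⟨x, hx, y, hy, hxy⟩ := h3 s t hst
        exact ⟨y, hy, hcl x y (Set.mem_biUnion hs hx) (Set.mem_biUnion ht hy) hxy
          (full s hs hDs x hx)⟩) w hw
      exact full w hw this y hyw
    · obtain ⟨v, hv⟩ := p1 a
      obtain ⟨x, hx⟩ := (h1 v (hsupp a v hv)).1
      exact ⟨x, Set.mem_biUnion hv hx⟩
  · intro a b hab
    rw [Set.disjoint_left]
    intro x hx hy
    simp only [Set.mem_iUnion, exists_prop] at hx hy
    obtain ⟨v, hv, hxv⟩ := hx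
    obtain ⟨w, hw, hyw⟩ := hy
    have hvw : v ≠ w := by
      rintro rfl
      exact Set.disjoint_left.1 (p3 a b hab) hv hw
    exact Set.disjoint_left.1 (h2 v w hvw (hsupp a v hv) (hsupp b w hw)) hxv hyw
  · intro a b hab
    obtain ⟨x, hx, y, hy, hxy⟩ := p4 a b hab
    obtain ⟨s, hs, t, ht, hst⟩ := h3 x y hxy
    exact ⟨s, Set.mem_biUnion hx hs, t, Set.mem_biUnion hy ht, hst⟩

theorem planar_trans {G' G : SimpleGraph V} (hG : G.IsPlanar) (ψ : V → Set V)
    (h1 : ∀ v, (∃ u, G'.Adj v u) → (ψ v).Nonempty ∧ Cj G (ψ v))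
    (h2 : ∀ u v, u ≠ v → (∃ w, G'.Adj u w) → (∃ w, G'.Adj v w) → Disjoint (ψ u) (ψ v))
    (h3 : ∀ u v, G'.Adj u v → ∃ x ∈ ψ u, ∃ y ∈ ψ v, G.Adj x y) : G'.IsPlanar := by
  refine ⟨fun h => hG.1 (minor_trans ?_ ψ h1 h2 h3 h), fun h => hG.2 (minor_trans ?_ ψ h1 h2 h3 h)⟩
  · intro a
    refine ⟨a + 1, ?_⟩
    revert a; simp [SimpleGraph.completeGraph]
  · rintro (a | a)
    · exact ⟨Sum.inr 0, by simp⟩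
    · exact ⟨Sum.inl 0, by simp⟩

theorem planar_mono {G' G : SimpleGraph V} (hG : G.IsPlanar) (h : G' ≤ G) : G'.IsPlanar := by
  refine planar_trans hG (fun v => {v}) (fun v _ => ⟨⟨v, rfl⟩, Cj.singleton G v⟩) ?_ ?_
  · intro u v huv _ _
    simpa using huv
  · intro u v huv
    exact ⟨u, rfl, v, rfl, h huv⟩

/-! ### Edge vectors, boundary, cycle space -/

variable [Fintype V]

/-- Boundary of an edge vector. -/
def bd (z : Sym2 V → ZMod 2) (v : V) : ZMod 2 := ∑ u, z s(v, u)

/-- `z` is an even edge set of `G`. -/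
def cyc (G : SimpleGraph V) (z : Sym2 V → ZMod 2) : Prop :=
  (∀ e, e ∉ G.edgeSet → z e = 0) ∧ ∀ v, bd z v = 0

/-- Indicator of a vertex. -/
def ind (a w : V) : ZMod 2 := if w = a then 1 else 0

/-- Single edge vector. -/
def sg (e : Sym2 V) : Sym2 V → ZMod 2 := fun e' => if e' = e then 1 else 0

theorem z2 (a : ZMod 2) : a = 0 ∨ a = 1 := by revert a; decide

theorem z2ne {a : ZMod 2} : a ≠ 0 ↔ a = 1 := by revert a; decide

theorem z2self (a : ZMod 2) : a + a = 0 := CharTwo.add_self_eq_zero a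

theorem z2add {a b : ZMod 2} : a + b = 0 ↔ a = b := by revert a b; decide

@[simp] theorem bd_add (y z : Sym2 V → ZMod 2) (v : V) : bd (y + z) v = bd y v + bd z v := by
  simp [bd, Finset.sum_add_distrib]

@[simp] theorem bd_zero (v : V) : bd (0 : Sym2 V → ZMod 2) v = 0 := by simp [bd]

@[simp] theorem bd_smul (c : ZMod 2) (z : Sym2 V → ZMod 2) (v : V) :
    bd (c • z) v = c * bd z v := by
  simp [bd, Finset.mul_sum]

theorem s2l {v u b : V} : s(v, u) = s(v, b) ↔ u = b := Sym2.congr_right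

theorem s2r {v u b : V} : s(v, u) = s(b, v) ↔ u = b := by
  rw [Sym2.eq_swap (a := b)]; exact Sym2.congr_right

theorem bd_sg {a b : V} (hab : a ≠ b) (v : V) : bd (sg s(a, b)) v = ind a v + ind b v := by
  unfold bd sg ind
  by_cases h1 : v = a
  · subst h1
    simp only [s2l]
    simp [hab]
  · by_cases h2 : v = b
    · subst h2
      simp only [s2r]
      simp [h1]
    · have : ∀ u, ¬ (s(v, u) = s(a, b)) := by
        intro u h; rw [Sym2.eq_iff] at h; tauto
      simp [this, h1, h2]

/-- Handshake. -/
theorem handshake (z : Sym2 V → ZMod 2) (hd : ∀ v, z s(v, v) = 0) : ∑ v, bd z v = 0 := by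
  unfold bd
  rw [← Fintype.sum_prod_type' (f := fun v u => z s(v, u))]
  apply Finset.sum_involution (fun p _ => (p.2, p.1))
  · rintro ⟨a, b⟩ _
    simp only
    rw [Sym2.eq_swap]; exact z2self _
  · rintro ⟨a, b⟩ _ h heq
    simp only [Prod.mk.injEq] at heq
    obtain ⟨rfl, _⟩ := heq
    exact h (hd _)
  · simp
  · simp

theorem cyc_add {G : SimpleGraph V} {y z} (hy : cyc G y) (hz : cyc G z) : cyc G (y + z) :=
  ⟨fun e he => by simp [hy.1 e he, hz.1 e he], fun v => by simp [hy.2 v, hz.2 v]⟩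

theorem cyc_zero {G : SimpleGraph V} : cyc G 0 := ⟨by simp, by simp⟩

theorem cyc_smul {G : SimpleGraph V} (c : ZMod 2) {z} (hz : cyc G z) : cyc G (c • z) :=
  ⟨fun e he => by simp [hz.1 e he], fun v => by simp [hz.2 v]⟩

theorem cyc_mono {G H : SimpleGraph V} (h : G ≤ H) {z} (hz : cyc G z) : cyc H z :=
  ⟨fun e he => hz.1 e fun h' => he (SimpleGraph.edgeSet_mono h h'), hz.2⟩

theorem not_mem_of_not_adj {G : SimpleGraph V} {u v : V} (h : ¬ G.Adj u v) :
    s(u, v) ∉ G.edgeSet := by simpa using h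

/-- triangles are even sets -/
theorem cyc_tri {G : SimpleGraph V} {a b c : V} (h1 : G.Adj a b) (h2 : G.Adj b c)
    (h3 : G.Adj a c) : cyc G (sg s(a, b) + sg s(b, c) + sg s(a, c)) := by
  refine ⟨fun e he => ?_, fun v => ?_⟩
  · have e1 : e ≠ s(a, b) := by rintro rfl; exact he h1
    have e2 : e ≠ s(b, c) := by rintro rfl; exact he h2
    have e3 : e ≠ s(a, c) := by rintro rfl; exact he h3
    simp [sg, e1, e2, e3]
  · simp only [bd_add, bd_sg h1.ne, bd_sg h2.ne, bd_sg h3.ne]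
    generalize ind a v = x; generalize ind b v = y; generalize ind c v = z
    revert x y z; decide

/-- In a connected set avoiding `v`, any two vertices are joined by a chain avoiding `v`. -/
theorem chain {G : SimpleGraph V} {R : Set V} (h : Cj G R) {a b : V} (ha : a ∈ R) (hb : b ∈ R) :
    ∃ z : Sym2 V → ZMod 2, (∀ e, z e ≠ 0 → e ∈ G.edgeSet ∧ ∀ u ∈ e, u ∈ R) ∧
      ∀ w, bd z w = ind a w + ind b w := by
  refine h (fun b => ∃ z : Sym2 V → ZMod 2, (∀ e, z e ≠ 0 → e ∈ G.edgeSet ∧ ∀ u ∈ e, u ∈ R) ∧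
      ∀ w, bd z w = ind a w + ind b w) ⟨a, ha, 0, by simp, fun w => ?_⟩ ?_ b hb
  · simp [z2self]
  · rintro u v hu hv huv ⟨z, hz, hzb⟩
    refine ⟨z + sg s(u, v), fun e he => ?_, fun w => ?_⟩
    · by_cases hE : e = s(u, v)
      · subst hE
        refine ⟨huv, fun t ht => ?_⟩
        rw [Sym2.mem_iff] at ht
        rcases ht with rfl | rfl <;> assumption
      · apply hz
        simpa [sg, hE] using he
    · rw [bd_add, hzb, bd_sg huv.ne]
      generalize ind a w = x; generalize ind u w = y; generalize ind v w = z
      revert x y z; decide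

/-- An even set through two prescribed edges at `v`. -/
theorem LCz {G : SimpleGraph V} {R : Set V} {v a b : V} (h : Cj G R) (hv : v ∉ R)
    (haR : a ∈ R) (hbR : b ∈ R) (ha : G.Adj v a) (hb : G.Adj v b) (hab : a ≠ b) :
    ∃ z, cyc G z ∧ z s(v, a) = 1 ∧ z s(v, b) = 1 ∧ ∀ u, u ≠ a → u ≠ b → z s(v, u) = 0 := by
  obtain ⟨z, hz, hzb⟩ := chain h haR hbR
  have hz0 : ∀ u, z s(v, u) = 0 := by
    intro u
    by_contra hne
    exact hv ((hz _ hne).2 v (by simp))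
  refine ⟨z + sg s(v, a) + sg s(v, b), ⟨fun e he => ?_, fun w => ?_⟩, ?_, ?_, ?_⟩
  · have e1 : e ≠ s(v, a) := by rintro rfl; exact he ha
    have e2 : e ≠ s(v, b) := by rintro rfl; exact he hb
    have e3 : z e = 0 := by
      by_contra hne; exact he (hz e hne).1
    simp [sg, e1, e2, e3]
  · simp only [bd_add, hzb, bd_sg ha.ne, bd_sg hb.ne]
    generalize ind a w = x; generalize ind b w = y; generalize ind v w = z
    revert x y z; decide
  · simp only [Pi.add_apply, hz0, sg, s2l]; simp [hab]
  · simp only [Pi.add_apply, hz0, sg, s2l]; simp [hab.symm]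
  · intro u h1 h2
    simp only [Pi.add_apply, hz0, sg, s2l]; simp [h1, h2]

/-! ### Abstract duals -/

/-- Coboundary of a face colouring. -/
def cob {ι : Type} (G : SimpleGraph V) (l r : Sym2 V → ι) (c : ι → ZMod 2) : Sym2 V → ZMod 2 :=
  fun e => if e ∈ G.edgeSet then c (l e) + c (r e) else 0

/-- `l, r` assign to each edge its two faces; cycles are exactly coboundaries. -/
def IsDual {ι : Type} (G : SimpleGraph V) (l r : Sym2 V → ι) : Prop :=
  (∀ c, cyc G (cob G l r c)) ∧ ∀ z, cyc G z → ∃ c, z = cob G l r c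

/-- `G` has a finite abstract dual. -/
def HasDual (G : SimpleGraph V) : Prop :=
  ∃ (ι : Type) (_ : Fintype ι) (l r : Sym2 V → ι), IsDual G l r

variable {ι : Type} {G : SimpleGraph V} {l r : Sym2 V → ι}

theorem cob_mem {e} (he : e ∈ G.edgeSet) (c : ι → ZMod 2) :
    cob G l r c e = c (l e) + c (r e) := by simp [cob, he]

theorem cob_nmem {e} (he : e ∉ G.edgeSet) {c : ι → ZMod 2} :
    cob G l r c e = 0 := by simp [cob, he]

theorem cob_add_const (c : ι → ZMod 2) (k : ZMod 2) :
    cob G l r (fun i => c i + k) = cob G l r c := by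
  funext e
  unfold cob
  split_ifs
  · dsimp only
    generalize c (l e) = x; generalize c (r e) = y
    revert x y k; decide
  · rfl

theorem IsDual.exists_normalized (hd : IsDual G l r) {z} (hz : cyc G z) (j : ι) (k : ZMod 2) :
    ∃ c, z = cob G l r c ∧ c j = k := by
  obtain ⟨c, hc⟩ := hd.2 z hz
  refine ⟨fun i => c i + (c j + k), by rw [cob_add_const]; exact hc, ?_⟩
  dsimp only
  generalize c j = x
  clear hc
  revert x k; decide

/-- indicator colouring of a face -/
def fi (i : ι) : ι → ZMod 2 := fun j => if j = i then 1 else 0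

theorem cob_fi_eq_one {i : ι} {e} : cob G l r (fi i) e = 1 ↔
    e ∈ G.edgeSet ∧ ((l e = i ∧ r e ≠ i) ∨ (l e ≠ i ∧ r e = i)) := by
  unfold cob fi
  by_cases he : e ∈ G.edgeSet <;> by_cases h1 : l e = i <;> by_cases h2 : r e = i <;>
    simp [he, h1, h2, z2self]

/-- Local connectivity at a vertex. -/
theorem local_const {R : Set V} {v a b : V} (h : Cj G R) (hv : v ∉ R)
    (haR : a ∈ R) (hbR : b ∈ R) (ha : G.Adj v a) (hb : G.Adj v b) (lam : Sym2 V → ZMod 2)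
    (hl : ∀ W, cyc G W → ∑ u, lam s(v, u) * W s(v, u) = 0) :
    lam s(v, a) = lam s(v, b) := by
  by_cases hab : a = b
  · rw [hab]
  obtain ⟨z, hz, h1, h2, h3⟩ := LCz h hv haR hbR ha hb hab
  have := hl z hz
  rw [Finset.sum_eq_add a b hab] at this
  · rw [h1, h2, mul_one, mul_one] at this
    exact z2add.1 this
  · intro c _ hc
    rw [h3 c hc.1 hc.2, mul_zero]
  · simp
  · simp

theorem color_const (hd : IsDual G l r) {R : Set V} {v a b : V} (h : Cj G R) (hv : v ∉ R)
    (haR : a ∈ R) (hbR : b ∈ R) (ha : G.Adj v a) (hb : G.Adj v b) (c : ι → ZMod 2)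
    (hc : ∀ u, G.Adj v u → c (l s(v, u)) = c (r s(v, u))) :
    c (l s(v, a)) = c (l s(v, b)) := by
  refine local_const h hv haR hbR ha hb (fun e => c (l e)) ?_
  intro W hW
  obtain ⟨d, rfl⟩ := hd.2 W hW
  have := (hd.1 (fun i => c i * d i)).2 v
  unfold bd at this
  rw [← this]
  apply Finset.sum_congr rfl
  intro u _
  by_cases hu : G.Adj v u
  · rw [cob_mem (by exact hu), cob_mem (by exact hu), ← hc u hu]
    ring
  · simp [cob, hu]

theorem ends_ne (hd : IsDual G l r) {R : Set V} {v a b : V} (h : Cj G R) (hv : v ∉ R)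
    (haR : a ∈ R) (hbR : b ∈ R) (ha : G.Adj v a) (hb : G.Adj v b) (hab : a ≠ b) :
    l s(v, a) ≠ r s(v, a) := by
  obtain ⟨z, hz, h1, -, -⟩ := LCz h hv haR hbR ha hb hab
  obtain ⟨c, rfl⟩ := hd.2 z hz
  rw [cob_mem (by exact ha)] at h1
  intro heq
  rw [heq, z2self] at h1
  exact zero_ne_one h1

end

end Dow

namespace Dow

open scoped Classical

noncomputable section

set_option linter.unusedSectionVars false
set_option linter.unusedVariables false

variable {V : Type} [Fintype V]

/-! ### Chains with prescribed boundary, and gluing of duals -/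

theorem bd_sum {α : Type} (s : Finset α) (f : α → Sym2 V → ZMod 2) (v : V) :
    bd (∑ a ∈ s, f a) v = ∑ a ∈ s, bd (f a) v := by
  unfold bd
  simp only [Finset.sum_apply]
  rw [Finset.sum_comm]

/-- Every boundary-like vector on a connected set is a boundary. -/
theorem chainb {G : SimpleGraph V} {R : Set V} (h : Cj G R) (b : V → ZMod 2)
    (hb : ∀ v, v ∉ R → b v = 0) (hs : ∑ v, b v = 0) :
    ∃ z : Sym2 V → ZMod 2, (∀ e, e ∉ G.edgeSet → z e = 0) ∧ ∀ w, bd z w = b w := by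
  by_cases hR : ∃ a, a ∈ R
  · obtain ⟨a, ha⟩ := hR
    have : ∀ v, ∃ z : Sym2 V → ZMod 2, v ∈ R → (∀ e, e ∉ G.edgeSet → z e = 0) ∧
        ∀ w, bd z w = ind a w + ind v w := by
      intro v
      by_cases hv : v ∈ R
      · obtain ⟨z, h1, h2⟩ := chain h ha hv
        refine ⟨z, fun _ => ⟨fun e he => ?_, h2⟩⟩
        by_contra hne
        exact he (h1 e hne).1
      · exact ⟨0, fun h => absurd h hv⟩
    choose f hf using this
    refine ⟨∑ v, b v • f v, fun e he => ?_, fun w => ?_⟩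
    · simp only [Finset.sum_apply, Pi.smul_apply, smul_eq_mul]
      apply Finset.sum_eq_zero
      intro v _
      by_cases hv : v ∈ R
      · rw [(hf v hv).1 e he, mul_zero]
      · rw [hb v hv, zero_mul]
    · rw [bd_sum]
      have : ∀ v, bd (b v • f v) w = b v * ind a w + b v * ind v w := by
        intro v
        by_cases hv : v ∈ R
        · rw [bd_smul, (hf v hv).2, mul_add]
        · rw [bd_smul, hb v hv]; simp
      rw [Finset.sum_congr rfl (fun v _ => this v), Finset.sum_add_distrib, ← Finset.sum_mul, hs]
      simp [ind]
  · push Not at hR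
    exact ⟨0, by simp, fun w => by simp [hb w (hR w)]⟩

theorem edge_diag {G : SimpleGraph V} (v : V) : s(v, v) ∉ G.edgeSet := by simp

/-- Decomposition of even sets along a common connected piece. -/
theorem decomp {G G1 G2 S : SimpleGraph V} {R : Set V} (hR : Cj S R)
    (hE : ∀ e, e ∈ G.edgeSet ↔ e ∈ G1.edgeSet ∨ e ∈ G2.edgeSet)
    (hS : ∀ e, e ∈ S.edgeSet ↔ e ∈ G1.edgeSet ∧ e ∈ G2.edgeSet)
    (hbd : ∀ v, v ∉ R → (∀ u, ¬ G1.Adj v u) ∨ (∀ u, ¬ G2.Adj v u))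
    {z : Sym2 V → ZMod 2} (hz : cyc G z) :
    ∃ z1 z2, cyc G1 z1 ∧ cyc G2 z2 ∧ z = z1 + z2 := by
  set y : Sym2 V → ZMod 2 := fun e => if e ∈ G1.edgeSet then z e else 0 with hy
  have y0 : ∀ e, e ∉ G1.edgeSet → y e = 0 := fun e he => by simp [hy, he]
  obtain ⟨t, ht0, htb⟩ := chainb hR (bd y) (by
    intro v hv
    rcases hbd v hv with h | h
    · unfold bd
      apply Finset.sum_eq_zero
      intro u _
      exact y0 _ (h u)
    · rw [← hz.2 v]
      unfold bd
      apply Finset.sum_congr rfl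
      intro u _
      by_cases hu : s(v, u) ∈ G1.edgeSet
      · simp [hy, hu]
      · rw [y0 _ hu, hz.1]
        rw [hE]
        rintro (h' | h')
        · exact hu h'
        · exact h u h') (handshake y fun v => y0 _ (edge_diag v))
  have c1 : cyc G1 (y + t) := by
    refine ⟨fun e he => ?_, fun v => ?_⟩
    · simp only [Pi.add_apply]
      rw [y0 e he, ht0 e, add_zero]
      rw [hS]; tauto
    · rw [bd_add, htb, z2self]
  refine ⟨y + t, z + (y + t), c1, ⟨fun e he => ?_, fun v => ?_⟩, ?_⟩
  · have h1 : t e = 0 := ht0 e (by rw [hS]; tauto)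
    simp only [Pi.add_apply, h1, add_zero]
    by_cases h : e ∈ G1.edgeSet
    · simp [hy, h, z2self]
    · rw [y0 e h, hz.1 e (by rw [hE]; tauto), add_zero]
  · rw [bd_add, hz.2, c1.2, add_zero]
  · funext e
    simp only [Pi.add_apply]
    generalize z e = p; generalize y e = q; generalize t e = r
    revert p q r; decide

theorem glue {ι₁ ι₂ : Type} [Fintype ι₁] [Fintype ι₂] {G G1 G2 S : SimpleGraph V} {R : Set V}
    {l1 r1 : Sym2 V → ι₁} {l2 r2 : Sym2 V → ι₂}
    (d1 : IsDual G1 l1 r1) (d2 : IsDual G2 l2 r2) (hR : Cj S R)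
    (hE : ∀ e, e ∈ G.edgeSet ↔ e ∈ G1.edgeSet ∨ e ∈ G2.edgeSet)
    (hS : ∀ e, e ∈ S.edgeSet ↔ e ∈ G1.edgeSet ∧ e ∈ G2.edgeSet)
    (hbd : ∀ v, v ∉ R → (∀ u, ¬ G1.Adj v u) ∨ (∀ u, ¬ G2.Adj v u))
    (i : ι₁) (j : ι₂) (hi : ∀ e ∈ S.edgeSet, l1 e = i ∨ r1 e = i)
    (hj : ∀ e ∈ S.edgeSet, l2 e = j ∨ r2 e = j) : HasDual G := by
  set φ : ι₂ → ι₁ ⊕ ι₂ := fun k => if k = j then Sum.inl i else Sum.inr k with hφ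
  set p1 : Sym2 V → ι₁ := fun e => if l1 e = i then r1 e else l1 e with hp1
  set p2 : Sym2 V → ι₂ := fun e => if l2 e = j then r2 e else l2 e with hp2
  set L : Sym2 V → ι₁ ⊕ ι₂ := fun e => if e ∈ S.edgeSet then Sum.inl (p1 e) else
    if e ∈ G1.edgeSet then Sum.inl (l1 e) else φ (l2 e) with hL
  set M : Sym2 V → ι₁ ⊕ ι₂ := fun e => if e ∈ S.edgeSet then φ (p2 e) else
    if e ∈ G1.edgeSet then Sum.inl (r1 e) else φ (r2 e) with hM
  have key : ∀ c : ι₁ ⊕ ι₂ → ZMod 2, cob G L M c =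
      cob G1 l1 r1 (fun k => c (Sum.inl k)) + cob G2 l2 r2 (fun k => c (φ k)) := by
    intro c
    have hc : c (φ j) = c (Sum.inl i) := by simp [hφ]
    funext e
    simp only [Pi.add_apply]
    by_cases hs : e ∈ S.edgeSet
    · have h12 := (hS e).1 hs
      rw [cob_mem ((hE e).2 (Or.inl h12.1)), cob_mem h12.1, cob_mem h12.2]
      have hLe : L e = Sum.inl (p1 e) := by simp [hL, hs]
      have hMe : M e = φ (p2 e) := by simp [hM, hs]
      have q1 : c (Sum.inl (l1 e)) + c (Sum.inl (r1 e)) = c (Sum.inl i) + c (Sum.inl (p1 e)) := by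
        by_cases h : l1 e = i
        · simp [hp1, h]
        · have := (hi e hs).resolve_left h
          simp [hp1, h, this, add_comm]
      have q2 : c (φ (l2 e)) + c (φ (r2 e)) = c (Sum.inl i) + c (φ (p2 e)) := by
        rw [← hc]
        by_cases h : l2 e = j
        · simp [hp2, h]
        · have := (hj e hs).resolve_left h
          simp [hp2, h, this, add_comm]
      rw [hLe, hMe, q1, q2]
      generalize c (Sum.inl i) = a
      generalize c (Sum.inl (p1 e)) = b
      generalize c (φ (p2 e)) = d
      revert a b d; decide
    · by_cases h1 : e ∈ G1.edgeSet
      · have h2 : e ∉ G2.edgeSet := fun h2 => hs ((hS e).2 ⟨h1, h2⟩)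
        rw [cob_mem ((hE e).2 (Or.inl h1)), cob_mem h1]
        simp [hL, hM, hs, h1, cob, h2]
      · by_cases h2 : e ∈ G2.edgeSet
        · rw [cob_mem ((hE e).2 (Or.inr h2)), cob_mem h2]
          simp [hL, hM, hs, h1, cob]
        · have : e ∉ G.edgeSet := by rw [hE]; tauto
          simp [cob, this, h1, h2]
  have m1 : G1 ≤ G := by
    intro a b hab
    exact (hE s(a, b)).2 (Or.inl hab)
  have m2 : G2 ≤ G := by
    intro a b hab
    exact (hE s(a, b)).2 (Or.inr hab)
  refine ⟨ι₁ ⊕ ι₂, inferInstance, L, M, ?_, ?_⟩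
  · intro c
    rw [key]
    exact cyc_add (cyc_mono m1 (d1.1 _)) (cyc_mono m2 (d2.1 _))
  · intro z hz
    obtain ⟨z1, z2, k1, k2, rfl⟩ := decomp hR hE hS hbd hz
    obtain ⟨c1, rfl, hc1⟩ := d1.exists_normalized k1 i 0
    obtain ⟨c2, rfl, hc2⟩ := d2.exists_normalized k2 j 0
    refine ⟨Sum.elim c1 c2, ?_⟩
    rw [key]
    have : (fun k => Sum.elim c1 c2 (φ k)) = c2 := by
      funext k
      by_cases hk : k = j
      · simp [hφ, hk, hc1, hc2]
      · simp [hφ, hk]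
    rw [this]
    rfl

/-! ### Deleting an edge -/

/-- delete the edge `g` -/
def de (G : SimpleGraph V) (g : Sym2 V) : SimpleGraph V where
  Adj u v := G.Adj u v ∧ s(u, v) ≠ g
  symm := ⟨fun u v h => ⟨h.1.symm, by rw [Sym2.eq_swap]; exact h.2⟩⟩
  loopless := ⟨fun u h => G.loopless.irrefl u h.1⟩

theorem de_mem {G : SimpleGraph V} {g e} : e ∈ (de G g).edgeSet ↔ e ∈ G.edgeSet ∧ e ≠ g := by
  induction e with | _ a b => rfl

theorem de_le (G : SimpleGraph V) (g) : de G g ≤ G := fun _ _ h => h.1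

theorem hasDual_de {G : SimpleGraph V} (h : HasDual G) (g : Sym2 V) (hg : g ∈ G.edgeSet) :
    HasDual (de G g) := by
  obtain ⟨ι, _, l, r, hd⟩ := h
  set π : ι → ι := fun k => if k = r g then l g else k with hπ
  have key : ∀ c : ι → ZMod 2, c (l g) = c (r g) → cob (de G g) l r c = cob G l r c := by
    intro c hc
    funext e
    by_cases he : e = g
    · subst he
      rw [cob_nmem (by rw [de_mem]; tauto), cob_mem hg, hc, z2self]
    · by_cases hG : e ∈ G.edgeSet
      · rw [cob_mem (by rw [de_mem]; tauto), cob_mem hG]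
      · rw [cob_nmem (by rw [de_mem]; tauto), cob_nmem hG]
  have key1 : ∀ c : ι → ZMod 2, cob (de G g) (fun e => π (l e)) (fun e => π (r e)) c =
      cob (de G g) l r (fun k => c (π k)) := fun c => rfl
  refine ⟨ι, inferInstance, fun e => π (l e), fun e => π (r e), fun c => ?_, fun z hz => ?_⟩
  · refine ⟨fun e he => by simp only [cob, he, if_false], ?_⟩
    rw [key1, key]
    · exact (hd.1 _).2
    · by_cases h : l g = r g <;> simp [hπ, h]
  · obtain ⟨c, hc⟩ := hd.2 z (cyc_mono (de_le G g) hz)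
    have h0 : c (l g) = c (r g) := by
      have : z g = 0 := hz.1 g (by simp [de_mem])
      rw [hc, cob_mem hg] at this
      exact z2add.1 this
    refine ⟨c, ?_⟩
    rw [key1, hc, ← key c h0]
    congr 1
    funext k
    by_cases h : k = r g <;> simp [hπ, h, h0]

/-! ### Face splitting -/

theorem split {ι : Type} [Fintype ι] {K G : SimpleGraph V} {l r : Sym2 V → ι}
    (hd : IsDual K l r) {g : Sym2 V}
    (hE : ∀ e, e ∈ G.edgeSet ↔ e ∈ K.edgeSet ∨ e = g) (hg : g ∉ K.edgeSet)
    (i : ι) (P : Sym2 V → ZMod 2) (hP : ∀ e, P e ≠ 0 → cob K l r (fi i) e = 1)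
    (hc : cyc G (P + sg g)) : HasDual G := by
  set L : Sym2 V → Option ι := fun e => if e = g then none else if P e = 0 then some (l e)
    else none with hL
  set M : Sym2 V → Option ι := fun e => if e = g then some i else if P e = 0 then some (r e)
    else if l e = i then some (r e) else some (l e) with hM
  have Pg : P g = 0 := by
    by_contra h
    have := (cob_fi_eq_one.1 (hP g h)).1
    exact hg this
  have key : ∀ c : Option ι → ZMod 2, cob G L M c =
      cob K l r (fun k => c (some k)) + (c none + c (some i)) • (P + sg g) := by
    intro c
    funext e
    simp only [Pi.add_apply, Pi.smul_apply, smul_eq_mul]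
    by_cases he : e = g
    · subst he
      rw [cob_mem ((hE e).2 (Or.inr rfl)), cob_nmem hg, Pg]
      simp [hL, hM, sg]
    · have hsg : sg g e = 0 := by simp [sg, he]
      by_cases hK : e ∈ K.edgeSet
      · rw [cob_mem ((hE e).2 (Or.inl hK)), cob_mem hK, hsg]
        by_cases h0 : P e = 0
        · simp [hL, hM, he, h0]
        · have h1 := (cob_fi_eq_one.1 (hP e h0)).2
          have hLe : L e = none := by simp [hL, he, h0]
          have hP1 := z2ne.1 h0
          rw [hLe, hP1]
          have hM' : c (some (l e)) + c (some (r e)) = c (some i) + c (M e) := by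
            rcases h1 with ⟨h1, h2⟩ | ⟨h1, h2⟩
            · simp [hM, he, h0, h1]
            · simp [hM, he, h0, h1, h2, add_comm]
          rw [hM']
          generalize c (some i) = a
          generalize c none = b
          generalize c (M e) = d
          revert a b d; decide
      · have hG : e ∉ G.edgeSet := by rw [hE]; tauto
        have hP0 : P e = 0 := by
          by_contra h
          exact hK (cob_fi_eq_one.1 (hP e h)).1
        rw [cob_nmem hG, cob_nmem hK, hsg, hP0]
        simp
  have hle : K ≤ G := fun a b hab => (hE s(a, b)).2 (Or.inl hab)
  refine ⟨Option ι, inferInstance, L, M, fun c => ?_, fun z hz => ?_⟩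
  · rw [key]
    exact cyc_add (cyc_mono hle (hd.1 _)) (cyc_smul _ hc)
  · have hz' : cyc K (z + z g • (P + sg g)) := by
      have h1 := cyc_add hz (cyc_smul (z g) hc)
      refine ⟨fun e he => ?_, h1.2⟩
      by_cases hge : e = g
      · subst hge
        simp [Pg, sg, z2self]
      · exact h1.1 e (by rw [hE]; tauto)
    obtain ⟨c, hcz⟩ := hd.2 _ hz'
    refine ⟨fun o => o.elim (c i + z g) c, ?_⟩
    rw [key]
    simp only [Option.elim]
    rw [← hcz]
    funext e
    simp only [Pi.add_apply, Pi.smul_apply, smul_eq_mul]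
    generalize z e = a; generalize z g = b; generalize c i = d
    generalize P e + sg g e = f
    revert a b d f; decide

/-! ### Deleting a vertex -/

/-- delete all edges at `x` -/
def dv (G : SimpleGraph V) (x : V) : SimpleGraph V where
  Adj u v := G.Adj u v ∧ u ≠ x ∧ v ≠ x
  symm := ⟨fun u v h => ⟨h.1.symm, h.2.2, h.2.1⟩⟩
  loopless := ⟨fun u h => G.loopless.irrefl u h.1⟩

theorem dv_mem {G : SimpleGraph V} {x e} : e ∈ (dv G x).edgeSet ↔ e ∈ G.edgeSet ∧ x ∉ e := by
  induction e with | _ a b =>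
  simp [dv, Ne, eq_comm]

theorem dv_le (G : SimpleGraph V) (x) : dv G x ≤ G := fun _ _ h => h.1

/-- The faces around `x`. -/
def aroundF {ι : Type} (G : SimpleGraph V) (l r : Sym2 V → ι) (x : V) (i : ι) : Prop :=
  ∃ a, G.Adj x a ∧ (i = l s(x, a) ∨ i = r s(x, a))

/-- collapse the faces around `x` -/
def collapse {ι : Type} (G : SimpleGraph V) (l r : Sym2 V → ι) (x : V) (i : ι) : Option ι :=
  if aroundF G l r x i then none else some i

theorem dual_dv {ι : Type} {G : SimpleGraph V} {l r : Sym2 V → ι} (hd : IsDual G l r)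
    {x : V} {R : Set V} (hR : Cj G R) (hx : x ∉ R) (hN : ∀ u, G.Adj x u → u ∈ R) :
    IsDual (dv G x) (fun e => collapse G l r x (l e)) (fun e => collapse G l r x (r e)) := by
  set π := collapse G l r x with hπ
  have key : ∀ c : ι → ZMod 2, (∀ u, G.Adj x u → c (l s(x, u)) = c (r s(x, u))) →
      cob (dv G x) l r c = cob G l r c := by
    intro c hc
    funext e
    by_cases hG : e ∈ G.edgeSet
    · by_cases hx : x ∈ e
      · rw [cob_nmem (by rw [dv_mem]; tauto), cob_mem hG]
        obtain ⟨u, rfl⟩ := hx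
        rw [hc u hG, z2self]
      · rw [cob_mem (by rw [dv_mem]; tauto), cob_mem hG]
    · rw [cob_nmem (by rw [dv_mem]; tauto), cob_nmem hG]
  have key1 : ∀ c : Option ι → ZMod 2, cob (dv G x) (fun e => π (l e)) (fun e => π (r e)) c =
      cob (dv G x) l r (fun k => c (π k)) := fun c => rfl
  refine ⟨fun c => ?_, fun z hz => ?_⟩
  · refine ⟨fun e he => cob_nmem he, ?_⟩
    rw [key1, key]
    · exact (hd.1 _).2
    · intro u hu
      have h1 : aroundF G l r x (l s(x, u)) := ⟨u, hu, Or.inl rfl⟩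
      have h2 : aroundF G l r x (r s(x, u)) := ⟨u, hu, Or.inr rfl⟩
      simp [hπ, collapse, h1, h2]
  · obtain ⟨c, hc⟩ := hd.2 z (cyc_mono (dv_le G x) hz)
    have h0 : ∀ u, G.Adj x u → c (l s(x, u)) = c (r s(x, u)) := by
      intro u hu
      have : z s(x, u) = 0 := hz.1 _ (by rw [dv_mem]; simp)
      rw [hc, cob_mem (by exact hu)] at this
      exact z2add.1 this
    have hk : ∃ k, ∀ i, aroundF G l r x i → c i = k := by
      by_cases ha : ∃ a, G.Adj x a
      · obtain ⟨a, ha⟩ := ha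
        refine ⟨c (l s(x, a)), ?_⟩
        rintro i ⟨b, hb, hi⟩
        have := color_const hd hR hx (hN a ha) (hN b hb) ha hb c h0
        rcases hi with rfl | rfl
        · exact this.symm
        · rw [← h0 b hb]; exact this.symm
      · push Not at ha
        exact ⟨0, fun i hi => absurd hi.choose_spec.1 (ha _)⟩
    obtain ⟨k, hk⟩ := hk
    refine ⟨fun o => o.elim k c, ?_⟩
    rw [key1, hc, ← key c h0]
    congr 1
    funext i
    by_cases h : aroundF G l r x i
    · simp [hπ, collapse, h, hk i h]
    · simp [hπ, collapse, h]

/-! ### Minimality of faces -/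

theorem min_face {ι : Type} {G : SimpleGraph V} {l r : Sym2 V → ι} (hd : IsDual G l r)
    {A : Set V} (hA : Cj G A) (hAv : ∀ v, Cj G (A \ {v})) (hAe : ∀ u v, G.Adj u v → u ∈ A)
    (j : ι) {Z : Sym2 V → ZMod 2} (hZ : cyc G Z) (hne : Z ≠ 0)
    (hle : ∀ e, Z e ≠ 0 → cob G l r (fi j) e = 1) : Z = cob G l r (fi j) := by
  obtain ⟨c, rfl, hcj⟩ := hd.exists_normalized hZ j 0
  set lam : Sym2 V → ZMod 2 := fun e => if l e = j then c (r e) else c (l e) with hlam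
  have hlamW : ∀ d : ι → ZMod 2, d j = 0 → ∀ e ∈ G.edgeSet,
      cob G l r (fun i => c i * d i) e = lam e * cob G l r d e := by
    intro d hdj e he
    rw [cob_mem he, cob_mem he]
    by_cases h1 : l e = j
    · simp [hlam, h1, hcj, hdj]
    · by_cases h2 : r e = j
      · simp [hlam, h1, h2, hcj, hdj]
      · have : c (l e) = c (r e) := by
          by_contra hne'
          have h3 : cob G l r c e ≠ 0 := by
            rw [cob_mem he]
            intro h0
            exact hne' (z2add.1 h0)
          have := (cob_fi_eq_one.1 (hle e h3)).2
          tauto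
        simp only [hlam, h1, if_false, ← this]
        ring
  have hloc : ∀ v a b, G.Adj v a → G.Adj v b → lam s(v, a) = lam s(v, b) := by
    intro v a b ha hb
    refine local_const (hAv v) (by simp) ⟨hAe _ _ ha.symm, ?_⟩ ⟨hAe _ _ hb.symm, ?_⟩ ha hb lam ?_
    · exact ha.ne'
    · exact hb.ne'
    · intro W hW
      obtain ⟨d, rfl, hdj⟩ := hd.exists_normalized hW j 0
      rw [← (hd.1 (fun i => c i * d i)).2 v]
      unfold bd
      apply Finset.sum_congr rfl
      intro u _
      by_cases hu : G.Adj v u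
      · rw [hlamW d hdj _ hu]
      · rw [cob_nmem (by exact hu), cob_nmem (by exact hu), mul_zero]
  obtain ⟨e0, he0⟩ : ∃ e, cob G l r c e ≠ 0 := by
    by_contra h
    push Not at h
    exact hne (funext h)
  have he0G : e0 ∈ G.edgeSet := by
    by_contra h
    exact he0 (cob_nmem h)
  have hlam0 : lam e0 = 1 := by
    have h1 := (cob_fi_eq_one.1 (hle e0 he0)).2
    rw [cob_mem he0G] at he0
    rcases h1 with ⟨h1, h2⟩ | ⟨h1, h2⟩
    · rw [h1, hcj, zero_add] at he0
      simp only [hlam, h1, if_true]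
      exact z2ne.1 he0
    · rw [h2, hcj, add_zero] at he0
      simp only [hlam, h1, if_false]
      exact z2ne.1 he0
  have hglob : ∀ v, v ∈ A → ∀ u, G.Adj v u → lam s(v, u) = 1 := by
    apply hA
    · induction e0 with | _ a b =>
      refine ⟨a, hAe _ _ he0G, fun u hu => ?_⟩
      rw [hloc a u b hu he0G, hlam0]
    · intro v w _ _ hvw h u hu
      rw [hloc w u v hu hvw.symm, Sym2.eq_swap]
      exact h w hvw
  funext e
  by_cases he : e ∈ G.edgeSet
  · have h1 : lam e = 1 := by
      induction e with | _ a b =>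
      exact hglob a (hAe _ _ he) b he
    by_cases h3 : cob G l r c e = 0
    · rw [h3]
      by_contra h4
      have h5 := (cob_fi_eq_one.1 (z2ne.1 (Ne.symm h4))).2
      rw [cob_mem he] at h3
      rcases h5 with ⟨h5, h6⟩ | ⟨h5, h6⟩
      · simp only [hlam, h5, if_true] at h1
        rw [h5, hcj, h1] at h3
        exact absurd h3 (by decide)
      · simp only [hlam, h5, if_false] at h1
        rw [h6, hcj, h1] at h3
        exact absurd h3 (by decide)
    · rw [hle e h3, z2ne.1 h3]
  · rw [cob_nmem he, cob_nmem he]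

/-- Single bridge lemma: a minimal even set with a single bridge is a face. -/
theorem single_bridge {ι : Type} {K : SimpleGraph V} {l r : Sym2 V → ι} (hd : IsDual K l r)
    {C : Sym2 V → ZMod 2} (hC : cyc K C) (hC0 : C ≠ 0)
    (hmin : ∀ Z, cyc K Z → Z ≠ 0 → (∀ e, Z e ≠ 0 → C e ≠ 0) → Z = C)
    {R : Set V} (hR : Cj K R) (hR0 : ∃ v u, v ∈ R ∧ K.Adj v u)
    (hCR : ∀ v u, v ∈ R → C s(v, u) = 0)
    (hedge : ∀ u v, K.Adj u v → C s(u, v) = 0 → u ∈ R ∨ v ∈ R)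
    (hloc : ∀ v, v ∈ R → ∃ R', Cj K R' ∧ v ∉ R' ∧ ∀ u, K.Adj v u → u ∈ R') :
    ∃ i, C = cob K l r (fi i) := by
  obtain ⟨v0, u0, hv0, hvu0⟩ := hR0
  obtain ⟨c, rfl, hc0⟩ := hd.exists_normalized hC (l s(v0, u0)) 0
  have heq : ∀ v u, v ∈ R → K.Adj v u → c (l s(v, u)) = c (r s(v, u)) := by
    intro v u hv hu
    have := hCR v u hv
    rw [cob_mem (by exact hu)] at this
    exact z2add.1 this
  have hcc : ∀ v a b, v ∈ R → K.Adj v a → K.Adj v b → c (l s(v, a)) = c (l s(v, b)) := by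
    intro v a b hv ha hb
    obtain ⟨R', h1, h2, h3⟩ := hloc v hv
    exact color_const hd h1 h2 (h3 a ha) (h3 b hb) ha hb c (fun u hu => heq v u hv hu)
  have hall : ∀ v, v ∈ R → ∀ u, K.Adj v u → c (l s(v, u)) = 0 := by
    apply hR
    · exact ⟨v0, hv0, fun u hu => by rw [hcc v0 u u0 hv0 hu hvu0, hc0]⟩
    · intro v w hv hw hvw h u hu
      rw [hcc w u v hw hu hvw.symm, Sym2.eq_swap]
      exact h w hvw
  obtain ⟨e0, he0⟩ : ∃ e, cob K l r c e ≠ 0 := by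
    by_contra h
    push Not at h
    exact hC0 (funext h)
  have he0K : e0 ∈ K.edgeSet := by
    by_contra h
    exact he0 (cob_nmem h)
  have hlr : c (l e0) ≠ c (r e0) := by
    rw [cob_mem he0K] at he0
    exact fun h => he0 (z2add.2 h)
  obtain ⟨i, hi, hie⟩ : ∃ i, c i = 1 ∧ cob K l r (fi i) e0 = 1 := by
    by_cases h1 : c (l e0) = 0
    · have h2 : c (r e0) = 1 := z2ne.1 (fun h => hlr (h1.trans h.symm))
      exact ⟨r e0, h2, cob_fi_eq_one.2 ⟨he0K, Or.inr ⟨fun h => hlr (by rw [h]), rfl⟩⟩⟩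
    · exact ⟨l e0, z2ne.1 h1, cob_fi_eq_one.2 ⟨he0K, Or.inl ⟨rfl, fun h => hlr (by rw [h])⟩⟩⟩
  refine ⟨i, (hmin _ (hd.1 _) ?_ ?_).symm⟩
  · intro h
    rw [h] at hie
    exact absurd hie (by simp)
  · intro e he h0
    have h1 := cob_fi_eq_one.1 (z2ne.1 he)
    have hz : c (l e) = 0 ∧ c (r e) = 0 := by
      induction e with | _ a b =>
      rcases hedge a b h1.1 h0 with h | h
      · exact ⟨hall a h b h1.1, by rw [← heq a b h h1.1]; exact hall a h b h1.1⟩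
      · have hba : K.Adj b a := h1.1.symm
        rw [Sym2.eq_swap]
        exact ⟨hall b h a hba, by rw [← heq b a h hba]; exact hall b h a hba⟩
    rcases h1.2 with ⟨h2, _⟩ | ⟨_, h2⟩
    · rw [h2, hi] at hz; exact absurd hz.1 (by decide)
    · rw [h2, hi] at hz; exact absurd hz.2 (by decide)

end

end Dow

namespace Dow

open scoped Classical

noncomputable section

set_option linter.unusedSectionVars false
set_option linter.unusedVariables false

variable {V : Type} [Fintype V]

/-! ### Set-up for the induction -/

/-- non-isolated vertices -/
def sp (G : SimpleGraph V) : Set V := {v | ∃ u, G.Adj v u}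

/-- measure for the induction -/
def mu (G : SimpleGraph V) : ℕ :=
  (sp G).ncard * (Fintype.card (Sym2 V) + 1) + G.edgeSet.ncard

theorem edge_card_le (G : SimpleGraph V) : G.edgeSet.ncard ≤ Fintype.card (Sym2 V) := by
  rw [← Nat.card_eq_fintype_card]
  exact Set.ncard_le_card _

theorem mu_lt_of_sp {K G : SimpleGraph V} (h : sp K ⊂ sp G) : mu K < mu G := by
  have h1 : (sp K).ncard + 1 ≤ (sp G).ncard := Set.ncard_lt_ncard h (Set.toFinite _)
  have h2 := edge_card_le K
  unfold mu
  nlinarith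

theorem sp_mono {K G : SimpleGraph V} (h : K ≤ G) : sp K ⊆ sp G :=
  fun _ ⟨u, hu⟩ => ⟨u, h hu⟩

theorem mu_lt_of_lt {K G : SimpleGraph V} (h : K < G) : mu K < mu G := by
  have h1 : (sp K).ncard ≤ (sp G).ncard :=
    Set.ncard_le_ncard (sp_mono h.le) (Set.toFinite _)
  have h2 : K.edgeSet.ncard < G.edgeSet.ncard :=
    Set.ncard_lt_ncard (SimpleGraph.edgeSet_ssubset_edgeSet.2 h) (Set.toFinite _)
  unfold mu
  nlinarith

theorem lt_of_le_edge {K G : SimpleGraph V} (h : K ≤ G) {e} (h1 : e ∈ G.edgeSet)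
    (h2 : e ∉ K.edgeSet) : K < G := by
  refine lt_of_le_of_ne h ?_
  rintro rfl
  exact h2 h1

/-- induction hypothesis -/
def IH (G : SimpleGraph V) : Prop := ∀ K : SimpleGraph V, K.IsPlanar → mu K < mu G → HasDual K

/-- 3-connected -/
def C3 (G : SimpleGraph V) : Prop := ∀ a b, Cj G (sp G \ {a, b})

theorem C3.c2 {G : SimpleGraph V} (h : C3 G) (v : V) : Cj G (sp G \ {v}) := by
  have := h v v
  simpa using this

theorem IH.de {G : SimpleGraph V} (ih : IH G) (hp : G.IsPlanar) {g} (hg : g ∈ G.edgeSet) :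
    HasDual (de G g) :=
  ih _ (planar_mono hp (de_le G g)) (mu_lt_of_lt (lt_of_le_edge (de_le G g) hg (by simp [de_mem])))

/-- connectivity survives replacing an edge by a path -/
theorem Cj.de_path {G : SimpleGraph V} {R : Set V} (h : Cj G R) {p q r : V} (hq : q ∈ R)
    (h1 : G.Adj p q) (h2 : G.Adj q r) : Cj (de G s(p, r)) R := by
  have hpr1 : (Dow.de G s(p, r)).Adj p q := ⟨h1, fun h => h2.ne (s2l.1 h)⟩
  have hpr2 : (Dow.de G s(p, r)).Adj q r := ⟨h2, fun h => h1.ne' (by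
    rw [Sym2.eq_iff] at h
    rcases h with h | h
    · exact h.1
    · exact absurd h.1 h2.ne)⟩
  intro D hD hcl
  refine h D hD ?_
  intro v w hv hw hvw hDv
  by_cases he : s(v, w) = s(p, r)
  · rw [Sym2.eq_iff] at he
    rcases he with ⟨rfl, rfl⟩ | ⟨rfl, rfl⟩
    · exact hcl _ _ hq hw hpr2 (hcl _ _ hv hq hpr1 hDv)
    · exact hcl _ _ hq hw hpr1.symm (hcl _ _ hv hq hpr2.symm hDv)
  · exact hcl v w hv hw ⟨hvw, he⟩ hDv

theorem de_hE {G : SimpleGraph V} {g} (hg : g ∈ G.edgeSet) (e) :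
    e ∈ G.edgeSet ↔ e ∈ (de G g).edgeSet ∨ e = g := by
  rw [de_mem]
  by_cases h : e = g
  · subst h; simp [hg]
  · simp [h]

theorem sg_self (e : Sym2 V) : sg e e = 1 := by simp [sg]

theorem sg_ne {e f : Sym2 V} (h : f ≠ e) : sg e f = 0 := by simp [sg, h]

theorem sgsg_ne {e f g : Sym2 V} (h : (sg e + sg f) g ≠ 0) : g = e ∨ g = f := by
  by_contra hne
  push Not at hne
  apply h
  simp [sg, hne.1, hne.2]

/-- Reduction: adjacent vertices of degree three with a common neighbour. -/
theorem redR {G : SimpleGraph V} (hp : G.IsPlanar) (ih : IH G) (h3 : C3 G) {u v x w y : V}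
    (huv : G.Adj u v) (hxu : G.Adj x u) (hxv : G.Adj x v)
    (hv : ∀ t, G.Adj v t ↔ t = u ∨ t = x ∨ t = w) (hwu : w ≠ u) (hwx : w ≠ x)
    (hy : G.Adj u y) (hyv : y ≠ v) (hyx : y ≠ x) : HasDual G := by
  have hg : s(x, u) ∈ G.edgeSet := hxu
  obtain ⟨ι, _, l, r, hd⟩ := ih.de hp hg
  set K := de G s(x, u) with hK
  have kvu : K.Adj v u := ⟨huv.symm, fun h => by
    rw [Sym2.eq_iff] at h
    rcases h with h | h
    · exact hxv.ne h.1.symm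
    · exact huv.ne h.1.symm⟩
  have kvx : K.Adj v x := ⟨hxv.symm, fun h => by
    rw [Sym2.eq_iff] at h
    rcases h with h | h
    · exact hxv.ne h.1.symm
    · exact huv.ne h.1.symm⟩
  have kvw : K.Adj v w := ⟨(hv w).2 (Or.inr (Or.inr rfl)), fun h => by
    rw [Sym2.eq_iff] at h
    rcases h with h | h
    · exact hxv.ne h.1.symm
    · exact huv.ne h.1.symm⟩
  have kuy : K.Adj u y := ⟨hy, fun h => by
    rw [Sym2.eq_iff] at h
    rcases h with h | h
    · exact hxu.ne h.1.symm
    · exact hyx h.2⟩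
  have hR : Cj K (sp G \ {v}) := by
    intro D hD hcl
    have hyR : y ∈ sp G \ {v} := ⟨⟨u, hy.symm⟩, hyv⟩
    have huR : u ∈ sp G \ {v} := ⟨⟨y, hy⟩, huv.ne⟩
    have hyu := hcl y u hyR huR kuy.symm
    have huy := hcl u y huR hyR kuy
    have hbig : ∀ t, t ∈ sp G \ {u, v} → D t := by
      refine h3 u v D ?_ ?_
      · obtain ⟨t, ht, hDt⟩ := hD
        by_cases htu : t = u
        · subst htu
          exact ⟨y, ⟨hyR.1, by simp [hy.ne', hyv]⟩, huy hDt⟩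
        · exact ⟨t, ⟨ht.1, by simp [htu, show t ≠ v from ht.2]⟩, hDt⟩
      · intro a b ha hb hab
        have ha' : a ≠ u ∧ a ≠ v := by simpa using ha.2
        have hb' : b ≠ u ∧ b ≠ v := by simpa using hb.2
        refine hcl a b ⟨ha.1, ha'.2⟩ ⟨hb.1, hb'.2⟩ ⟨hab, fun h => ?_⟩
        rw [Sym2.eq_iff] at h
        rcases h with h | h
        · exact hb'.1 h.2
        · exact ha'.1 h.1
    intro t ht
    by_cases htu : t = u
    · subst htu
      exact hyu (hbig y ⟨hyR.1, by simp [hy.ne', hyv]⟩)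
    · exact hbig t ⟨ht.1, by simp [htu, show t ≠ v from ht.2]⟩
  have inR : ∀ t, K.Adj v t → t ∈ sp G \ {v} := fun t ht => ⟨⟨v, ht.1.symm⟩, ht.ne'⟩
  have hvR : v ∉ sp G \ {v} := by simp
  have exu : x ≠ u := hxu.ne
  have nx : l s(v, x) ≠ r s(v, x) :=
    ends_ne hd hR hvR (inR _ kvx) (inR _ kvu) kvx kvu exu
  have nu : l s(v, u) ≠ r s(v, u) :=
    ends_ne hd hR hvR (inR _ kvu) (inR _ kvx) kvu kvx exu.symm
  have hbdv : ∀ z, cyc K z → z s(v, u) + z s(v, x) + z s(v, w) = 0 := by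
    intro z hz
    have h0 := hz.2 v
    unfold bd at h0
    rw [← Finset.sum_subset (Finset.subset_univ ({u, x, w} : Finset V))] at h0
    · rw [Finset.sum_insert (by simp [exu.symm, hwu.symm]), Finset.sum_insert (by simp [hwx.symm]),
        Finset.sum_singleton] at h0
      rw [add_assoc]; exact h0
    · intro t _ ht
      apply hz.1
      intro h
      have := (hv t).1 h.1
      simp at ht
      tauto
  have main : ∃ i, cob K l r (fi i) s(v, u) = 1 ∧ cob K l r (fi i) s(v, x) = 1 := by
    by_contra hno
    push Not at hno
    set i := l s(v, x) with hi
    set j := r s(v, x) with hj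
    have ix : cob K l r (fi i) s(v, x) = 1 := cob_fi_eq_one.2 ⟨kvx, Or.inl ⟨rfl, nx.symm⟩⟩
    have jx : cob K l r (fi j) s(v, x) = 1 := cob_fi_eq_one.2 ⟨kvx, Or.inr ⟨nx, rfl⟩⟩
    have iu : cob K l r (fi i) s(v, u) = 0 := by
      by_contra h; exact hno i (z2ne.1 h) ix
    have ju : cob K l r (fi j) s(v, u) = 0 := by
      by_contra h; exact hno j (z2ne.1 h) jx
    have iw := hbdv _ (hd.1 (fi i))
    have jw := hbdv _ (hd.1 (fi j))
    rw [iu, ix, zero_add] at iw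
    rw [ju, jx, zero_add] at jw
    have hsum : ∀ e ∈ K.edgeSet, cob K l r (fi i) e + cob K l r (fi j) e = 0 →
        fi i (l e) + fi j (l e) = fi i (r e) + fi j (r e) := by
      intro e he h
      rw [cob_mem he, cob_mem he] at h
      rw [← z2add, ← h]; ring
    have hcol := color_const hd hR hvR (inR _ kvx) (inR _ kvu) kvx kvu
      (fun k => fi i k + fi j k) (by
        intro t ht
        apply hsum _ ht
        rcases (hv t).1 ht.1 with rfl | rfl | rfl
        · rw [iu, ju, add_zero]
        · rw [ix, jx, z2self]
        · rw [← z2add.1 iw, ← z2add.1 jw, z2self])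
    have h2 := hsum _ kvu (by rw [iu, ju, add_zero])
    have hne1 : ¬ (cob K l r (fi i) s(v, u) = 1) := by rw [iu]; decide
    have hne2 : ¬ (cob K l r (fi j) s(v, u) = 1) := by rw [ju]; decide
    rw [cob_fi_eq_one] at hne1 hne2
    have kvu' : s(v, u) ∈ K.edgeSet := kvu
    rw [← hi] at hcol
    have hii : fi i i = 1 := by simp [fi]
    have hji : fi j i = 0 := by simp [fi, nx]
    rw [hii, hji, add_zero] at hcol
    rw [← hcol] at h2
    have q1 : l s(v, u) = i ∨ l s(v, u) = j := by
      by_contra h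
      push Not at h
      simp [fi, h.1, h.2] at hcol
    have q2 : r s(v, u) = i ∨ r s(v, u) = j := by
      by_contra h
      push Not at h
      simp [fi, h.1, h.2] at h2
    rcases q1 with q1 | q1
    · exact hne1 ⟨kvu', Or.inl ⟨q1, fun h => nu (q1.trans h.symm)⟩⟩
    · exact hne2 ⟨kvu', Or.inl ⟨q1, fun h => nu (q1.trans h.symm)⟩⟩
  obtain ⟨i, iu, ix⟩ := main
  refine split hd (de_hE hg) (by rw [hK, de_mem]; tauto) i (sg s(v, u) + sg s(v, x)) ?_ ?_
  · intro e he
    rcases sgsg_ne he with rfl | rfl <;> assumption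
  · have := cyc_tri huv hxv.symm hxu.symm
    have e1 : sg s(v, u) + sg s(v, x) + sg s(x, u) = sg s(u, v) + sg s(v, x) + sg s(u, x) := by
      rw [Sym2.eq_swap (a := u) (b := v), Sym2.eq_swap (a := u) (b := x)]
    rw [e1]; exact this

set_option maxHeartbeats 1000000 in
/-- Reduction: a quadrilateral with a diagonal whose complement is connected. -/
theorem redQ {G : SimpleGraph V} (hp : G.IsPlanar) (ih : IH G) (h3 : C3 G) {p q r t : V}
    (hpq : G.Adj p q) (hqr : G.Adj q r) (hrt : G.Adj r t) (htp : G.Adj t p) (hpr : G.Adj p r)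
    (hqt : q ≠ t) (hnq : ¬ G.Adj q t) (hB : Cj G (sp G \ {p, q, r, t}))
    (hB0 : (sp G \ {p, q, r, t}).Nonempty) : HasDual G := by
  have hg : s(p, r) ∈ G.edgeSet := hpr
  obtain ⟨ι, _, l, m, hd⟩ := ih.de hp hg
  set K := de G s(p, r) with hK
  set B := sp G \ {p, q, r, t} with hBdef
  have hle : K ≤ G := de_le _ _
  have npq := hpq.ne
  have nqr := hqr.ne
  have nrt := hrt.ne
  have ntp := htp.ne
  have npr := hpr.ne
  have kpq : K.Adj p q := ⟨hpq, fun h => by rw [Sym2.eq_iff] at h; grind⟩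
  have kqr : K.Adj q r := ⟨hqr, fun h => by rw [Sym2.eq_iff] at h; grind⟩
  have krt : K.Adj r t := ⟨hrt, fun h => by rw [Sym2.eq_iff] at h; grind⟩
  have ktp : K.Adj t p := ⟨htp, fun h => by rw [Sym2.eq_iff] at h; grind⟩
  set C : Sym2 V → ZMod 2 := sg s(p, q) + sg s(q, r) + sg s(r, t) + sg s(t, p) with hC
  have Cne : ∀ e, C e ≠ 0 → e = s(p, q) ∨ e = s(q, r) ∨ e = s(r, t) ∨ e = s(t, p) := by
    intro e he
    by_contra hne
    push Not at hne
    apply he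
    simp [hC, sg, hne.1, hne.2.1, hne.2.2.1, hne.2.2.2]
  have Bn : ∀ v, v ∈ B → v ≠ p ∧ v ≠ q ∧ v ≠ r ∧ v ≠ t := by
    intro v hv
    have := hv.2
    simpa using this
  have C0 : C s(p, q) = 1 := by
    simp only [hC, Pi.add_apply, sg_self]
    rw [sg_ne, sg_ne, sg_ne] <;> first | decide | (rw [Ne, Sym2.eq_iff]; grind)
  have C1 : C s(q, r) = 1 := by
    simp only [hC, Pi.add_apply, sg_self]
    rw [sg_ne, sg_ne, sg_ne] <;> first | decide | (rw [Ne, Sym2.eq_iff]; grind)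
  have C2 : C s(r, t) = 1 := by
    simp only [hC, Pi.add_apply, sg_self]
    rw [sg_ne, sg_ne, sg_ne] <;> first | decide | (rw [Ne, Sym2.eq_iff]; grind)
  have C3 : C s(t, p) = 1 := by
    simp only [hC, Pi.add_apply, sg_self]
    rw [sg_ne, sg_ne, sg_ne] <;> first | decide | (rw [Ne, Sym2.eq_iff]; grind)
  have hCc : cyc K C := by
    refine ⟨fun e he => ?_, fun v => ?_⟩
    · by_contra h
      rcases Cne e h with rfl | rfl | rfl | rfl
      · exact he kpq
      · exact he kqr
      · exact he krt
      · exact he ktp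
    · simp only [hC, bd_add, bd_sg npq, bd_sg nqr, bd_sg nrt, bd_sg ntp]
      generalize ind p v = x1; generalize ind q v = x2; generalize ind r v = x3
      generalize ind t v = x4
      revert x1 x2 x3 x4; decide
  have pair : ∀ Z, cyc K Z → (∀ e, Z e ≠ 0 → C e ≠ 0) → ∀ v a b, a ≠ b →
      (∀ u, u ≠ a → u ≠ b → s(v, u) ≠ s(p, q) ∧ s(v, u) ≠ s(q, r) ∧ s(v, u) ≠ s(r, t)
        ∧ s(v, u) ≠ s(t, p)) → Z s(v, a) = Z s(v, b) := by
    intro Z hZ hZC v a b hab hu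
    have h0 := hZ.2 v
    unfold bd at h0
    rw [Finset.sum_eq_add a b hab] at h0
    · exact z2add.1 h0
    · rintro c - ⟨h1, h2⟩
      by_contra h
      have := Cne _ (hZC _ h)
      have := hu c h1 h2
      tauto
    · simp
    · simp
  have hmin : ∀ Z, cyc K Z → Z ≠ 0 → (∀ e, Z e ≠ 0 → C e ≠ 0) → Z = C := by
    intro Z hZ hZ0 hZC
    have e1 : Z s(q, p) = Z s(q, r) := pair Z hZ hZC q p r npr (by
      intro u h1 h2; simp only [Ne, Sym2.eq_iff]; grind)
    have e2 : Z s(r, q) = Z s(r, t) := pair Z hZ hZC r q t hqt (by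
      intro u h1 h2; simp only [Ne, Sym2.eq_iff]; grind)
    have e3 : Z s(t, r) = Z s(t, p) := pair Z hZ hZC t r p npr.symm (by
      intro u h1 h2; simp only [Ne, Sym2.eq_iff]; grind)
    rw [Sym2.eq_swap] at e1 e2 e3
    funext e
    by_cases he : C e = 0
    · rw [he]
      by_contra h
      exact hZC e h he
    · have hall : Z s(p, q) = 1 := by
        by_contra h
        have h0 : Z s(p, q) = 0 := by
          rcases z2 (Z s(p, q)) with h' | h'
          · exact h'
          · exact absurd h' h
        apply hZ0
        funext e
        by_contra h'
        rcases Cne e (hZC e h') with rfl | rfl | rfl | rfl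
        · exact h' h0
        · exact h' (by rw [← e1]; exact h0)
        · exact h' (by rw [← e2, ← e1]; exact h0)
        · exact h' (by rw [← e3, ← e2, ← e1]; exact h0)
      rw [z2ne.1 he]
      rcases Cne e he with rfl | rfl | rfl | rfl
      · exact hall
      · rw [← e1]; exact hall
      · rw [← e2, ← e1]; exact hall
      · rw [← e3, ← e2, ← e1]; exact hall
  have hCne : C ≠ 0 := by
    intro h
    rw [h] at C0
    exact absurd C0 (by simp)
  have kB : ∀ v u, v ∈ B → G.Adj v u → K.Adj v u := by
    intro v u hv hu
    refine ⟨hu, fun h => ?_⟩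
    have := Bn v hv
    rw [Sym2.eq_iff] at h
    tauto
  obtain ⟨i, hi⟩ := single_bridge hd hCc hCne hmin (R := B)
    (by
      intro D hD hcl
      exact hB D hD (fun v w hv hw hvw => hcl v w hv hw (kB v w hv hvw)))
    (by
      obtain ⟨v, hv⟩ := hB0
      obtain ⟨u, hu⟩ := hv.1
      exact ⟨v, u, hv, kB v u hv hu⟩)
    (by
      intro v u hv
      by_contra h
      have h1 := Bn v hv
      have h2 := Cne _ h
      simp only [Sym2.eq_iff] at h2
      tauto)
    (by
      intro u v huv h
      by_contra hno
      push Not at hno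
      have hu : u ∈ sp G := ⟨v, huv.1⟩
      have hv : v ∈ sp G := ⟨u, huv.1.symm⟩
      have hu' : u = p ∨ u = q ∨ u = r ∨ u = t := by
        by_contra h'
        exact hno.1 ⟨hu, by simpa using h'⟩
      have hv' : v = p ∨ v = q ∨ v = r ∨ v = t := by
        by_contra h'
        exact hno.2 ⟨hv, by simpa using h'⟩
      have h4 : ¬ G.Adj t q := fun h => hnq h.symm
      have k1 : ¬ K.Adj p r := fun h => h.2 rfl
      have k2 : ¬ K.Adj r p := fun h => h.2 Sym2.eq_swap
      rcases hu' with rfl | rfl | rfl | rfl <;> rcases hv' with rfl | rfl | rfl | rfl <;>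
        first
        | exact absurd huv (K.loopless.irrefl _)
        | exact k1 huv
        | exact k2 huv
        | exact hnq huv.1
        | exact h4 huv.1
        | (rw [C0] at h; exact absurd h (by decide))
        | (rw [C1] at h; exact absurd h (by decide))
        | (rw [C2] at h; exact absurd h (by decide))
        | (rw [C3] at h; exact absurd h (by decide))
        | (rw [Sym2.eq_swap] at h; rw [C0] at h; exact absurd h (by decide))
        | (rw [Sym2.eq_swap] at h; rw [C1] at h; exact absurd h (by decide))
        | (rw [Sym2.eq_swap] at h; rw [C2] at h; exact absurd h (by decide))
        | (rw [Sym2.eq_swap] at h; rw [C3] at h; exact absurd h (by decide)))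
    (by
      intro v hv
      refine ⟨sp G \ {v}, (h3.c2 v).de_path ?_ hpq hqr, by simp, fun u hu => ?_⟩
      · exact ⟨⟨p, hpq.symm⟩, (Bn v hv).2.1.symm⟩
      · exact ⟨⟨v, hu.1.symm⟩, hu.ne'⟩)
  refine split hd (de_hE hg) (by rw [hK, de_mem]; tauto) i (sg s(p, q) + sg s(q, r)) ?_ ?_
  · intro e he
    rw [← hi]
    rcases sgsg_ne he with rfl | rfl <;> assumption
  · exact cyc_tri hpq hqr hpr

end

end Dow

namespace Dow

open scoped Classical

noncomputable section

set_option linter.unusedSectionVars false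
set_option linter.unusedVariables false

variable {V : Type} [Fintype V]

/-- restrict the edge set -/
def rs (G : SimpleGraph V) (P : Sym2 V → Prop) : SimpleGraph V where
  Adj u v := G.Adj u v ∧ P s(u, v)
  symm := ⟨fun u v h => ⟨h.1.symm, by rw [Sym2.eq_swap]; exact h.2⟩⟩
  loopless := ⟨fun u h => G.loopless.irrefl u h.1⟩

theorem rs_mem {G : SimpleGraph V} {P e} : e ∈ (rs G P).edgeSet ↔ e ∈ G.edgeSet ∧ P e := by
  induction e with | _ a b => rfl

theorem rs_le (G : SimpleGraph V) (P) : rs G P ≤ G := fun _ _ h => h.1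

/-- add an edge -/
def ae (G : SimpleGraph V) (a b : V) : SimpleGraph V where
  Adj u v := G.Adj u v ∨ (u ≠ v ∧ s(u, v) = s(a, b))
  symm := ⟨fun u v h => h.imp (fun h => h.symm) (fun h => ⟨h.1.symm, by
    rw [Sym2.eq_swap]; exact h.2⟩)⟩
  loopless := ⟨fun u h => h.elim (G.loopless.irrefl u) (fun h => h.1 rfl)⟩

theorem ae_mem {G : SimpleGraph V} {a b : V} (hab : a ≠ b) {e} :
    e ∈ (ae G a b).edgeSet ↔ e ∈ G.edgeSet ∨ e = s(a, b) := by
  induction e with | _ u v =>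
  constructor
  · rintro (h | h)
    · exact Or.inl h
    · exact Or.inr h.2
  · rintro (h | h)
    · exact Or.inl h
    · refine Or.inr ⟨?_, h⟩
      intro huv
      have huv' : u = v := huv
      subst huv'
      rw [Sym2.eq_iff] at h
      apply hab
      rcases h with h | h
      · exact h.1.symm.trans h.2
      · exact h.2.symm.trans h.1

theorem not_Cj {G : SimpleGraph V} {R : Set V} (h : ¬ Cj G R) :
    ∃ D : V → Prop, (∀ v, D v → v ∈ R) ∧ (∃ v, D v) ∧ (∃ w, w ∈ R ∧ ¬ D w) ∧
      ∀ v w, D v → w ∈ R → G.Adj v w → D w := by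
  unfold Cj at h
  push Not at h
  obtain ⟨D, ⟨v, hv, hD⟩, hcl, w, hw, hDw⟩ := h
  exact ⟨fun v => v ∈ R ∧ D v, fun v h => h.1, ⟨v, hv, hD⟩, ⟨w, hw, fun h => hDw h.2⟩,
    fun v w hv hw hvw => ⟨hw, hcl v w hv.1 hw hvw hv.2⟩⟩

/-- Separation by at most one vertex. -/
theorem sep1 {G : SimpleGraph V} (hp : G.IsPlanar) (ih : IH G) (D : V → Prop) (s : V)
    (hs : ¬ D s) (hcl : ∀ u w, D u → G.Adj u w → w ≠ s → D w)
    (h1 : ∃ u w, D u ∧ G.Adj u w) (h2 : ∃ u w, G.Adj u w ∧ ¬ D u ∧ ¬ D w) : HasDual G := by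
  set P : Sym2 V → Prop := fun e => ∃ u ∈ e, D u with hP
  obtain ⟨u1, w1, hu1, huw1⟩ := h1
  obtain ⟨u2, w2, huw2, hu2, hw2⟩ := h2
  have p1 : P s(u1, w1) := ⟨u1, by simp, hu1⟩
  have p2 : ¬ P s(u2, w2) := by
    rintro ⟨t, ht, hD⟩
    rw [Sym2.mem_iff] at ht
    rcases ht with rfl | rfl <;> tauto
  obtain ⟨ι₁, _, l1, r1, d1⟩ := ih (rs G P) (planar_mono hp (rs_le _ _))
    (mu_lt_of_lt (lt_of_le_edge (rs_le _ _) (e := s(u2, w2)) huw2 (fun h => p2 h.2)))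
  obtain ⟨ι₂, _, l2, r2, d2⟩ := ih (rs G (fun e => ¬ P e)) (planar_mono hp (rs_le _ _))
    (mu_lt_of_lt (lt_of_le_edge (rs_le _ _) (e := s(u1, w1)) huw1 (fun h => h.2 p1)))
  refine glue d1 d2 (S := ⊥) (Cj.singleton _ s) ?_ ?_ ?_ (l1 s(s, s)) (l2 s(s, s)) ?_ ?_
  · intro e
    rw [rs_mem, rs_mem]; generalize P e = q; tauto
  · intro e
    rw [rs_mem, rs_mem]; simp; tauto
  · intro v hv
    by_cases hDv : D v
    · right
      intro u hu
      exact hu.2 ⟨v, by simp, hDv⟩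
    · left
      rintro u ⟨hu, t, ht, hD⟩
      rw [Sym2.mem_iff] at ht
      rcases ht with rfl | rfl
      · exact hDv hD
      · exact hDv (hcl _ _ hD hu.symm hv)
  · simp
  · simp

theorem virt {G : SimpleGraph V} (hp : G.IsPlanar) (h2c : ∀ v, Cj G (sp G \ {v})) (D : V → Prop)
    {a b : V} (hab : a ≠ b) (ha : a ∈ sp G) (hb : b ∈ sp G) (hDa : ¬ D a) (hDb : ¬ D b)
    (hDs : ∀ v, D v → v ∈ sp G) (hcl : ∀ u w, D u → G.Adj u w → w ≠ a → w ≠ b → D w)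
    (hD : ∃ v, D v) {K : SimpleGraph V}
    (hK : ∀ u v, K.Adj u v → (G.Adj u v ∧ ¬ D u ∧ ¬ D v) ∨ s(u, v) = s(a, b)) : K.IsPlanar := by
  by_cases hadj : G.Adj a b
  · apply planar_mono hp
    intro u v huv
    rcases hK u v huv with h | h
    · exact h.1
    · have : s(u, v) ∈ G.edgeSet := by rw [h]; exact hadj
      exact this
  set T : Set V := {v | ∀ D0 : V → Prop, D0 a →
    (∀ u w, D0 u → G.Adj u w → D w → D0 w) → D0 v} with hT
  have Ta : a ∈ T := fun D0 h _ => h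
  have Tstep : ∀ u w, u ∈ T → G.Adj u w → D w → w ∈ T :=
    fun u w hu huw hw D0 h0 hs => hs u w (hu D0 h0 hs) huw hw
  have Tsub : ∀ v, v ∈ T → v = a ∨ D v := by
    intro v hv
    exact hv (fun v => v = a ∨ D v) (Or.inl rfl) (fun u w _ _ h => Or.inr h)
  have Tcj : Cj G T := by
    rintro D0 ⟨v, hv, hDv⟩ h0
    have hD0a : D0 a := by
      by_contra hna
      have := hv (fun v => v ∈ T ∧ ¬ D0 v) ⟨Ta, hna⟩ (by
        rintro u w ⟨hu, hnu⟩ huw hw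
        have hwT := Tstep u w hu huw hw
        exact ⟨hwT, fun h => hnu (h0 w u hwT hu huw.symm h)⟩)
      exact this.2 hDv
    intro w hw
    have := hw (fun v => v ∈ T ∧ D0 v) ⟨Ta, hD0a⟩ (by
        rintro u w ⟨hu, hnu⟩ huw hw
        have hwT := Tstep u w hu huw hw
        exact ⟨hwT, h0 u w hu hwT huw hnu⟩)
    exact this.2
  have hda : ∃ d, D d ∧ G.Adj a d := by
    by_contra hno
    push Not at hno
    obtain ⟨d, hd⟩ := hD
    refine hDa (h2c b D ⟨d, ⟨hDs d hd, ?_⟩, hd⟩ ?_ a ⟨ha, hab⟩)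
    · rintro rfl; exact hDb hd
    · intro u w hu hw huw hDu
      refine hcl u w hDu huw ?_ hw.2
      rintro rfl
      exact hno u hDu huw.symm
  have htb : ∃ t ∈ T, G.Adj t b := by
    by_contra hno
    push Not at hno
    obtain ⟨d, hd, had⟩ := hda
    have := h2c a (fun v => v ∈ T ∧ D v) ⟨d, ⟨hDs d hd, fun h => hDa (h ▸ hd)⟩,
      Tstep a d Ta had hd, hd⟩ (by
        rintro u w hu hw huw ⟨huT, hDu⟩
        have hwb : w ≠ b := by
          rintro rfl
          exact hno u huT huw
        have := hcl u w hDu huw hw.2 hwb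
        exact ⟨Tstep u w huT huw this, this⟩) b ⟨hb, hab.symm⟩
    exact hDb this.2
  obtain ⟨t, htT, htb⟩ := htb
  have Ksp : ∀ v, (∃ u, K.Adj v u) → ¬ D v := by
    rintro v ⟨u, hu⟩
    rcases hK v u hu with h | h
    · exact h.2.1
    · rw [Sym2.eq_iff] at h
      rcases h with ⟨rfl, _⟩ | ⟨rfl, _⟩ <;> assumption
  set ψ : V → Set V := fun v => if v = a then T else {v} with hψ
  have ψa : ψ a = T := by simp [hψ]
  have ψn : ∀ v, v ≠ a → ψ v = {v} := fun v hv => by simp [hψ, hv]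
  have ψs : ∀ v, v ∈ ψ v := by
    intro v
    by_cases hv : v = a
    · subst hv; rw [ψa]; exact Ta
    · rw [ψn v hv]; rfl
  refine planar_trans hp ψ ?_ ?_ ?_
  · intro v _
    refine ⟨⟨v, ψs v⟩, ?_⟩
    by_cases hv : v = a
    · subst hv; rw [ψa]; exact Tcj
    · rw [ψn v hv]; exact Cj.singleton _ _
  · intro u v huv hu hv
    have hTn : ∀ v, v ≠ a → ¬ D v → v ∉ T := fun v h1 h2 h3 => by
      rcases Tsub v h3 with h | h <;> tauto
    by_cases hua : u = a
    · subst hua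
      rw [ψa, ψn v huv.symm, Set.disjoint_singleton_right]
      exact hTn v huv.symm (Ksp v hv)
    · by_cases hva : v = a
      · subst hva
        rw [ψa, ψn u huv, Set.disjoint_singleton_left]
        exact hTn u huv (Ksp u hu)
      · rw [ψn u hua, ψn v hva]
        simpa using huv
  · intro u v huv
    rcases hK u v huv with h | h
    · exact ⟨u, ψs u, v, ψs v, h.1⟩
    · rw [Sym2.eq_iff] at h
      rcases h with ⟨rfl, rfl⟩ | ⟨rfl, rfl⟩
      · exact ⟨t, by rw [ψa]; exact htT, v, ψs v, htb⟩
      · exact ⟨u, ψs u, t, by rw [ψa]; exact htT, htb.symm⟩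

/-- Separation by two vertices. -/
theorem sep2 {G : SimpleGraph V} (hp : G.IsPlanar) (ih : IH G) (h2c : ∀ v, Cj G (sp G \ {v}))
    (D : V → Prop) {a b : V} (hab : a ≠ b) (ha : a ∈ sp G) (hb : b ∈ sp G)
    (hDs : ∀ v, D v → v ∈ sp G) (hDa : ¬ D a) (hDb : ¬ D b)
    (hcl : ∀ u w, D u → G.Adj u w → w ≠ a → w ≠ b → D w) (h1 : ∃ v, D v)
    (h2 : ∃ v, v ∈ sp G ∧ ¬ D v ∧ v ≠ a ∧ v ≠ b) : HasDual G := by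
  set P : Sym2 V → Prop := fun e => ∃ u ∈ e, D u with hP
  have Pmk : ∀ u v, P s(u, v) ↔ D u ∨ D v := by
    intro u v
    simp [hP]
  have hPab : ¬ P s(a, b) := by rw [Pmk]; tauto
  have mem1 : ∀ e, e ∈ (ae (rs G P) a b).edgeSet ↔ (e ∈ G.edgeSet ∧ P e) ∨ e = s(a, b) := by
    intro e; rw [ae_mem hab, rs_mem]
  have mem2 : ∀ e, e ∈ (ae (rs G fun e => ¬ P e) a b).edgeSet ↔
      (e ∈ G.edgeSet ∧ ¬ P e) ∨ e = s(a, b) := by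
    intro e; rw [ae_mem hab, rs_mem]
  have hsub : ∀ Q : Sym2 V → Prop, sp (ae (rs G Q) a b) ⊆ sp G := by
    rintro Q v ⟨u, hu⟩
    rcases hu with hu | ⟨_, hu⟩
    · exact ⟨u, hu.1⟩
    · rw [Sym2.eq_iff] at hu
      rcases hu with ⟨rfl, _⟩ | ⟨rfl, _⟩ <;> assumption
  obtain ⟨d', hd's, hd'D, hd'a, hd'b⟩ := h2
  obtain ⟨d, hd⟩ := h1
  have m1 : mu (ae (rs G P) a b) < mu G := by
    apply mu_lt_of_sp
    refine ⟨hsub P, fun h => ?_⟩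
    obtain ⟨u, hu⟩ := h hd's
    rcases hu with hu | ⟨_, hu⟩
    · have := hu.2
      rw [Pmk] at this
      rcases this with h | h
      · exact hd'D h
      · exact hd'D (hcl _ _ h hu.1.symm hd'a hd'b)
    · rw [Sym2.eq_iff] at hu; tauto
  have m2 : mu (ae (rs G fun e => ¬ P e) a b) < mu G := by
    apply mu_lt_of_sp
    refine ⟨hsub _, fun h => ?_⟩
    obtain ⟨u, hu⟩ := h (hDs d hd)
    rcases hu with hu | ⟨_, hu⟩
    · exact hu.2 (by rw [Pmk]; exact Or.inl hd)
    · rw [Sym2.eq_iff] at hu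
      rcases hu with ⟨rfl, _⟩ | ⟨rfl, _⟩ <;> tauto
  have p2 : (ae (rs G fun e => ¬ P e) a b).IsPlanar := by
    refine virt hp h2c D hab ha hb hDa hDb hDs hcl ⟨d, hd⟩ ?_
    rintro u v (huv | huv)
    · left
      have : ¬ P s(u, v) := huv.2
      rw [Pmk] at this
      exact ⟨huv.1, by tauto, by tauto⟩
    · exact Or.inr huv.2
  have p1 : (ae (rs G P) a b).IsPlanar := by
    refine virt hp h2c (fun v => v ∈ sp G ∧ ¬ D v ∧ v ≠ a ∧ v ≠ b) hab ha hb (by simp) (by simp)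
      (fun v h => h.1) ?_ ⟨d', hd's, hd'D, hd'a, hd'b⟩ ?_
    · rintro u w ⟨hu, hDu, hua, hub⟩ huw hwa hwb
      exact ⟨⟨u, huw.symm⟩, fun h => hDu (hcl _ _ h huw.symm hua hub), hwa, hwb⟩
    · rintro u v (huv | huv)
      · left
        have := huv.2
        rw [Pmk] at this
        refine ⟨huv.1, ?_, ?_⟩
        · rintro ⟨_, h1, h2, h3⟩
          rcases this with h | h
          · exact h1 h
          · exact h1 (hcl _ _ h huv.1.symm h2 h3)
        · rintro ⟨_, h1, h2, h3⟩
          rcases this with h | h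
          · exact h1 (hcl _ _ h huv.1 h2 h3)
          · exact h1 h
      · exact Or.inr huv.2
  obtain ⟨ι₁, _, l1, r1, d1⟩ := ih _ p1 m1
  obtain ⟨ι₂, _, l2, r2, d2⟩ := ih _ p2 m2
  have hS : ∀ e, e ∈ (ae (⊥ : SimpleGraph V) a b).edgeSet ↔ e = s(a, b) := by
    intro e; rw [ae_mem hab]; simp
  have big : HasDual (ae G a b) := by
    refine glue d1 d2 (S := ae ⊥ a b) (R := {a, b}) ?_ ?_ ?_ ?_ (l1 s(a, b)) (l2 s(a, b)) ?_ ?_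
    · have hSab : (ae (⊥ : SimpleGraph V) a b).Adj a b := Or.inr ⟨hab, rfl⟩
      rintro D0 ⟨v, hv, hDv⟩ h0 w hw
      have ma : a ∈ ({a, b} : Set V) := by simp
      have mb : b ∈ ({a, b} : Set V) := by simp
      have h1 := h0 a b ma mb hSab
      have h2 := h0 b a mb ma hSab.symm
      rcases hv with rfl | rfl <;> rcases hw with rfl | rfl <;> tauto
    · intro e
      rw [mem1, mem2, ae_mem hab]; generalize P e = q; tauto
    · intro e
      rw [mem1, mem2, hS]; generalize P e = q; tauto
    · intro v hv
      have hva : v ≠ a := fun h => hv (by simp [h])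
      have hvb : v ≠ b := fun h => hv (by simp [h])
      have hnab : ∀ u, s(v, u) ≠ s(a, b) := by
        intro u h
        rw [Sym2.eq_iff] at h; tauto
      by_cases hDv : D v
      · right
        rintro u (hu | hu)
        · exact hu.2 (by rw [Pmk]; exact Or.inl hDv)
        · exact hnab u hu.2
      · left
        rintro u (hu | hu)
        · have := hu.2
          rw [Pmk] at this
          rcases this with h | h
          · exact hDv h
          · exact hDv (hcl _ _ h hu.1.symm hva hvb)
        · exact hnab u hu.2
    · intro e he
      rw [(hS e).1 he]; exact Or.inl rfl
    · intro e he
      rw [(hS e).1 he]; exact Or.inl rfl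
  by_cases hadj : G.Adj a b
  · have : ae G a b = G := by
      apply SimpleGraph.edgeSet_injective
      ext e
      rw [ae_mem hab]
      constructor
      · rintro (h | rfl)
        · exact h
        · exact hadj
      · exact Or.inl
    rw [this] at big
    exact big
  · have h3 := hasDual_de big s(a, b) ((ae_mem hab).2 (Or.inr rfl))
    have : de (ae G a b) s(a, b) = G := by
      apply SimpleGraph.edgeSet_injective
      ext e
      rw [de_mem, ae_mem hab]
      constructor
      · tauto
      · intro h
        refine ⟨Or.inl h, ?_⟩
        rintro rfl
        exact hadj h
    rw [this] at h3
    exact h3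

theorem not_conn {G : SimpleGraph V} (hp : G.IsPlanar) (ih : IH G) (h : ¬ Cj G (sp G)) :
    HasDual G := by
  obtain ⟨D, hD1, ⟨v, hv⟩, ⟨w, hw, hDw⟩, hcl⟩ := not_Cj h
  refine sep1 hp ih D w hDw (fun u t hu hut _ => hcl u t hu ⟨u, hut.symm⟩ hut) ?_ ?_
  · obtain ⟨u, hu⟩ := hD1 v hv
    exact ⟨v, u, hv, hu⟩
  · obtain ⟨u, hu⟩ := hw
    exact ⟨w, u, hu, hDw, fun h => hDw (hcl u w h ⟨u, hu⟩ hu.symm)⟩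

theorem not_conn2 {G : SimpleGraph V} (hp : G.IsPlanar) (ih : IH G) {s : V}
    (h : ¬ Cj G (sp G \ {s})) : HasDual G := by
  obtain ⟨D, hD1, ⟨v, hv⟩, ⟨w, hw, hDw⟩, hcl⟩ := not_Cj h
  refine sep1 hp ih D s (fun h => (hD1 s h).2 rfl)
    (fun u t hu hut hts => hcl u t hu ⟨⟨u, hut.symm⟩, hts⟩ hut) ?_ ?_
  · obtain ⟨u, hu⟩ := (hD1 v hv).1
    exact ⟨v, u, hv, hu⟩
  · obtain ⟨u, hu⟩ := hw.1
    exact ⟨w, u, hu, hDw, fun h => hDw (hcl u w h hw hu.symm)⟩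

theorem not_C3 {G : SimpleGraph V} (hp : G.IsPlanar) (ih : IH G) (h : ¬ C3 G) : HasDual G := by
  by_cases h2 : ∀ v, Cj G (sp G \ {v})
  · unfold C3 at h
    push Not at h
    obtain ⟨a, b, hab⟩ := h
    have nab : a ≠ b := by
      rintro rfl
      apply hab
      simpa using h2 a
    have ha : a ∈ sp G := by
      by_contra ha
      apply hab
      have : sp G \ {a, b} = sp G \ {b} := by
        ext v
        simp only [Set.mem_sdiff, Set.mem_insert_iff, Set.mem_singleton_iff]
        constructor
        · tauto
        · rintro ⟨h1, h2⟩
          refine ⟨h1, ?_⟩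
          rintro (rfl | h) <;> tauto
      rw [this]; exact h2 b
    have hb : b ∈ sp G := by
      by_contra ha
      apply hab
      have : sp G \ {a, b} = sp G \ {a} := by
        ext v
        simp only [Set.mem_sdiff, Set.mem_insert_iff, Set.mem_singleton_iff]
        constructor
        · tauto
        · rintro ⟨h1, h2⟩
          refine ⟨h1, ?_⟩
          rintro (h | rfl) <;> tauto
      rw [this]; exact h2 a
    obtain ⟨D, hD1, ⟨v, hv⟩, ⟨w, hw, hDw⟩, hcl⟩ := not_Cj hab
    have hw2 : w ≠ a ∧ w ≠ b := by simpa using hw.2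
    refine sep2 hp ih h2 D nab ha hb (fun v hv => (hD1 v hv).1) (fun h => (hD1 a h).2 (by simp))
      (fun h => (hD1 b h).2 (by simp)) ?_ ⟨v, hv⟩ ⟨w, hw.1, hDw, hw2.1, hw2.2⟩
    intro u t hu hut hta htb
    exact hcl u t hu ⟨⟨u, hut.symm⟩, by simp [hta, htb]⟩ hut
  · push Not at h2
    obtain ⟨v, hv⟩ := h2
    exact not_conn2 hp ih hv

/-- Thomassen: a 3-connected graph has an edge whose contraction keeps it 3-connected. -/
theorem thomassen {G : SimpleGraph V} (h3 : C3 G) (hE : ∃ x y, G.Adj x y) :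
    ∃ x y, G.Adj x y ∧ ∀ z, Cj G (sp G \ {x, y, z}) := by
  by_contra hno
  push Not at hno
  set Good : Finset V → Prop := fun D => ∃ x y z, G.Adj x y ∧ D.Nonempty ∧
    (∀ v ∈ D, v ∈ sp G \ {x, y, z}) ∧ (∀ u w, u ∈ D → w ∈ sp G \ {x, y, z} → G.Adj u w → w ∈ D) ∧
    ∃ t, t ∈ sp G \ {x, y, z} ∧ t ∉ D with hGood
  have ex : ∃ D, Good D := by
    obtain ⟨x, y, hxy⟩ := hE
    obtain ⟨z, hz⟩ := hno x y hxy
    obtain ⟨D, hD1, ⟨v, hv⟩, ⟨w, hw, hDw⟩, hcl⟩ := not_Cj hz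
    refine ⟨Finset.univ.filter D, x, y, z, hxy, ⟨v, by simpa using hv⟩, ?_, ?_, w, hw, ?_⟩
    · intro v hv
      exact hD1 v (by simpa using hv)
    · intro u w hu hw huw
      have := hcl u w (by simpa using hu) hw huw
      simpa using this
    · simpa using hDw
  obtain ⟨D, hD, hmin⟩ := exists_minimalFor_of_wellFoundedLT Good Finset.card ex
  obtain ⟨x, y, z, hxy, ⟨d, hd⟩, hDs, hDcl, t, ht, htD⟩ := hD
  have Dn : ∀ v ∈ D, v ≠ x ∧ v ≠ y ∧ v ≠ z := by
    intro v hv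
    simpa using (hDs v hv).2
  have inS : ∀ v, v ∈ sp G → v ≠ x → v ≠ y → v ≠ z → v ∈ sp G \ {x, y, z} := by
    intro v h1 h2 h3 h4
    exact ⟨h1, by simp [h2, h3, h4]⟩
  have htn : t ≠ x ∧ t ≠ y ∧ t ≠ z := by simpa using ht.2
  have hzv : ∃ v ∈ D, G.Adj z v := by
    by_contra hnv
    push Not at hnv
    refine htD (h3 x y (fun v => v ∈ D) ⟨d, ⟨(hDs d hd).1, ?_⟩, hd⟩ ?_ t ⟨ht.1, ?_⟩)
    · simp [(Dn d hd).1, (Dn d hd).2.1]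
    · intro u w hu hw huw huD
      have hw' : w ≠ x ∧ w ≠ y := by simpa using hw.2
      refine hDcl u w huD (inS w hw.1 hw'.1 hw'.2 ?_) huw
      rintro rfl
      exact hnv u huD huw.symm
    · simp [htn.1, htn.2.1]
  obtain ⟨v, hvD, hzv⟩ := hzv
  obtain ⟨w, hw⟩ := hno z v hzv
  obtain ⟨D0, hD01, ⟨v0, hv0⟩, ⟨w0, hw0, hDw0⟩, hcl0⟩ := not_Cj hw
  -- pick the side avoiding x and y
  obtain ⟨D', hD'1, ⟨v1, hv1⟩, ⟨w1, hw1, hDw1⟩, hcl1, hx, hy⟩ : ∃ D' : V → Prop,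
      (∀ u, D' u → u ∈ sp G \ {z, v, w}) ∧ (∃ u, D' u) ∧ (∃ u, u ∈ sp G \ {z, v, w} ∧ ¬ D' u) ∧
      (∀ u t, D' u → t ∈ sp G \ {z, v, w} → G.Adj u t → D' t) ∧ ¬ D' x ∧ ¬ D' y := by
    by_cases hside : D0 x ∨ D0 y
    · refine ⟨fun u => u ∈ sp G \ {z, v, w} ∧ ¬ D0 u, fun u h => h.1, ⟨w0, hw0, hDw0⟩,
        ⟨v0, hD01 v0 hv0, fun h => h.2 hv0⟩, ?_, ?_, ?_⟩
      · rintro a b ⟨ha, hDa⟩ hb hab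
        exact ⟨hb, fun h => hDa (hcl0 b a h ha hab.symm)⟩
      · rintro ⟨h1, h2⟩
        rcases hside with h | h
        · exact h2 h
        · exact h2 (hcl0 y x h h1 hxy.symm)
      · rintro ⟨h1, h2⟩
        rcases hside with h | h
        · exact h2 (hcl0 x y h h1 hxy)
        · exact h2 h
    · push Not at hside
      exact ⟨D0, hD01, ⟨v0, hv0⟩, ⟨w0, hw0, hDw0⟩, hcl0, hside.1, hside.2⟩
  have D'n : ∀ u, D' u → u ≠ z ∧ u ≠ v ∧ u ≠ w := by
    intro u hu
    simpa using (hD'1 u hu).2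
  have hw1n : w1 ≠ z ∧ w1 ≠ v ∧ w1 ≠ w := by simpa using hw1.2
  have hvd : ∃ u, D' u ∧ G.Adj v u := by
    by_contra hnv
    push Not at hnv
    refine hDw1 (h3 z w D' ⟨v1, ⟨(hD'1 v1 hv1).1, ?_⟩, hv1⟩ ?_ w1 ⟨hw1.1, ?_⟩)
    · simp [(D'n v1 hv1).1, (D'n v1 hv1).2.2]
    · intro a b ha hb hab hDa
      have hb' : b ≠ z ∧ b ≠ w := by simpa using hb.2
      refine hcl1 a b hDa ⟨hb.1, ?_⟩ hab
      have : b ≠ v := by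
        rintro rfl
        exact hnv a hDa hab.symm
      simp [this, hb'.1, hb'.2]
    · simp [hw1n.1, hw1n.2.2]
  obtain ⟨e, he, hve⟩ := hvd
  have inD : ∀ a b, a ∈ D → G.Adj a b → D' b → b ∈ D := by
    intro a b ha hab hb
    refine hDcl a b ha (inS b ⟨a, hab.symm⟩ ?_ ?_ (D'n b hb).1) hab
    · rintro rfl; exact hx hb
    · rintro rfl; exact hy hb
  have good2 : Good (D.filter D') := by
    refine ⟨z, v, w, hzv, ⟨e, ?_⟩, ?_, ?_, w1, hw1, ?_⟩
    · rw [Finset.mem_filter]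
      exact ⟨inD v e hvD hve he, he⟩
    · intro a ha
      exact hD'1 a (Finset.mem_filter.1 ha).2
    · intro a b ha hb hab
      rw [Finset.mem_filter] at ha ⊢
      have := hcl1 a b ha.2 hb hab
      exact ⟨inD a b ha.1 hab this, this⟩
    · intro h
      exact hDw1 (Finset.mem_filter.1 h).2
  have hlt : (D.filter D').card < D.card := by
    apply Finset.card_lt_card
    refine ⟨Finset.filter_subset _ _, fun h => ?_⟩
    exact (D'n v (Finset.mem_filter.1 (h hvD)).2).2.1 rfl
  have := hmin good2 hlt.le
  omega

end

end Dow

namespace Dow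

open scoped Classical

noncomputable section

set_option linter.unusedSectionVars false
set_option linter.unusedVariables false

variable {V : Type} [Fintype V]

theorem nb {G : SimpleGraph V} {R : Set V} (h : Cj G R) {v t : V} (hv : v ∈ R) (ht : t ∈ R)
    (hvt : v ≠ t) : ∃ u, G.Adj v u ∧ u ∈ R := by
  by_contra hno
  push Not at hno
  refine hvt.symm (h (fun w => w = v) ⟨v, hv, rfl⟩ ?_ t ht)
  rintro a b ha hb hab rfl
  exact absurd hb (hno b hab)

theorem nb3 {G : SimpleGraph V} (h3 : C3 G) {v t a b : V} (hv : v ∈ sp G) (ht : t ∈ sp G)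
    (hvt : v ≠ t) (hva : v ≠ a) (hvb : v ≠ b) (hta : t ≠ a) (htb : t ≠ b) :
    ∃ u, G.Adj v u ∧ u ≠ a ∧ u ≠ b := by
  obtain ⟨u, hu, hu2⟩ := nb (h3 a b) (v := v) (t := t) ⟨hv, by simp [hva, hvb]⟩
    ⟨ht, by simp [hta, htb]⟩ hvt
  exact ⟨u, hu, by simpa using hu2.2⟩

theorem Cj.insert {G : SimpleGraph V} {R : Set V} (h : Cj G R) {y a : V} (ha : a ∈ R)
    (hya : G.Adj y a) : Cj G (insert y R) := by
  rintro D ⟨v, hv, hD⟩ hcl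
  have my : y ∈ Insert.insert y R := by simp
  have ma : a ∈ Insert.insert y R := by simp [ha]
  have h1 : D y → D a := hcl y a my ma hya
  have h2 : D a → D y := hcl a y ma my hya.symm
  have hR : ∀ w, w ∈ R → D w := by
    refine h D ?_ (fun v w hv hw hvw => hcl v w (by simp [hv]) (by simp [hw]) hvw)
    rcases hv with rfl | hv
    · exact ⟨a, ha, h1 hD⟩
    · exact ⟨v, hv, hD⟩
  rintro w (rfl | hw)
  · exact h2 (hR a ha)
  · exact hR w hw

/-- contraction of `xy` -/
def con (G : SimpleGraph V) (x y : V) : SimpleGraph V where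
  Adj u v := u ≠ v ∧ u ≠ y ∧ v ≠ y ∧ (G.Adj u v ∨ (u = x ∧ G.Adj y v) ∨ (v = x ∧ G.Adj y u))
  symm := ⟨fun u v h => ⟨h.1.symm, h.2.2.1, h.2.1, by
    rcases h.2.2.2 with h | h | h
    · exact Or.inl h.symm
    · exact Or.inr (Or.inr h)
    · exact Or.inr (Or.inl h)⟩⟩
  loopless := ⟨fun u h => h.1 rfl⟩

theorem con_planar {G : SimpleGraph V} (hp : G.IsPlanar) {x y : V} (hxy : G.Adj x y) :
    (con G x y).IsPlanar := by
  set ψ : V → Set V := fun v => if v = x then {x, y} else {v} with hψ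
  have ψx : ψ x = {x, y} := by simp [hψ]
  have ψn : ∀ v, v ≠ x → ψ v = {v} := fun v hv => by simp [hψ, hv]
  have ψs : ∀ v, v ∈ ψ v := by
    intro v
    by_cases hv : v = x
    · subst hv; rw [ψx]; simp
    · rw [ψn v hv]; rfl
  refine planar_trans hp ψ ?_ ?_ ?_
  · intro v _
    refine ⟨⟨v, ψs v⟩, ?_⟩
    by_cases hv : v = x
    · subst hv; rw [ψx]
      exact Cj.insert (Cj.singleton G y) rfl hxy
    · rw [ψn v hv]; exact Cj.singleton _ _
  · rintro u v huv ⟨u', hu⟩ ⟨v', hv⟩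
    have huy := hu.2.1
    have hvy := hv.2.1
    by_cases hua : u = x
    · subst hua
      rw [ψx, ψn v huv.symm, Set.disjoint_singleton_right]
      simp [huv.symm, hvy]
    · by_cases hva : v = x
      · subst hva
        rw [ψx, ψn u huv, Set.disjoint_singleton_left]
        simp [huv, huy]
      · rw [ψn u hua, ψn v hva]
        simpa using huv
  · rintro u v ⟨_, _, _, h | ⟨rfl, h⟩ | ⟨rfl, h⟩⟩
    · exact ⟨u, ψs u, v, ψs v, h⟩
    · exact ⟨y, by rw [ψx]; simp, v, ψs v, h⟩
    · exact ⟨u, ψs u, y, by rw [ψx]; simp, h.symm⟩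

/-- The final configuration: an edge `xy` and a cycle. -/
structure Whl (G : SimpleGraph V) (x y : V) : Prop where
  hxy : G.Adj x y
  reg : ∀ v, v ∈ sp G \ {x, y} → ∃ a b, a ≠ b ∧ a ∈ sp G \ {x, y} ∧ b ∈ sp G \ {x, y} ∧
    ∀ u, u ∈ sp G \ {x, y} → (G.Adj v u ↔ u = a ∨ u = b)
  att : ∀ v, v ∈ sp G \ {x, y} → G.Adj v x ∨ G.Adj v y
  cB : Cj G (sp G \ {x, y})
  cBz : ∀ z, Cj G ((sp G \ {x, y}) \ {z})

theorem contract_step {G : SimpleGraph V} (hp : G.IsPlanar) (ih : IH G) (h3 : C3 G) {x y : V}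
    (hxy : G.Adj x y) (hT : ∀ z, Cj G (sp G \ {x, y, z}))
    (h5 : ∀ a b c d, ∃ t ∈ sp G, t ≠ a ∧ t ≠ b ∧ t ≠ c ∧ t ≠ d) :
    HasDual G ∨ Whl G x y := by
  have nxy := hxy.ne
  have hxs : x ∈ sp G := ⟨y, hxy⟩
  have hys : y ∈ sp G := ⟨x, hxy.symm⟩
  set B := sp G \ {x, y} with hB
  have memB : ∀ v, v ∈ B ↔ v ∈ sp G ∧ v ≠ x ∧ v ≠ y := by
    intro v; simp [hB]
  set Q := con G x y with hQ
  have hmu : mu Q < mu G := by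
    apply mu_lt_of_sp
    refine ⟨?_, fun h => ?_⟩
    · rintro v ⟨u, hu⟩
      rcases hu with ⟨_, _, _, h | ⟨rfl, h⟩ | ⟨rfl, h⟩⟩
      · exact ⟨u, h⟩
      · exact hxs
      · exact ⟨y, h.symm⟩
    · obtain ⟨u, hu⟩ := h hys
      exact hu.2.1 rfl
  obtain ⟨ι, _, l, r, hd⟩ := ih Q (con_planar hp hxy) hmu
  set H := dv Q x with hH
  have Hadj : ∀ u v, H.Adj u v ↔ G.Adj u v ∧ u ≠ x ∧ u ≠ y ∧ v ≠ x ∧ v ≠ y := by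
    intro u v
    constructor
    · rintro ⟨⟨h1, h2, h3, h4⟩, h5, h6⟩
      rcases h4 with h | h | h
      · exact ⟨h, h5, h2, h6, h3⟩
      · exact absurd h.1 h5
      · exact absurd h.1 h6
    · rintro ⟨h, h1, h2, h3, h4⟩
      exact ⟨⟨h.ne, h2, h4, Or.inl h⟩, h1, h3⟩
  have HG : H ≤ G := fun u v h => ((Hadj u v).1 h).1
  have HQ : H ≤ Q := dv_le _ _
  have HB : ∀ u v, H.Adj u v → u ∈ B := fun u v h =>
    (memB u).2 ⟨⟨v, HG h⟩, ((Hadj u v).1 h).2.1, ((Hadj u v).1 h).2.2.1⟩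
  have upH : ∀ R : Set V, (∀ v ∈ R, v ≠ x ∧ v ≠ y) → Cj G R → Cj H R := by
    intro R hR hc D hD hcl
    refine hc D hD (fun v w hv hw hvw => hcl v w hv hw ((Hadj v w).2 ⟨hvw, ?_⟩))
    have h1 := hR v hv
    have h2 := hR w hw
    exact ⟨h1.1, h1.2, h2.1, h2.2⟩
  have cB : Cj G B := h3 x y
  have cBz : ∀ z, Cj G (B \ {z}) := by
    intro z
    have : B \ {z} = sp G \ {x, y, z} := by
      ext v; simp [hB]; tauto
    rw [this]; exact hT z
  have hcB : Cj H B := upH B (fun v hv => ((memB v).1 hv).2) cB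
  have hcBz : ∀ z, Cj H (B \ {z}) := fun z =>
    upH _ (fun v hv => ((memB v).1 hv.1).2) (cBz z)
  -- degrees in H
  have Hdeg : ∀ v a, v ∈ B → v ≠ a → ∃ u, H.Adj v u ∧ u ≠ a ∧ u ∈ B := by
    intro v a hv hva
    obtain ⟨t, ht, h1, h2, h3, h4⟩ := h5 x y v a
    obtain ⟨u, hu, huR⟩ := nb (hcBz a) (v := v) (t := t) ⟨hv, hva⟩ ⟨(memB t).2 ⟨ht, h1, h2⟩, h4⟩
      h3.symm
    exact ⟨u, hu, huR.2, huR.1⟩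
  have Hdeg2 : ∀ v, v ∈ B → ∃ a b, a ≠ b ∧ H.Adj v a ∧ H.Adj v b ∧ a ∈ B ∧ b ∈ B := by
    intro v hv
    obtain ⟨a, ha, _, haB⟩ := Hdeg v x hv ((memB v).1 hv).2.1
    obtain ⟨b, hb, hba, hbB⟩ := Hdeg v a hv ha.ne
    exact ⟨a, b, hba.symm, ha, hb, haB, hbB⟩
  -- neighbours of x in Q
  have Qx : ∀ a, Q.Adj x a ↔ a ≠ x ∧ a ≠ y ∧ (G.Adj x a ∨ G.Adj y a) := by
    intro a
    constructor
    · rintro ⟨h1, h2, h3, h4⟩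
      rcases h4 with h | h | h
      · exact ⟨h1.symm, h3, Or.inl h⟩
      · exact ⟨h1.symm, h3, Or.inr h.2⟩
      · exact absurd h.1 h1.symm
    · rintro ⟨h1, h2, h | h⟩
      · exact ⟨h1.symm, nxy, h2, Or.inl h⟩
      · exact ⟨h1.symm, nxy, h2, Or.inr (Or.inl ⟨rfl, h⟩)⟩
  have QxB : ∀ a, Q.Adj x a → a ∈ B := by
    intro a ha
    have := (Qx a).1 ha
    refine (memB a).2 ⟨?_, this.1, this.2.1⟩
    rcases this.2.2 with h | h
    · exact ⟨x, h.symm⟩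
    · exact ⟨y, h.symm⟩
  have hxB : x ∉ B := fun h => ((memB x).1 h).2.1 rfl
  have hyB : y ∉ B := fun h => ((memB y).1 h).2.2 rfl
  have hdH := dual_dv hd (hcB.mono HQ) hxB QxB
  rw [← hH] at hdH
  set L := fun e => collapse Q l r x (l e) with hL
  set M := fun e => collapse Q l r x (r e) with hM
  set C := cob H L M (fi none) with hC
  have hCc : cyc H C := hdH.1 _
  have Cne : ∀ e, C e ≠ 0 → e ∈ H.edgeSet := by
    intro e he
    by_contra h
    exact he (hCc.1 e h)
  have hN : ∀ a, Q.Adj x a → ∃ u, C s(a, u) ≠ 0 := by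
    intro a ha
    have haB := QxB a ha
    have hax := ((memB a).1 haB).2.1
    obtain ⟨t, ht, ht1, ht2, ht3, ht4⟩ := h5 x y a a
    obtain ⟨b, hb, hby, hba⟩ := nb3 h3 (v := x) (t := t) (a := y) (b := a) hxs ht ht1.symm nxy
      hax.symm ht2 ht3
    have hQb : Q.Adj x b := (Qx b).2 ⟨hb.ne', hby, Or.inl hb⟩
    have hne := ends_ne hd (hcB.mono HQ) hxB haB (QxB b hQb) ha hQb hba.symm
    set f := l s(x, a) with hf
    have hfa : cob Q l r (fi f) s(x, a) = 1 := cob_fi_eq_one.2 ⟨ha, Or.inl ⟨rfl, hne.symm⟩⟩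
    have hev := (hd.1 (fi f)).2 a
    have : ∃ u, u ≠ x ∧ cob Q l r (fi f) s(a, u) ≠ 0 := by
      by_contra hno
      push Not at hno
      unfold bd at hev
      rw [Finset.sum_eq_single x (fun u _ hu => hno u hu) (by simp), Sym2.eq_swap, hfa] at hev
      exact absurd hev (by decide)
    obtain ⟨u, hux, hu⟩ := this
    have hu1 := cob_fi_eq_one.1 (z2ne.1 hu)
    have hQau : Q.Adj a u := hu1.1
    have hHau : H.Adj a u := ⟨hQau, hax, hux⟩
    refine ⟨u, ?_⟩
    obtain ⟨w, hw, hwu, hwB⟩ := Hdeg a u haB hHau.ne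
    have hne2 := ends_ne hdH (hcBz a) (v := a) (a := u) (b := w) (by simp)
      ⟨HB _ _ hHau.symm, hHau.ne'⟩ ⟨hwB, hw.ne'⟩ hHau hw hwu.symm
    have hfT : aroundF Q l r x f := ⟨a, ha, Or.inl rfl⟩
    have : C s(a, u) = 1 := by
      apply cob_fi_eq_one.2
      refine ⟨hHau, ?_⟩
      rcases hu1.2 with ⟨h1, h2⟩ | ⟨h1, h2⟩
      · have hLn : L s(a, u) = none := by simp [hL, h1, collapse, hfT]
        exact Or.inl ⟨hLn, fun h => hne2 (hLn.trans h.symm)⟩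
      · have hMn : M s(a, u) = none := by simp [hM, h2, collapse, hfT]
        exact Or.inr ⟨fun h => hne2 (h.trans hMn.symm), hMn⟩
    rw [this]; decide
  have hC0 : C ≠ 0 := by
    intro h0
    obtain ⟨t, ht, ht1, ht2, ht3, ht4⟩ := h5 x y x x
    obtain ⟨b, hb, hby, _⟩ := nb3 h3 (v := x) (t := t) (a := y) (b := y) hxs ht ht1.symm nxy
      nxy ht2 ht2
    obtain ⟨u, hu⟩ := hN b ((Qx b).2 ⟨hb.ne', hby, Or.inl hb⟩)
    rw [h0] at hu
    exact hu rfl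
  have hmin : ∀ Z, cyc H Z → Z ≠ 0 → (∀ e, Z e ≠ 0 → C e ≠ 0) → Z = C := by
    intro Z hZ hZ0 hZC
    exact min_face hdH hcB hcBz HB none hZ hZ0 (fun e he => z2ne.1 (hZC e he))
  set VC : Set V := {v | ∃ u, C s(v, u) ≠ 0} with hVC
  set S := rs H (fun e => C e ≠ 0) with hS
  have hSVC : Cj S VC := by
    rintro D ⟨v, ⟨v', hv'⟩, hDv⟩ hcl w ⟨w', hw'⟩
    set Z : Sym2 V → ZMod 2 := fun e => if ∃ u ∈ e, D u then C e else 0 with hZ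
    have Sadj : ∀ a b, C s(a, b) ≠ 0 → S.Adj a b := fun a b h => ⟨Cne _ h, h⟩
    have step : ∀ a b, C s(a, b) ≠ 0 → D a → D b := by
      intro a b h
      exact hcl a b ⟨b, h⟩ ⟨a, by rw [Sym2.eq_swap]; exact h⟩ (Sadj a b h)
    have hZD : ∀ a, D a → ∀ u, Z s(a, u) = C s(a, u) := by
      intro a ha u
      have : ∃ t ∈ s(a, u), D t := ⟨a, by simp, ha⟩
      simp only [hZ, this, if_true]
    have hZn : ∀ a, ¬ D a → ∀ u, Z s(a, u) = 0 := by
      intro a ha u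
      by_contra h
      have hc : C s(a, u) ≠ 0 := by
        intro h0
        apply h
        simp only [hZ, h0, ite_self]
      have : ∃ t ∈ s(a, u), D t := by
        by_contra hno
        apply h
        simp only [hZ, hno, if_false]
      obtain ⟨t, ht, hDt⟩ := this
      rw [Sym2.mem_iff] at ht
      rcases ht with rfl | rfl
      · exact ha hDt
      · exact ha (step t a (by rw [Sym2.eq_swap]; exact hc) hDt)
    have hZc : cyc H Z := by
      refine ⟨fun e he => ?_, fun a => ?_⟩
      · simp only [hZ, hCc.1 e he, ite_self]
      · by_cases ha : D a
        · rw [← hCc.2 a]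
          unfold bd
          exact Finset.sum_congr rfl (fun u _ => hZD a ha u)
        · unfold bd
          exact Finset.sum_eq_zero (fun u _ => hZn a ha u)
    have hZC : Z = C := by
      apply hmin Z hZc
      · intro h0
        have := hZD v hDv v'
        rw [h0] at this
        exact hv' this.symm
      · intro e he h0
        apply he
        simp only [hZ, h0, ite_self]
    by_contra hDw
    have := hZn w hDw w'
    rw [hZC] at this
    exact hw' this
  by_cases hall : ∀ e ∈ H.edgeSet, C e ≠ 0
  · right
    have reg : ∀ v, v ∈ B → ∃ a b, a ≠ b ∧ a ∈ B ∧ b ∈ B ∧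
        ∀ u, u ∈ B → (G.Adj v u ↔ u = a ∨ u = b) := by
      intro v hv
      obtain ⟨a, b, hab, ha, hb, haB, hbB⟩ := Hdeg2 v hv
      refine ⟨a, b, hab, haB, hbB, fun u hu => ⟨fun huv => ?_, ?_⟩⟩
      · obtain ⟨z, hz, hz1, hz2, hz3⟩ := LCz (hcBz v) (v := v) (by simp) ⟨haB, ha.ne'⟩
          ⟨hbB, hb.ne'⟩ ha hb hab
        have hzC : z = C := by
          apply hmin z hz
          · intro h0
            rw [h0] at hz1
            simp at hz1
          · intro e he
            apply hall
            by_contra h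
            exact he (hz.1 e h)
        by_contra hno
        push Not at hno
        have h0 := hz3 u hno.1 hno.2
        rw [hzC] at h0
        have h1 := (memB v).1 hv
        have h2 := (memB u).1 hu
        exact hall s(v, u) ((Hadj v u).2 ⟨huv, h1.2.1, h1.2.2, h2.2.1, h2.2.2⟩) h0
      · rintro (rfl | rfl)
        · exact HG ha
        · exact HG hb
    have att : ∀ v, v ∈ B → G.Adj v x ∨ G.Adj v y := by
      intro v hv
      obtain ⟨a, b, hab, haB, hbB, hr⟩ := reg v hv
      have hvb := (memB v).1 hv
      have hva : v ≠ a := ((hr a haB).2 (Or.inl rfl)).ne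
      have hvb' : v ≠ b := ((hr b hbB).2 (Or.inr rfl)).ne
      obtain ⟨u, hu, hua, hub⟩ := nb3 h3 (v := v) (t := x) (a := a) (b := b) hvb.1 hxs hvb.2.1
        hva hvb' (((memB a).1 haB).2.1).symm (((memB b).1 hbB).2.1).symm
      by_cases h1 : u = x
      · subst h1; exact Or.inl hu
      by_cases h2 : u = y
      · subst h2; exact Or.inr hu
      rcases (hr u ((memB u).2 ⟨⟨v, hu.symm⟩, h1, h2⟩)).1 hu with h | h
      · exact absurd h hua
      · exact absurd h hub
    exact ⟨hxy, reg, att, cB, cBz⟩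
  · left
    push Not at hall
    obtain ⟨e0, he0, hCe0⟩ := hall
    have HxE : ∀ e ∈ H.edgeSet, x ∉ e ∧ y ∉ e := by
      intro e he
      induction e with | _ a b =>
      have := (Hadj a b).1 he
      simp only [Sym2.mem_iff]
      exact ⟨by rintro (h | h) <;> subst h <;> tauto, by rintro (h | h) <;> subst h <;> tauto⟩
    set K := rs G (fun e => x ∈ e ∨ y ∈ e ∨ C e ≠ 0) with hK
    have hKG : K ≤ G := rs_le _ _
    have hSK : S ≤ K := fun u v h => ⟨HG h.1, Or.inr (Or.inr h.2)⟩
    have hCK : cyc K C := by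
      refine ⟨fun e he => ?_, hCc.2⟩
      by_contra h
      exact he (rs_mem.2 ⟨SimpleGraph.edgeSet_mono HG (Cne e h), Or.inr (Or.inr h)⟩)
    have hlt : K < G := lt_of_le_edge hKG (SimpleGraph.edgeSet_mono HG he0) (by
      intro h
      have h1 := (rs_mem.1 h).2
      have h2 := HxE e0 he0
      tauto)
    obtain ⟨κ, _, l', r', hdK⟩ := ih K (planar_mono hp hKG) (mu_lt_of_lt hlt)
    have Kx : ∀ u, K.Adj x u ↔ G.Adj x u := fun u => ⟨fun h => h.1, fun h => ⟨h, Or.inl (by simp)⟩⟩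
    have Ky : ∀ u, K.Adj y u ↔ G.Adj y u :=
      fun u => ⟨fun h => h.1, fun h => ⟨h, Or.inr (Or.inl (by simp))⟩⟩
    have nVx : ∀ a, G.Adj x a → a ≠ y → a ∈ VC := fun a h h1 =>
      hN a ((Qx a).2 ⟨h.ne', h1, Or.inl h⟩)
    have nVy : ∀ a, G.Adj y a → a ≠ x → a ∈ VC := fun a h h1 =>
      hN a ((Qx a).2 ⟨h1, h.ne', Or.inr h⟩)
    have VCB : ∀ a, a ∈ VC → a ∈ B := by
      rintro a ⟨u, hu⟩
      exact HB a u (Cne _ hu)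
    obtain ⟨t, ht, ht1, ht2, ht3, ht4⟩ := h5 x y x x
    obtain ⟨bx, hbx, hbxy, _⟩ := nb3 h3 (v := x) (t := t) (a := y) (b := y) hxs ht ht1.symm nxy
      nxy ht2 ht2
    obtain ⟨by', hby, hbyx, _⟩ := nb3 h3 (v := y) (t := t) (a := x) (b := x) hys ht ht2.symm
      nxy.symm nxy.symm ht1 ht1
    have hSVK : Cj K VC := hSVC.mono hSK
    obtain ⟨i, hi⟩ := single_bridge hdK hCK hC0 (fun Z hZ hZ0 hZC => hmin Z ⟨fun e he => by
        by_contra h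
        exact he (Cne e (hZC e h)), hZ.2⟩ hZ0 hZC) (R := {x, y})
      (Cj.insert (Cj.singleton K y) rfl ((Kx y).2 hxy)) ⟨x, y, by simp, (Kx y).2 hxy⟩
      (by
        rintro v u hv
        by_contra h
        have := VCB v ⟨u, h⟩
        rcases hv with rfl | rfl
        · exact hxB this
        · exact hyB this)
      (by
        rintro u v ⟨h1, h2⟩ h0
        simp only [Sym2.mem_iff] at h2
        simp only [Set.mem_insert_iff, Set.mem_singleton_iff]
        rcases h2 with (h | h) | (h | h) | h
        · exact Or.inl (Or.inl h.symm)
        · exact Or.inr (Or.inl h.symm)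
        · exact Or.inl (Or.inr h.symm)
        · exact Or.inr (Or.inr h.symm)
        · exact absurd h0 h)
      (by
        rintro v (rfl | hv)
        · refine ⟨insert y VC, Cj.insert hSVK (nVy _ hby hbyx) ((Ky _).2 hby), ?_, ?_⟩
          · rintro (h | h)
            · exact nxy h
            · exact hxB (VCB _ h)
          · intro u hu
            by_cases h : u = y
            · exact Or.inl h
            · exact Or.inr (nVx u hu.1 h)
        · rw [Set.mem_singleton_iff] at hv
          subst hv
          refine ⟨insert x VC, Cj.insert hSVK (nVx _ hbx hbxy) ((Kx _).2 hbx), ?_, ?_⟩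
          · rintro (h | h)
            · exact nxy h.symm
            · exact hyB (VCB _ h)
          · intro u hu
            by_cases h : u = x
            · exact Or.inl h
            · exact Or.inr (nVy u hu.1 h))
    refine glue (G := G) (G1 := K) (G2 := H) (S := S) hdK hdH hSVC ?_ ?_ ?_ i none ?_ ?_
    · intro e
      constructor
      · intro he
        by_cases hx : x ∈ e
        · exact Or.inl (rs_mem.2 ⟨he, Or.inl hx⟩)
        by_cases hy : y ∈ e
        · exact Or.inl (rs_mem.2 ⟨he, Or.inr (Or.inl hy)⟩)
        right
        induction e with | _ a b =>
        simp only [Sym2.mem_iff, not_or] at hx hy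
        exact (Hadj a b).2 ⟨he, Ne.symm hx.1, Ne.symm hy.1, Ne.symm hx.2, Ne.symm hy.2⟩
      · rintro (h | h)
        · exact (rs_mem.1 h).1
        · exact SimpleGraph.edgeSet_mono HG h
    · intro e
      rw [hS, hK, rs_mem, rs_mem]
      constructor
      · rintro ⟨h1, h2⟩
        exact ⟨⟨SimpleGraph.edgeSet_mono HG h1, Or.inr (Or.inr h2)⟩, h1⟩
      · rintro ⟨⟨_, h2⟩, h1⟩
        have := HxE e h1
        exact ⟨h1, by tauto⟩
    · intro v hv
      by_cases hvH : ∃ u, H.Adj v u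
      · left
        obtain ⟨w, hw⟩ := hvH
        have hvB := (memB v).1 (HB v w hw)
        rintro u ⟨h1, h2⟩
        simp only [Sym2.mem_iff] at h2
        rcases h2 with (h | h) | (h | h) | h
        · exact hvB.2.1 h.symm
        · subst h; exact hv (nVx v h1.symm hvB.2.2)
        · exact hvB.2.2 h.symm
        · subst h; exact hv (nVy v h1.symm hvB.2.1)
        · exact hv ⟨u, h⟩
      · right
        push Not at hvH
        exact hvH
    · intro e he
      have h1 := z2ne.1 (rs_mem.1 he).2
      rw [hi, cob_fi_eq_one] at h1
      tauto
    · intro e he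
      have h1 := z2ne.1 (rs_mem.1 he).2
      rw [hC, cob_fi_eq_one] at h1
      tauto

end

end Dow

namespace Dow

open scoped Classical

noncomputable section

set_option linter.unusedSectionVars false
set_option linter.unusedVariables false

variable {V : Type} [Fintype V]

theorem Whl.symm {G : SimpleGraph V} {x y : V} (h : Whl G x y) : Whl G y x := by
  have e : ({y, x} : Set V) = {x, y} := Set.pair_comm y x
  obtain ⟨h1, h2, h3, h4, h5⟩ := h
  refine ⟨h1.symm, ?_, ?_, ?_, ?_⟩ <;> rw [e]
  · exact h2
  · exact fun v hv => (h3 v hv).symm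
  · exact h4
  · exact h5

theorem Whl.mem {G : SimpleGraph V} {x y v : V} : v ∈ sp G \ {x, y} ↔ v ∈ sp G ∧ v ≠ x ∧ v ≠ y := by
  simp

/-- F0 -/
theorem Whl.F0 {G : SimpleGraph V} (hp : G.IsPlanar) (ih : IH G) (h3 : C3 G) {x y : V}
    (h : Whl G x y) {u v : V} (hu : u ∈ sp G \ {x, y}) (hv : v ∈ sp G \ {x, y}) (huv : G.Adj u v)
    (h1 : ¬ G.Adj u y) (h2 : ¬ G.Adj v y) : HasDual G := by
  have hux : G.Adj u x := (h.att u hu).resolve_right h1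
  have hvx : G.Adj v x := (h.att v hv).resolve_right h2
  have mu := Whl.mem.1 hu
  have mv := Whl.mem.1 hv
  -- other neighbour of v and u
  have oth : ∀ v u, v ∈ sp G \ {x, y} → u ∈ sp G \ {x, y} → G.Adj v u → ∃ w, w ≠ u ∧
      w ∈ sp G \ {x, y} ∧ ∀ t, t ∈ sp G \ {x, y} → (G.Adj v t ↔ t = u ∨ t = w) := by
    intro v u hv hu hvu
    obtain ⟨a, b, hab, ha, hb, hr⟩ := h.reg v hv
    rcases (hr u hu).1 hvu with rfl | rfl
    · exact ⟨b, hab.symm, hb, hr⟩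
    · exact ⟨a, hab, ha, fun t ht => (hr t ht).trans or_comm⟩
  obtain ⟨w, hwu, hw, hrv⟩ := oth v u hv hu huv.symm
  obtain ⟨y', hyv, hy', hru⟩ := oth u v hu hv huv
  have mw := Whl.mem.1 hw
  have my := Whl.mem.1 hy'
  refine redR hp ih h3 (u := u) (v := v) (x := x) (w := w) (y := y') huv hux.symm hvx.symm ?_ hwu
    mw.2.1 ((hru y' hy').2 (Or.inr rfl)) hyv my.2.1
  intro t
  constructor
  · intro ht
    by_cases htx : t = x
    · exact Or.inr (Or.inl htx)
    by_cases hty : t = y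
    · subst hty; exact absurd ht h2
    rcases (hrv t (Whl.mem.2 ⟨⟨v, ht.symm⟩, htx, hty⟩)).1 ht with h | h
    · exact Or.inl h
    · exact Or.inr (Or.inr h)
  · rintro (rfl | rfl | rfl)
    · exact huv.symm
    · exact hvx
    · exact (hrv _ hw).2 (Or.inr rfl)

theorem Cj.leaf {G : SimpleGraph V} {R : Set V} (h : Cj G R) {r n : V}
    (hn : ∀ u, u ∈ R → G.Adj r u → u = n) : Cj G (R \ {r}) := by
  rintro D ⟨v, hv, hD⟩ hcl w hw
  have := h (fun t => (t = r ∧ (n ∈ R → G.Adj r n → n ≠ r → D n)) ∨ (t ≠ r ∧ D t)) ⟨v, hv.1, Or.inr ⟨hv.2, hD⟩⟩ ?_ w hw.1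
  · rcases this with h | h
    · exact absurd h.1 hw.2
    · exact h.2
  · rintro a b ha hb hab (⟨rfl, h1⟩ | ⟨h1, h2⟩)
    · right
      have := hn b hb hab
      subst this
      exact ⟨hab.ne', h1 hb hab hab.ne'⟩
    · by_cases hbr : b = r
      · subst hbr
        left
        refine ⟨rfl, fun _ _ _ => ?_⟩
        rw [← hn a ha hab.symm]
        exact h2
      · exact Or.inr ⟨hbr, hcl a b ⟨ha, h1⟩ ⟨hb, hbr⟩ hab h2⟩

/-- a K33 minor -/
theorem k33 {G : SimpleGraph V} (hp : G.IsPlanar) {a b c d e : V} {W : Set V} (hW : Cj G W)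
    (h1 : a ≠ b) (h2 : a ≠ c) (h3 : b ≠ c) (h4 : d ≠ e)
    (haW : a ∉ W) (hbW : b ∉ W) (hcW : c ∉ W) (hdW : d ∉ W) (heW : e ∉ W)
    (had : G.Adj a d) (hae : G.Adj a e) (hbd : G.Adj b d) (hbe : G.Adj b e)
    (hcd : G.Adj c d) (hce : G.Adj c e) (haw : ∃ w ∈ W, G.Adj a w) (hbw : ∃ w ∈ W, G.Adj b w)
    (hcw : ∃ w ∈ W, G.Adj c w) : False := by
  apply hp.2
  obtain ⟨wa, hwa, haw⟩ := haw
  obtain ⟨wb, hwb, hbw⟩ := hbw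
  obtain ⟨wc, hwc, hcw⟩ := hcw
  have p1 : ∃ x ∈ W, G.Adj a x := ⟨_, hwa, haw⟩
  have p2 : ∃ x ∈ W, G.Adj b x := ⟨_, hwb, hbw⟩
  have p3 : ∃ x ∈ W, G.Adj c x := ⟨_, hwc, hcw⟩
  have key : ∀ i j : Fin 3, ∃ x ∈ (![{a}, {b}, {c}] : Fin 3 → Set V) i,
      ∃ y ∈ (![{d}, {e}, W] : Fin 3 → Set V) j, G.Adj x y := by
    intro i j
    fin_cases i <;> fin_cases j <;> simp <;> assumption
  refine ⟨Sum.elim ![{a}, {b}, {c}] ![{d}, {e}, W], ?_, ?_, ?_, ?_⟩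
  · rintro (i | i) <;> fin_cases i <;> simp
    exact ⟨wa, hwa⟩
  · rintro (i | i) <;> fin_cases i <;> simp only [Sum.elim_inl, Sum.elim_inr] <;>
      first | exact Cj.induce_connected (Cj.singleton G _) ⟨_, rfl⟩ |
        exact Cj.induce_connected hW ⟨wa, hwa⟩
  · have s1 := had.ne
    have s2 := hae.ne
    have s3 := hbd.ne
    have s4 := hbe.ne
    have s5 := hcd.ne
    have s6 := hce.ne
    have s7 : ∀ {a : V} {W : Set V}, a ∉ W → ({a} : Set V) ∩ W = ∅ := by
      intro a W h; ext t; simp; rintro rfl; exact h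
    rintro (i | i) (j | j) hij <;> fin_cases i <;> fin_cases j <;>
      simp_all [Set.disjoint_iff_inter_eq_empty]
    all_goals (rintro rfl; tauto)
  · rintro (i | i) (j | j) hij
    · simp [completeBipartiteGraph] at hij
    · exact key i j
    · obtain ⟨x, hx, y, hy, h⟩ := key j i
      exact ⟨y, hy, x, hx, h.symm⟩
    · simp [completeBipartiteGraph] at hij

theorem k5 {G : SimpleGraph V} (hp : G.IsPlanar) {a b c d : V} {W : Set V} (hW : Cj G W)
    (haW : a ∉ W) (hbW : b ∉ W) (hcW : c ∉ W) (hdW : d ∉ W)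
    (hab : G.Adj a b) (hac : G.Adj a c) (had : G.Adj a d) (hbc : G.Adj b c) (hbd : G.Adj b d)
    (hcd : G.Adj c d) (haw : ∃ w ∈ W, G.Adj a w) (hbw : ∃ w ∈ W, G.Adj b w)
    (hcw : ∃ w ∈ W, G.Adj c w) (hdw : ∃ w ∈ W, G.Adj d w) : False := by
  apply hp.1
  obtain ⟨wa, hwa, haw⟩ := haw
  obtain ⟨wb, hwb, hbw⟩ := hbw
  obtain ⟨wc, hwc, hcw⟩ := hcw
  obtain ⟨wd, hwd, hdw⟩ := hdw
  refine ⟨![{a}, {b}, {c}, {d}, W], ?_, ?_, ?_, ?_⟩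
  · intro i; fin_cases i <;> simp
    exact ⟨wa, hwa⟩
  · intro i; fin_cases i <;>
      first | exact Cj.induce_connected (Cj.singleton G _) ⟨_, rfl⟩ |
        exact Cj.induce_connected hW ⟨wa, hwa⟩
  · have s1 := hab.ne
    have s2 := hac.ne
    have s3 := had.ne
    have s4 := hbc.ne
    have s5 := hbd.ne
    have s6 := hcd.ne
    intro i j hij
    fin_cases i <;> fin_cases j <;>
      simp_all [Set.disjoint_iff_inter_eq_empty]
    all_goals (rintro rfl; tauto)
  · have q1 : ∃ x ∈ W, G.Adj x a := ⟨_, hwa, haw.symm⟩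
    have q2 : ∃ x ∈ W, G.Adj x b := ⟨_, hwb, hbw.symm⟩
    have q3 : ∃ x ∈ W, G.Adj x c := ⟨_, hwc, hcw.symm⟩
    have q4 : ∃ x ∈ W, G.Adj x d := ⟨_, hwd, hdw.symm⟩
    have p1 : ∃ x ∈ W, G.Adj a x := ⟨_, hwa, haw⟩
    have p2 : ∃ x ∈ W, G.Adj b x := ⟨_, hwb, hbw⟩
    have p3 : ∃ x ∈ W, G.Adj c x := ⟨_, hwc, hcw⟩
    have p4 : ∃ x ∈ W, G.Adj d x := ⟨_, hwd, hdw⟩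
    intro i j hij
    have := hij.ne
    fin_cases i <;> fin_cases j <;> simp at this ⊢ <;>
      first | assumption | (apply SimpleGraph.Adj.symm; assumption)

theorem Whl.oth {G : SimpleGraph V} {x y : V} (h : Whl G x y) {v u : V}
    (hv : v ∈ sp G \ {x, y}) (hu : u ∈ sp G \ {x, y}) (hvu : G.Adj v u) : ∃ w, w ≠ u ∧
      w ∈ sp G \ {x, y} ∧ G.Adj v w ∧ ∀ t, t ∈ sp G \ {x, y} → G.Adj v t → t = u ∨ t = w := by
  obtain ⟨a, b, hab, ha, hb, hr⟩ := h.reg v hv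
  rcases (hr u hu).1 hvu with rfl | rfl
  · exact ⟨b, hab.symm, hb, (hr b hb).2 (Or.inr rfl), fun t ht => (hr t ht).1⟩
  · exact ⟨a, hab, ha, (hr a ha).2 (Or.inl rfl), fun t ht h => ((hr t ht).1 h).symm⟩

theorem Whl.two {G : SimpleGraph V} {x y : V} (h : Whl G x y) {v a b : V}
    (hv : v ∈ sp G \ {x, y}) (ha : a ∈ sp G \ {x, y}) (hb : b ∈ sp G \ {x, y})
    (hva : G.Adj v a) (hvb : G.Adj v b) (hab : a ≠ b) :
    ∀ t, t ∈ sp G \ {x, y} → G.Adj v t → t = a ∨ t = b := by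
  obtain ⟨w, hw, hwB, hvw, hr⟩ := h.oth hv ha hva
  rcases hr b hb hvb with h1 | h1
  · exact absurd h1.symm hab
  · rw [h1]; exact hr

theorem Whl.F1 {G : SimpleGraph V} (hp : G.IsPlanar) (ih : IH G) (h3 : C3 G) {x y : V}
    (h : Whl G x y) {q : V} (hq : q ∈ sp G \ {x, y}) (hqy : ¬ G.Adj q y) : HasDual G := by
  have hqx : G.Adj q x := (h.att q hq).resolve_right hqy
  have hxy := h.hxy
  have nxy := hxy.ne
  have hxs : x ∈ sp G := ⟨y, hxy⟩
  have hys : y ∈ sp G := ⟨x, hxy.symm⟩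
  have sw : ∀ v, v ∈ sp G \ {x, y} → v ∈ sp G \ {y, x} := fun v hv => by
    rw [Set.pair_comm]; exact hv
  obtain ⟨p, r, hpr, hpB, hrB, hrq⟩ := h.reg q hq
  have qp : G.Adj q p := (hrq p hpB).2 (Or.inl rfl)
  have qr : G.Adj q r := (hrq r hrB).2 (Or.inr rfl)
  by_cases hpy : G.Adj p y
  swap
  · exact h.F0 hp ih h3 hq hpB qp hqy hpy
  by_cases hry : G.Adj r y
  swap
  · exact h.F0 hp ih h3 hq hrB qr hqy hry
  have mq := Whl.mem.1 hq
  have mp := Whl.mem.1 hpB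
  have mr := Whl.mem.1 hrB
  by_cases hadj : G.Adj p r
  · have hBall : ∀ t, t ∈ sp G \ {x, y} → t = p ∨ t = q ∨ t = r := by
      refine h.cB (fun t => t = p ∨ t = q ∨ t = r) ⟨p, hpB, Or.inl rfl⟩ ?_
      rintro a b ha hb hab (rfl | rfl | rfl)
      · rcases h.two hpB hq hrB qp.symm hadj qr.ne b hb hab with h | h <;> simp [h]
      · rcases h.two hq hpB hrB qp qr hpr b hb hab with h | h <;> simp [h]
      · rcases h.two hrB hpB hq hadj.symm qr.symm qp.ne' b hb hab with h | h <;> simp [h]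
    have hall : ∀ t, t ∈ sp G → t = x ∨ t = y ∨ t = p ∨ t = q ∨ t = r := by
      intro t ht
      by_cases h1 : t = x
      · exact Or.inl h1
      by_cases h2 : t = y
      · exact Or.inr (Or.inl h2)
      exact Or.inr (Or.inr (hBall t (Whl.mem.2 ⟨ht, h1, h2⟩)))
    by_cases hpx : G.Adj p x
    · by_cases hrx : G.Adj r x
      · have e : sp G \ {p, q, r, y} = {x} := by
          ext t
          simp only [Set.mem_sdiff, Set.mem_insert_iff, Set.mem_singleton_iff]
          constructor
          · rintro ⟨ht, h2⟩
            have := hall t ht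
            tauto
          · rintro rfl
            exact ⟨hxs, by rintro (h | h | h | h) <;> subst h <;> tauto⟩
        refine redQ hp ih h3 (p := p) (q := q) (r := r) (t := y) qp.symm qr hry hpy.symm hadj
          mq.2.2 hqy ?_ ?_
        · rw [e]; exact Cj.singleton G x
        · rw [e]; exact ⟨x, rfl⟩
      · have e : sp G \ {q, x, p, r} = {y} := by
          ext t
          simp only [Set.mem_sdiff, Set.mem_insert_iff, Set.mem_singleton_iff]
          constructor
          · rintro ⟨ht, h2⟩
            have := hall t ht
            tauto
          · rintro rfl
            exact ⟨hys, by rintro (h | h | h | h) <;> subst h <;> tauto⟩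
        refine redQ hp ih h3 (p := q) (q := x) (r := p) (t := r) hqx hpx.symm hadj qr.symm qp
          mr.2.1.symm (fun h => hrx h.symm) ?_ ?_
        · rw [e]; exact Cj.singleton G y
        · rw [e]; exact ⟨y, rfl⟩
    · by_cases hrx : G.Adj r x
      · have e : sp G \ {q, x, r, p} = {y} := by
          ext t
          simp only [Set.mem_sdiff, Set.mem_insert_iff, Set.mem_singleton_iff]
          constructor
          · rintro ⟨ht, h2⟩
            have := hall t ht
            tauto
          · rintro rfl
            exact ⟨hys, by rintro (h | h | h | h) <;> subst h <;> tauto⟩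
        refine redQ hp ih h3 (p := q) (q := x) (r := r) (t := p) hqx hrx.symm hadj.symm qp.symm qr
          mp.2.1.symm (fun h => hpx h.symm) ?_ ?_
        · rw [e]; exact Cj.singleton G y
        · rw [e]; exact ⟨y, rfl⟩
      · exact h.symm.F0 hp ih h3 (sw _ hpB) (sw _ hrB) hadj hpx hrx
  · obtain ⟨p', hp'q, hp'B, pp', hp'⟩ := h.oth hpB hq qp.symm
    obtain ⟨r', hr'q, hr'B, rr', hr'⟩ := h.oth hrB hq qr.symm
    have hW0 := h.cBz q
    have hW1 : Cj G (((sp G \ {x, y}) \ {q}) \ {p}) := hW0.leaf (n := p') (by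
      intro u hu hpu
      exact (hp' u hu.1 hpu).resolve_left hu.2)
    have hW : Cj G ((((sp G \ {x, y}) \ {q}) \ {p}) \ {r}) := hW1.leaf (n := r') (by
      intro u hu hpu
      exact (hr' u hu.1.1 hpu).resolve_left hu.1.2)
    set W := (((sp G \ {x, y}) \ {q}) \ {p}) \ {r} with hWdef
    have p'W : p' ∈ W := ⟨⟨⟨hp'B, hp'q⟩, pp'.ne'⟩, by rintro rfl; exact hadj pp'⟩
    have r'W : r' ∈ W := ⟨⟨⟨hr'B, hr'q⟩, by rintro rfl; exact hadj rr'.symm⟩, rr'.ne'⟩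
    by_cases hWx : ∃ w ∈ W, G.Adj x w
    · exact (k33 hp hW (a := x) (b := p) (c := r) (d := q) (e := y) mp.2.1.symm mr.2.1.symm hpr
        mq.2.2 (fun h => (Whl.mem.1 h.1.1.1).2.1 rfl) (fun h => h.1.2 rfl) (fun h => h.2 rfl)
        (fun h => h.1.1.2 rfl) (fun h => (Whl.mem.1 h.1.1.1).2.2 rfl) hqx.symm hxy qp.symm hpy
        qr.symm hry hWx ⟨p', p'W, pp'⟩ ⟨r', r'W, rr'⟩).elim
    · push Not at hWx
      by_cases h2 : ∃ w ∈ W, w ≠ p'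
      · obtain ⟨w, hw, hwp⟩ := h2
        obtain ⟨u, hu, huW⟩ := nb hW hw p'W hwp
        exact h.symm.F0 hp ih h3 (sw _ hw.1.1.1) (sw _ huW.1.1.1) hu (fun h => hWx w hw h.symm)
          (fun h => hWx u huW h.symm)
      · push Not at h2
        have hp'x : ¬ G.Adj p' x := fun h => hWx p' p'W h.symm
        by_cases hpx : G.Adj p x
        swap
        · exact h.symm.F0 hp ih h3 (sw _ hpB) (sw _ hp'B) pp' hpx hp'x
        by_cases hrx : G.Adj r x
        swap
        · have := h2 r' r'W
          subst this
          exact h.symm.F0 hp ih h3 (sw _ hrB) (sw _ hp'B) rr' hrx hp'x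
        have hp'y : G.Adj p' y := (h.att p' hp'B).resolve_left hp'x
        have e : sp G \ {q, r, x, p} = insert p' {y} := by
          ext t
          simp only [Set.mem_sdiff, Set.mem_insert_iff, Set.mem_singleton_iff]
          constructor
          · rintro ⟨ht, h1⟩
            push Not at h1
            by_cases hty : t = y
            · exact Or.inr hty
            · exact Or.inl (h2 t ⟨⟨⟨Whl.mem.2 ⟨ht, h1.2.2.1, hty⟩, h1.1⟩, h1.2.2.2⟩, h1.2.1⟩)
          · rintro (rfl | rfl)
            · refine ⟨(Whl.mem.1 hp'B).1, ?_⟩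
              rintro (h | h | h | h)
              · exact hp'q h
              · exact p'W.2 h
              · exact (Whl.mem.1 hp'B).2.1 h
              · exact pp'.ne' h
            · exact ⟨hys, by rintro (h | h | h | h) <;> subst h <;> tauto⟩
        refine redQ hp ih h3 (p := q) (q := r) (r := x) (t := p) qr hrx hpx.symm qp.symm hqx
          hpr.symm (fun h => hadj h.symm) ?_ ?_
        · rw [e]; exact Cj.insert (Cj.singleton G y) rfl hp'y
        · rw [e]; exact ⟨y, by simp⟩

theorem Whl.F2 {G : SimpleGraph V} (hp : G.IsPlanar) {x y : V}
    (h : Whl G x y) {q : V} (hq : q ∈ sp G \ {x, y})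
    (hall : ∀ v, v ∈ sp G \ {x, y} → G.Adj v x ∧ G.Adj v y) : False := by
  obtain ⟨p, b, hpb, hpB, hbB, hr⟩ := h.reg q hq
  have qp : G.Adj q p := (hr p hpB).2 (Or.inl rfl)
  have qb : G.Adj q b := (hr b hbB).2 (Or.inr rfl)
  obtain ⟨p', hp'q, hp'B, pp', hp'⟩ := h.oth hpB hq qp.symm
  have hW : Cj G (((sp G \ {x, y}) \ {q}) \ {p}) := (h.cBz q).leaf (n := p') (by
    intro u hu hpu
    exact (hp' u hu.1 hpu).resolve_left hu.2)
  have bW : b ∈ (((sp G \ {x, y}) \ {q}) \ {p}) := ⟨⟨hbB, qb.ne'⟩, hpb.symm⟩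
  have pW : p' ∈ (((sp G \ {x, y}) \ {q}) \ {p}) := ⟨⟨hp'B, hp'q⟩, pp'.ne'⟩
  exact k5 hp hW (a := x) (b := y) (c := q) (d := p) (fun h => (Whl.mem.1 h.1.1).2.1 rfl)
    (fun h => (Whl.mem.1 h.1.1).2.2 rfl) (fun h => h.1.2 rfl) (fun h => h.2 rfl) h.hxy
    (hall q hq).1.symm (hall p hpB).1.symm (hall q hq).2.symm (hall p hpB).2.symm qp
    ⟨b, bW, (hall b hbB).1.symm⟩ ⟨b, bW, (hall b hbB).2.symm⟩ ⟨b, bW, qb⟩ ⟨p', pW, pp'⟩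

end

end Dow

namespace Dow

open scoped Classical

noncomputable section

set_option linter.unusedSectionVars false
set_option linter.unusedVariables false

variable {V : Type} [Fintype V]

theorem hasDual_triv {G : SimpleGraph V} (h : ∀ z, cyc G z → z = 0) : HasDual G := by
  refine ⟨Unit, inferInstance, fun _ => (), fun _ => (), fun c => ?_, fun z hz => ⟨0, ?_⟩⟩
  · have : cob G (fun _ => ()) (fun _ => ()) c = 0 := by
      funext e
      simp [cob, z2self]
    rw [this]; exact cyc_zero
  · rw [h z hz]
    funext e
    simp [cob]

theorem bd_two {z : Sym2 V → ZMod 2} {v a b : V} (hab : a ≠ b)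
    (h : ∀ u, u ≠ a → u ≠ b → z s(v, u) = 0) : bd z v = z s(v, a) + z s(v, b) := by
  unfold bd
  rw [← Finset.sum_pair hab (f := fun u => z s(v, u))]
  symm
  apply Finset.sum_subset (Finset.subset_univ _)
  intro u _ hu
  simp at hu
  exact h u hu.1 hu.2

theorem hasDual_tri {G : SimpleGraph V} {x y z : V} (hxy : G.Adj x y) (hyz : G.Adj y z)
    (hxz : G.Adj x z) (hall : ∀ t, t ∈ sp G → t = x ∨ t = y ∨ t = z) : HasDual G := by
  have hE : ∀ e ∈ G.edgeSet, e = s(x, y) ∨ e = s(y, z) ∨ e = s(x, z) := by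
    intro e he
    induction e with | _ a b =>
    have hab : G.Adj a b := he
    have h1 := hall a ⟨b, hab⟩
    have h2 := hall b ⟨a, hab.symm⟩
    have h3 := hab.ne
    rcases h1 with rfl | rfl | rfl <;> rcases h2 with rfl | rfl | rfl <;> simp_all
  have n1 := hxy.ne
  have n2 := hyz.ne
  have n3 := hxz.ne
  have e1 : s(x, y) ≠ s(y, z) := by intro h; rw [Sym2.eq_iff] at h; tauto
  have e2 : s(x, y) ≠ s(x, z) := by intro h; rw [Sym2.eq_iff] at h; tauto
  have e3 : s(y, z) ≠ s(x, z) := by intro h; rw [Sym2.eq_iff] at h; tauto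
  have hcob : ∀ c : Bool → ZMod 2, cob G (fun _ => true) (fun _ => false) c =
      (c true + c false) • (sg s(x, y) + sg s(y, z) + sg s(x, z)) := by
    intro c
    funext e
    by_cases he : e ∈ G.edgeSet
    · rw [cob_mem he]
      rcases hE e he with rfl | rfl | rfl
      · simp [sg, e1, e2]
      · simp [sg, e1.symm, e3]
      · simp [sg, e2.symm, e3.symm]
    · rw [cob_nmem he]
      simp [(cyc_tri hxy hyz hxz).1 e he]
  refine ⟨Bool, inferInstance, fun _ => true, fun _ => false, fun c => ?_, fun w hw => ?_⟩
  · rw [hcob]; exact cyc_smul _ (cyc_tri hxy hyz hxz)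
  · have hno : ∀ v u, ¬ G.Adj v u → w s(v, u) = 0 := fun v u h => hw.1 _ h
    have b1 := hw.2 x
    rw [bd_two n2 (fun u h1 h2 => hno x u (fun h => by
      rcases hall u ⟨x, h.symm⟩ with h | h | h <;> simp_all))] at b1
    have b2 := hw.2 y
    rw [bd_two n3 (fun u h1 h2 => hno y u (fun h => by
      rcases hall u ⟨y, h.symm⟩ with h | h | h <;> simp_all))] at b2
    rw [z2add] at b1 b2
    rw [Sym2.eq_swap (a := y) (b := x)] at b2
    refine ⟨fun b => if b then w s(x, y) else 0, ?_⟩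
    funext e
    by_cases he : e ∈ G.edgeSet
    · rw [cob_mem he]
      rcases hE e he with rfl | rfl | rfl
      · simp
      · simp [b2]
      · simp [b1]
    · rw [cob_nmem he, hw.1 e he]

theorem hasDual_small {G : SimpleGraph V} (hp : G.IsPlanar) (ih : IH G) (h3 : C3 G)
    {a b c d : V} (H : ∀ t ∈ sp G, t = a ∨ t = b ∨ t = c ∨ t = d)
    {x y : V} (hxy : G.Adj x y) : HasDual G := by
  have cmp : ∀ v t e f, v ∈ sp G → t ∈ sp G → v ≠ t →
      (∀ s ∈ sp G, s = v ∨ s = t ∨ s = e ∨ s = f) → G.Adj v t := by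
    intro v t e f hv ht hvt hs
    have fin : ∀ u, G.Adj v u → (u = v ∨ u = t) → G.Adj v t := by
      rintro u hu (rfl | rfl)
      · exact absurd rfl hu.ne
      · exact hu
    by_cases he : e ≠ v ∧ e ≠ t
    · by_cases hf : f ≠ v ∧ f ≠ t
      · obtain ⟨u, hu, h1, h2⟩ := nb3 h3 hv ht hvt he.1.symm hf.1.symm he.2.symm hf.2.symm
        have := hs u ⟨v, hu.symm⟩
        exact fin u hu (by tauto)
      · obtain ⟨u, hu, h1, h2⟩ := nb3 h3 hv ht hvt he.1.symm he.1.symm he.2.symm he.2.symm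
        have := hs u ⟨v, hu.symm⟩
        refine fin u hu ?_
        by_contra hno
        have : u = f := by tauto
        subst this
        tauto
    · by_cases hf : f ≠ v ∧ f ≠ t
      · obtain ⟨u, hu, h1, h2⟩ := nb3 h3 hv ht hvt hf.1.symm hf.1.symm hf.2.symm hf.2.symm
        have := hs u ⟨v, hu.symm⟩
        refine fin u hu ?_
        by_contra hno
        have : u = e := by tauto
        subst this
        tauto
      · obtain ⟨u, hu⟩ := hv
        refine fin u hu ?_
        rcases hs u ⟨v, hu.symm⟩ with h | h | h | h
        · exact Or.inl h
        · exact Or.inr h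
        · subst h; tauto
        · subst h; tauto
  have cmpl : ∀ v t, v ∈ sp G → t ∈ sp G → v ≠ t → G.Adj v t := by
    intro v t hv ht hvt
    rcases H v hv with h1 | h1 | h1 | h1 <;> rcases H t ht with h2 | h2 | h2 | h2 <;> subst h1 <;>
      first
        | exact absurd h2.symm hvt
        | (subst h2
           first
             | exact cmp _ _ a b hv ht hvt (fun s hs => by have := H s hs; tauto)
             | exact cmp _ _ a c hv ht hvt (fun s hs => by have := H s hs; tauto)
             | exact cmp _ _ a d hv ht hvt (fun s hs => by have := H s hs; tauto)
             | exact cmp _ _ b c hv ht hvt (fun s hs => by have := H s hs; tauto)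
             | exact cmp _ _ b d hv ht hvt (fun s hs => by have := H s hs; tauto)
             | exact cmp _ _ c d hv ht hvt (fun s hs => by have := H s hs; tauto))
  have hxs : x ∈ sp G := ⟨y, hxy⟩
  have hys : y ∈ sp G := ⟨x, hxy.symm⟩
  by_cases hz : ∃ z ∈ sp G, z ≠ x ∧ z ≠ y
  · obtain ⟨z, hzs, hzx, hzy⟩ := hz
    have hyz := cmpl y z hys hzs hzy.symm
    have hxz := cmpl x z hxs hzs hzx.symm
    by_cases hw : ∃ w ∈ sp G, w ≠ x ∧ w ≠ y ∧ w ≠ z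
    · obtain ⟨w, hws, hwx, hwy, hwz⟩ := hw
      have hall : ∀ t ∈ sp G, t = x ∨ t = y ∨ t = z ∨ t = w := by
        have hsub : ({x, y, z, w} : Finset V) ⊆ {a, b, c, d} := by
          intro t ht
          simp only [Finset.mem_insert, Finset.mem_singleton] at ht ⊢
          apply H
          rcases ht with rfl | rfl | rfl | rfl <;> assumption
        have hc : ({x, y, z, w} : Finset V).card = 4 := by
          rw [Finset.card_insert_of_notMem, Finset.card_insert_of_notMem,
            Finset.card_pair hwz.symm]
          · simp [hzy.symm, hwy.symm]
          · simp [hxy.ne, hzx.symm, hwx.symm]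
        have := Finset.eq_of_subset_of_card_le hsub (by rw [hc]; exact Finset.card_le_four)
        intro t ht
        have h2 : t ∈ ({a, b, c, d} : Finset V) := by
          simpa using H t ht
        rw [← this] at h2
        simpa using h2
      refine redR hp ih h3 (u := x) (v := y) (x := z) (w := w) (y := w) hxy hxz.symm hyz.symm ?_
        hwx hwz (cmpl x w hxs hws hwx.symm) hwy hwz
      intro t
      constructor
      · intro ht
        have := hall t ⟨y, ht.symm⟩
        have := ht.ne'
        tauto
      · rintro (rfl | rfl | rfl)
        · exact hxy.symm
        · exact hyz
        · exact cmpl _ _ hys hws hwy.symm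
    · push Not at hw
      exact hasDual_tri hxy hyz hxz (fun t ht => by
        have := hw t ht; tauto)
  · push Not at hz
    apply hasDual_triv
    intro w hw
    have key : ∀ t, t ∈ sp G → t = x ∨ t = y := fun t ht => by have := hz t ht; tauto
    have hno : ∀ v u, ¬ G.Adj v u → w s(v, u) = 0 := fun v u h => hw.1 _ h
    have b1 := hw.2 x
    unfold bd at b1
    rw [Finset.sum_eq_single y (fun u _ hu => hno x u (fun h => by
      rcases key u ⟨x, h.symm⟩ with h' | h'
      · exact h.ne h'.symm
      · exact hu h')) (by simp)] at b1
    funext e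
    by_cases he : e ∈ G.edgeSet
    · induction e with | _ p q =>
      have hpq : G.Adj p q := he
      have := hpq.ne
      rcases key p ⟨q, hpq⟩ with rfl | rfl <;> rcases key q ⟨p, hpq.symm⟩ with rfl | rfl
      · tauto
      · exact b1
      · rw [Sym2.eq_swap]; exact b1
      · tauto
    · exact hw.1 e he

/-- Planar graphs have abstract duals. -/
theorem hasDual_of_planar : ∀ (k : ℕ) (G : SimpleGraph V), mu G = k → G.IsPlanar → HasDual G := by
  intro k
  induction k using Nat.strong_induction_on with
  | _ k IHk =>
  intro G hk hp
  have ih : IH G := fun K hK hlt => IHk (mu K) (hk ▸ hlt) K rfl hK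
  by_cases h3 : C3 G
  swap
  · exact not_C3 hp ih h3
  by_cases hE : ∃ x y, G.Adj x y
  swap
  · apply hasDual_triv
    intro z hz
    funext e
    apply hz.1
    push Not at hE
    induction e with | _ a b =>
    exact hE a b
  by_cases h5 : ∀ a b c d, ∃ t ∈ sp G, t ≠ a ∧ t ≠ b ∧ t ≠ c ∧ t ≠ d
  · obtain ⟨x, y, hxy, hT⟩ := thomassen h3 hE
    rcases contract_step hp ih h3 hxy hT h5 with h | h
    · exact h
    by_cases h1 : ∃ q, q ∈ sp G \ {x, y} ∧ ¬ G.Adj q y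
    · obtain ⟨q, hq, hqy⟩ := h1
      exact h.F1 hp ih h3 hq hqy
    by_cases h2 : ∃ q, q ∈ sp G \ {x, y} ∧ ¬ G.Adj q x
    · obtain ⟨q, hq, hqx⟩ := h2
      exact h.symm.F1 hp ih h3 (by rw [Set.pair_comm]; exact hq) hqx
    push Not at h1 h2
    obtain ⟨t, ht, ht1, ht2, _⟩ := h5 x y x x
    exact (h.F2 hp (q := t) (Whl.mem.2 ⟨ht, ht1, ht2⟩) (fun v hv => ⟨h2 v hv, h1 v hv⟩)).elim
  · push Not at h5
    obtain ⟨a, b, c, d, H⟩ := h5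
    obtain ⟨x, y, hxy⟩ := hE
    refine hasDual_small hp ih h3 (a := a) (b := b) (c := c) (d := d) (fun t ht => ?_) hxy
    have := H t ht
    tauto

end

end Dow

namespace Dow

open scoped Classical

noncomputable section

set_option linter.unusedSectionVars false
set_option linter.unusedVariables false

variable {V : Type} [Fintype V]

/-! ### Even edge sets as finsets -/

/-- indicator -/
def chi (S : Finset (Sym2 V)) : Sym2 V → ZMod 2 := fun e => if e ∈ S then 1 else 0

/-- even edge sets -/
def Ev (G : SimpleGraph V) (S : Finset (Sym2 V)) : Prop := cyc G (chi S)

/-- support -/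
def supp (z : Sym2 V → ZMod 2) : Finset (Sym2 V) := Finset.univ.filter (fun e => z e ≠ 0)

theorem mem_supp {z : Sym2 V → ZMod 2} {e} : e ∈ supp z ↔ z e ≠ 0 := by simp [supp]

theorem chi_supp (z : Sym2 V → ZMod 2) : chi (supp z) = z := by
  funext e
  unfold chi
  simp only [mem_supp]
  rcases z2 (z e) with h | h <;> simp [h]

theorem chi_ne {S : Finset (Sym2 V)} {e} : chi S e ≠ 0 ↔ e ∈ S := by
  unfold chi
  by_cases h : e ∈ S <;> simp [h]

theorem chi_symm (S T : Finset (Sym2 V)) : chi (symmDiff S T) = chi S + chi T := by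
  funext e
  simp only [chi, Finset.mem_symmDiff, Pi.add_apply]
  by_cases h : e ∈ S <;> by_cases h' : e ∈ T <;> simp [h, h', z2self]

theorem Ev.symm {G : SimpleGraph V} {S T} (h1 : Ev G S) (h2 : Ev G T) : Ev G (symmDiff S T) := by
  unfold Ev
  rw [chi_symm]
  exact cyc_add h1 h2

theorem card_symm (S T : Finset (Sym2 V)) :
    (symmDiff S T).card + 2 * (S ∩ T).card = S.card + T.card := by
  have h1 : symmDiff S T = (S \ T) ∪ (T \ S) := rfl
  rw [h1, Finset.card_union_of_disjoint]
  · have h2 := Finset.card_sdiff_add_card_inter S T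
    have h3 := Finset.card_sdiff_add_card_inter T S
    rw [Finset.inter_comm T S] at h3
    omega
  · exact disjoint_sdiff_sdiff

theorem Ev.sub {G : SimpleGraph V} {S} (h : Ev G S) {e} (he : e ∈ S) : e ∈ G.edgeSet := by
  by_contra hn
  exact chi_ne.2 he (h.1 e hn)

theorem Ev.adj {G : SimpleGraph V} {S} (h : Ev G S) {a b : V} (he : s(a, b) ∈ S) : G.Adj a b :=
  h.sub he

theorem Ev.oth {G : SimpleGraph V} {S} (h : Ev G S) {a b : V} (he : s(a, b) ∈ S) :
    ∃ c, c ≠ b ∧ s(a, c) ∈ S := by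
  by_contra hno
  push Not at hno
  have := h.2 a
  unfold bd at this
  rw [Finset.sum_eq_single b (fun u _ hu => by simp [chi, hno u hu]) (by simp)] at this
  simp [chi, he] at this

theorem Ev.tri {G : SimpleGraph V} {a b c : V} (h1 : G.Adj a b) (h2 : G.Adj b c)
    (h3 : G.Adj a c) : Ev G {s(a, b), s(b, c), s(a, c)} := by
  have : chi {s(a, b), s(b, c), s(a, c)} = sg s(a, b) + sg s(b, c) + sg s(a, c) := by
    have n1 := h1.ne
    have n2 := h2.ne
    have n3 := h3.ne
    have e1 : s(a, b) ≠ s(b, c) := by intro h; rw [Sym2.eq_iff] at h; tauto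
    have e2 : s(a, b) ≠ s(a, c) := by intro h; rw [Sym2.eq_iff] at h; tauto
    have e3 : s(b, c) ≠ s(a, c) := by intro h; rw [Sym2.eq_iff] at h; tauto
    funext e
    simp only [chi, sg, Finset.mem_insert, Finset.mem_singleton, Pi.add_apply]
    by_cases q1 : e = s(a, b)
    · subst q1; simp [e1, e2]
    by_cases q2 : e = s(b, c)
    · subst q2; simp [e1.symm, e3]
    simp [q1, q2]
  unfold Ev
  rw [this]
  exact cyc_tri h1 h2 h3

theorem s_ne {a b c d : V} (h1 : a ≠ c ∨ b ≠ d) (h2 : a ≠ d ∨ b ≠ c) : s(a, b) ≠ s(c, d) := by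
  intro h; rw [Sym2.eq_iff] at h; tauto

theorem card3 {a b c : V} (n1 : a ≠ b) (n2 : b ≠ c) (n3 : a ≠ c) :
    ({s(a, b), s(b, c), s(a, c)} : Finset (Sym2 V)).card = 3 := by
  rw [Finset.card_eq_three]
  exact ⟨_, _, _, s_ne (by tauto) (by tauto), s_ne (by tauto) (by tauto),
    s_ne (by tauto) (by tauto), rfl⟩

/-- four-cycles -/
theorem quad_eq {a b c d : V} (n1 : a ≠ b) (n2 : b ≠ c) (n3 : c ≠ d) (n4 : a ≠ d) (n5 : a ≠ c)
    (n6 : b ≠ d) : chi {s(a, b), s(b, c), s(c, d), s(a, d)} =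
    sg s(a, b) + sg s(b, c) + sg s(c, d) + sg s(a, d) := by
  have e1 : s(a, b) ≠ s(b, c) := s_ne (by tauto) (by tauto)
  have e2 : s(a, b) ≠ s(c, d) := s_ne (by tauto) (by tauto)
  have e3 : s(a, b) ≠ s(a, d) := s_ne (by tauto) (by tauto)
  have e4 : s(b, c) ≠ s(c, d) := s_ne (by tauto) (by tauto)
  have e5 : s(b, c) ≠ s(a, d) := s_ne (by tauto) (by tauto)
  have e6 : s(c, d) ≠ s(a, d) := s_ne (by tauto) (by tauto)
  funext e
  simp only [chi, sg, Finset.mem_insert, Finset.mem_singleton, Pi.add_apply]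
  by_cases q1 : e = s(a, b)
  · subst q1; simp [e1, e2, e3]
  by_cases q2 : e = s(b, c)
  · subst q2; simp [e1.symm, e4, e5]
  by_cases q3 : e = s(c, d)
  · subst q3; simp [e2.symm, e4.symm, e6]
  simp [q1, q2, q3]

theorem Ev.quad {G : SimpleGraph V} {a b c d : V} (h1 : G.Adj a b) (h2 : G.Adj b c)
    (h3 : G.Adj c d) (h4 : G.Adj a d) (n5 : a ≠ c) (n6 : b ≠ d) :
    Ev G {s(a, b), s(b, c), s(c, d), s(a, d)} := by
  unfold Ev
  rw [quad_eq h1.ne h2.ne h3.ne h4.ne n5 n6]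
  refine ⟨fun e he => ?_, fun v => ?_⟩
  · have e1 : e ≠ s(a, b) := by rintro rfl; exact he h1
    have e2 : e ≠ s(b, c) := by rintro rfl; exact he h2
    have e3 : e ≠ s(c, d) := by rintro rfl; exact he h3
    have e4 : e ≠ s(a, d) := by rintro rfl; exact he h4
    simp [sg, e1, e2, e3, e4]
  · simp only [bd_add, bd_sg h1.ne, bd_sg h2.ne, bd_sg h3.ne, bd_sg h4.ne]
    generalize ind a v = p
    generalize ind b v = q
    generalize ind c v = r
    generalize ind d v = s
    revert p q r s
    decide

theorem card4 {a b c d : V} (n1 : a ≠ b) (n2 : b ≠ c) (n3 : c ≠ d) (n4 : a ≠ d) (n5 : a ≠ c)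
    (n6 : b ≠ d) : ({s(a, b), s(b, c), s(c, d), s(a, d)} : Finset (Sym2 V)).card = 4 := by
  have e1 : s(a, b) ≠ s(b, c) := s_ne (by tauto) (by tauto)
  have e2 : s(a, b) ≠ s(c, d) := s_ne (by tauto) (by tauto)
  have e3 : s(a, b) ≠ s(a, d) := s_ne (by tauto) (by tauto)
  have e4 : s(b, c) ≠ s(c, d) := s_ne (by tauto) (by tauto)
  have e5 : s(b, c) ≠ s(a, d) := s_ne (by tauto) (by tauto)
  have e6 : s(c, d) ≠ s(a, d) := s_ne (by tauto) (by tauto)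
  rw [Finset.card_insert_of_notMem (by simp only [Finset.mem_insert, Finset.mem_singleton]; tauto),
    Finset.card_insert_of_notMem (by simp only [Finset.mem_insert, Finset.mem_singleton]; tauto),
    Finset.card_pair e6]

theorem Ev.three {G : SimpleGraph V} {S} (h : Ev G S) (hne : S.Nonempty) : 3 ≤ S.card := by
  obtain ⟨e, he⟩ := hne
  induction e with | _ b a =>
  obtain ⟨c, hca, hc⟩ := h.oth he
  rw [Sym2.eq_swap] at hc
  obtain ⟨d, hdb, hd⟩ := h.oth hc
  have n1 := (h.adj he).ne
  have n2 := (h.adj hc).ne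
  have n3 := (h.adj hd).ne
  have : ({s(b, a), s(c, b), s(c, d)} : Finset (Sym2 V)).card = 3 := by
    rw [Finset.card_eq_three]
    exact ⟨_, _, _, s_ne (by tauto) (by tauto), s_ne (by tauto) (by tauto),
      s_ne (by tauto) (by tauto), rfl⟩
  rw [← this]
  apply Finset.card_le_card
  intro e
  simp only [Finset.mem_insert, Finset.mem_singleton]
  rintro (rfl | rfl | rfl) <;> assumption

/-- If an even set contains another one, which is almost all of it, they agree. -/
theorem Ev.eq_of_sub {G : SimpleGraph V} {S T} (hS : Ev G S) (hT : Ev G T) (hTS : T ⊆ S)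
    (hc : S.card ≤ T.card + 2) : S = T := by
  have h1 := hS.symm hT
  have h2 := card_symm S T
  rw [Finset.inter_eq_right.2 hTS] at h2
  by_contra hne
  have : (symmDiff S T).Nonempty := by
    rw [Finset.nonempty_iff_ne_empty]
    intro h0
    apply hne
    exact symmDiff_eq_bot.1 h0
  have := h1.three this
  omega

/-- no 5-cycles -/
def No5 (G : SimpleGraph V) : Prop := ∀ a b c d e, G.Adj a b → G.Adj b c → G.Adj c d →
  G.Adj d e → G.Adj e a → a ≠ c → a ≠ d → b ≠ d → b ≠ e → c ≠ e → False

theorem Ev.small {G : SimpleGraph V} (h5 : No5 G) {S} (h : Ev G S) (hne : S.Nonempty)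
    (hc : S.card ≤ 5) :
    (∃ a b c, G.Adj a b ∧ G.Adj b c ∧ G.Adj a c ∧ S = {s(a, b), s(b, c), s(a, c)}) ∨
    (∃ a b c d, G.Adj a b ∧ G.Adj b c ∧ G.Adj c d ∧ G.Adj a d ∧ a ≠ c ∧ b ≠ d ∧
      S = {s(a, b), s(b, c), s(c, d), s(a, d)}) := by
  have tri : ∀ a b c, s(a, b) ∈ S → s(b, c) ∈ S → s(a, c) ∈ S →
      S = {s(a, b), s(b, c), s(a, c)} := by
    intro a b c q1 q2 q3
    have a1 := h.adj q1
    have a2 := h.adj q2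
    have a3 := h.adj q3
    apply h.eq_of_sub (Ev.tri a1 a2 a3)
    · intro e
      simp only [Finset.mem_insert, Finset.mem_singleton]
      rintro (rfl | rfl | rfl) <;> assumption
    · rw [card3 a1.ne a2.ne a3.ne]; exact hc
  have quad : ∀ a b c d, s(a, b) ∈ S → s(b, c) ∈ S → s(c, d) ∈ S → s(a, d) ∈ S → a ≠ c → b ≠ d →
      S = {s(a, b), s(b, c), s(c, d), s(a, d)} := by
    intro a b c d q1 q2 q3 q4 n1 n2
    have a1 := h.adj q1
    have a2 := h.adj q2
    have a3 := h.adj q3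
    have a4 := h.adj q4
    apply h.eq_of_sub (Ev.quad a1 a2 a3 a4 n1 n2)
    · intro e
      simp only [Finset.mem_insert, Finset.mem_singleton]
      rintro (rfl | rfl | rfl | rfl) <;> assumption
    · rw [card4 a1.ne a2.ne a3.ne a4.ne n1 n2]; omega
  obtain ⟨e, he⟩ := hne
  induction e with | _ b a =>
  obtain ⟨c, hca, hbc⟩ := h.oth he
  have hab := he
  rw [Sym2.eq_swap] at hab
  have hcb := hbc
  rw [Sym2.eq_swap] at hcb
  obtain ⟨d, hdb, hcd⟩ := h.oth hcb
  have nab := (h.adj hab).ne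
  have nbc := (h.adj hbc).ne
  have ncd := (h.adj hcd).ne
  by_cases hda : d = a
  · subst hda
    left
    refine ⟨d, b, c, h.adj hab, h.adj hbc, (h.adj hcd).symm, tri _ _ _ hab hbc ?_⟩
    rw [Sym2.eq_swap]; exact hcd
  have hdc := hcd
  rw [Sym2.eq_swap] at hdc
  obtain ⟨f, hfc, hdf⟩ := h.oth hdc
  have ndf := (h.adj hdf).ne
  by_cases hfa : f = a
  · subst hfa
    right
    refine ⟨f, b, c, d, h.adj hab, h.adj hbc, h.adj hcd, (h.adj hdf).symm, hca.symm, hdb.symm,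
      quad _ _ _ _ hab hbc hcd ?_ hca.symm hdb.symm⟩
    rw [Sym2.eq_swap]; exact hdf
  exfalso
  by_cases hfb : f = b
  · subst hfb
    have hS := tri _ _ _ hbc hcd (by rw [Sym2.eq_swap]; exact hdf)
    rw [hS] at hab
    simp only [Finset.mem_insert, Finset.mem_singleton] at hab
    rcases hab with q | q | q
    · exact s_ne (by tauto) (by tauto) q
    · exact s_ne (by tauto) (by tauto) q
    · exact s_ne (by tauto) (by tauto) q
  have hfd := hdf
  rw [Sym2.eq_swap] at hfd
  obtain ⟨g, hgd, hfg⟩ := h.oth hfd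
  have nfg := (h.adj hfg).ne
  by_cases hga : g = a
  · subst hga
    exact h5 g b c d f (h.adj hab) (h.adj hbc) (h.adj hcd) (h.adj hdf) (h.adj hfg) (by tauto)
      (by tauto) (by tauto) (by tauto) (by tauto)
  by_cases hgb : g = b
  · subst hgb
    have hS := quad _ _ _ _ hbc hcd hdf (by rw [Sym2.eq_swap]; exact hfg) (by tauto) (by tauto)
    rw [hS] at hab
    simp only [Finset.mem_insert, Finset.mem_singleton] at hab
    rcases hab with q | q | q | q <;> exact s_ne (by tauto) (by tauto) q
  by_cases hgc : g = c
  · subst hgc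
    have hS := tri _ _ _ hcd hdf (by rw [Sym2.eq_swap]; exact hfg)
    rw [hS] at hab
    simp only [Finset.mem_insert, Finset.mem_singleton] at hab
    rcases hab with q | q | q <;> exact s_ne (by tauto) (by tauto) q
  obtain ⟨k, hkb, hak⟩ := h.oth hab
  have nak := (h.adj hak).ne
  have d1 : s(a, b) ≠ s(b, c) := s_ne (by tauto) (by tauto)
  have d2 : s(a, b) ≠ s(c, d) := s_ne (by tauto) (by tauto)
  have d3 : s(a, b) ≠ s(d, f) := s_ne (by tauto) (by tauto)
  have d4 : s(a, b) ≠ s(f, g) := s_ne (by tauto) (by tauto)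
  have d5 : s(b, c) ≠ s(c, d) := s_ne (by tauto) (by tauto)
  have d6 : s(b, c) ≠ s(d, f) := s_ne (by tauto) (by tauto)
  have d7 : s(b, c) ≠ s(f, g) := s_ne (by tauto) (by tauto)
  have d8 : s(c, d) ≠ s(d, f) := s_ne (by tauto) (by tauto)
  have d9 : s(c, d) ≠ s(f, g) := s_ne (by tauto) (by tauto)
  have d10 : s(d, f) ≠ s(f, g) := s_ne (by tauto) (by tauto)
  have k1 : s(a, k) ≠ s(a, b) := s_ne (by tauto) (by tauto)
  have k2 : s(a, k) ≠ s(b, c) := s_ne (by tauto) (by tauto)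
  have k3 : s(a, k) ≠ s(c, d) := s_ne (by tauto) (by tauto)
  have k4 : s(a, k) ≠ s(d, f) := s_ne (by tauto) (by tauto)
  have k5 : s(a, k) ≠ s(f, g) := s_ne (by tauto) (by tauto)
  have hsub : ({s(a, k), s(a, b), s(b, c), s(c, d), s(d, f), s(f, g)} : Finset (Sym2 V)) ⊆ S := by
    intro e
    simp only [Finset.mem_insert, Finset.mem_singleton]
    rintro (rfl | rfl | rfl | rfl | rfl | rfl) <;> assumption
  have hcard : ({s(a, k), s(a, b), s(b, c), s(c, d), s(d, f), s(f, g)} :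
      Finset (Sym2 V)).card = 6 := by
    rw [Finset.card_insert_of_notMem, Finset.card_insert_of_notMem,
      Finset.card_insert_of_notMem, Finset.card_insert_of_notMem, Finset.card_pair d10] <;>
    simp only [Finset.mem_insert, Finset.mem_singleton, not_or]
    · exact ⟨d8, d9⟩
    · exact ⟨d5, d6, d7⟩
    · exact ⟨d1, d2, d3, d4⟩
    · exact ⟨k1, k2, k3, k4, k5⟩
  have := Finset.card_le_card hsub
  omega

theorem Ev.c5 {G : SimpleGraph V} (h5 : No5 G) {S} (h : Ev G S) : S.card ≠ 5 := by
  intro hc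
  rcases h.small h5 (Finset.card_pos.1 (by omega)) (by omega) with
    ⟨a, b, c, h1, h2, h3, rfl⟩ | ⟨a, b, c, d, h1, h2, h3, h4, h6, h7, rfl⟩
  · rw [card3 h1.ne h2.ne h3.ne] at hc; omega
  · rw [card4 h1.ne h2.ne h3.ne h4.ne h6 h7] at hc; omega

/-- rotate a triangle so that a given dart comes first -/
theorem Ev.tri_at {G : SimpleGraph V} (h5 : No5 G) {S} (h : Ev G S) (hc : S.card = 3) {v u : V}
    (hvu : s(v, u) ∈ S) : ∃ x, G.Adj v u ∧ G.Adj v x ∧ G.Adj u x ∧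
      S = {s(v, u), s(u, x), s(v, x)} := by
  obtain ⟨x, hxu, hvx⟩ := h.oth hvu
  have huv := hvu
  rw [Sym2.eq_swap] at huv
  obtain ⟨y, hyv, huy⟩ := h.oth huv
  have a1 := h.adj hvu
  have a2 := h.adj hvx
  have a3 := h.adj huy
  have n1 := a1.ne
  have n2 := a2.ne
  have n3 := a3.ne
  have hS : ({s(v, u), s(u, y), s(v, x)} : Finset (Sym2 V)) = S := by
    apply Finset.eq_of_subset_of_card_le
    · intro e
      simp only [Finset.mem_insert, Finset.mem_singleton]
      rintro (rfl | rfl | rfl) <;> assumption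
    · rw [hc]
      apply le_of_eq
      symm
      rw [Finset.card_eq_three]
      exact ⟨_, _, _, s_ne (by tauto) (by tauto), s_ne (by tauto) (by tauto),
        s_ne (by tauto) (by tauto), rfl⟩
  have hxv := hvx
  rw [Sym2.eq_swap] at hxv
  obtain ⟨w, hwv, hxw⟩ := h.oth hxv
  have hmem := hxw
  rw [← hS] at hmem
  simp only [Finset.mem_insert, Finset.mem_singleton, Sym2.eq_iff] at hmem
  have : x = y := by
    rcases hmem with q | q | q
    · tauto
    · rcases q with q | q
      · exact absurd q.1 hxu
      · exact q.1
    · rcases q with q | q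
      · exact absurd q.1 (Ne.symm n2)
      · exact absurd q.2 hwv
  subst this
  exact ⟨x, a1, a2, a3, hS.symm⟩

end

end Dow

namespace Dow

open scoped Classical

noncomputable section

set_option linter.unusedSectionVars false
set_option linter.unusedVariables false

variable {V : Type} [Fintype V]

/-- The counting context: a 2-connected graph with minimum degree 3, with a dual, no 5-cycle. -/
structure Ctx {ι : Type} (G : SimpleGraph V) (A : Finset V) (l r : Sym2 V → ι) : Prop where
  hd : IsDual G l r
  hA : ∀ u v, G.Adj u v → u ∈ A
  cA : Cj G (A : Set V)
  cAv : ∀ v, Cj G ((A : Set V) \ {v})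
  deg : ∀ v ∈ A, ∀ a b, ∃ u, G.Adj v u ∧ u ≠ a ∧ u ≠ b
  no5 : No5 G
  big : 5 ≤ A.card

/-- boundary of a face -/
def F {ι : Type} (G : SimpleGraph V) (l r : Sym2 V → ι) (i : ι) : Finset (Sym2 V) :=
  Finset.univ.filter (fun e => e ∈ G.edgeSet ∧ (l e = i ∨ r e = i))

variable {ι : Type} {G : SimpleGraph V} {A : Finset V} {l r : Sym2 V → ι}

theorem mem_F {i : ι} {e} : e ∈ F G l r i ↔ e ∈ G.edgeSet ∧ (l e = i ∨ r e = i) := by simp [F]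

theorem Ctx.lr (h : Ctx G A l r) {e} (he : e ∈ G.edgeSet) : l e ≠ r e := by
  induction e with | _ v u =>
  have hvu : G.Adj v u := he
  obtain ⟨b, hb, hbu, _⟩ := h.deg v (h.hA v u hvu) u u
  exact ends_ne h.hd (h.cAv v) (by simp) ⟨h.hA _ _ hvu.symm, hvu.ne'⟩ ⟨h.hA _ _ hb.symm, hb.ne'⟩
    hvu hb hbu.symm

theorem Ctx.cobF (h : Ctx G A l r) (i : ι) : cob G l r (fi i) = chi (F G l r i) := by
  funext e
  by_cases he : e ∈ F G l r i
  · have h1 := mem_F.1 he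
    have h2 := h.lr h1.1
    have : cob G l r (fi i) e = 1 := by
      rw [cob_fi_eq_one]
      refine ⟨h1.1, ?_⟩
      rcases h1.2 with q | q
      · exact Or.inl ⟨q, fun hh => h2 (q.trans hh.symm)⟩
      · exact Or.inr ⟨fun hh => h2 (hh.trans q.symm), q⟩
    rw [this]; simp [chi, he]
  · have : cob G l r (fi i) e = 0 := by
      by_contra hne
      have := cob_fi_eq_one.1 (z2ne.1 hne)
      exact he (mem_F.2 ⟨this.1, by tauto⟩)
    rw [this]; simp [chi, he]

theorem Ctx.ev (h : Ctx G A l r) (i : ι) : Ev G (F G l r i) := by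
  unfold Ev
  rw [← h.cobF]
  exact h.hd.1 _

theorem Ctx.min (h : Ctx G A l r) {Z : Finset (Sym2 V)} (hZ : Ev G Z) (hne : Z.Nonempty) {j : ι}
    (hs : Z ⊆ F G l r j) : Z = F G l r j := by
  have := min_face h.hd h.cA h.cAv h.hA j hZ (by
    obtain ⟨e, he⟩ := hne
    intro h0
    have h1 := chi_ne.2 he
    rw [h0] at h1
    exact h1 rfl) (by
    intro e he
    rw [h.cobF]
    exact z2ne.1 (chi_ne.2 (hs (chi_ne.1 he))))
  rw [h.cobF] at this
  ext e
  rw [← chi_ne, this, chi_ne]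

theorem Ctx.colour (h : Ctx G A l r) {v a b : V} (ha : G.Adj v a) (hb : G.Adj v b)
    (c : ι → ZMod 2) (hc : ∀ u, G.Adj v u → c (l s(v, u)) = c (r s(v, u))) :
    c (l s(v, a)) = c (l s(v, b)) :=
  color_const h.hd (h.cAv v) (by simp) ⟨h.hA _ _ ha.symm, ha.ne'⟩ ⟨h.hA _ _ hb.symm, hb.ne'⟩
    ha hb c hc

theorem only2 {i j k : ι} {e} (h1 : e ∈ F G l r i) (h2 : e ∈ F G l r j) (hij : i ≠ j)
    (h3 : e ∈ F G l r k) : k = i ∨ k = j := by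
  have q1 := (mem_F.1 h1).2
  have q2 := (mem_F.1 h2).2
  have q3 := (mem_F.1 h3).2
  rcases q1 with q1 | q1 <;> rcases q2 with q2 | q2 <;> rcases q3 with q3 | q3 <;>
    subst q1 <;> subst q2 <;> subst q3 <;> tauto

theorem Ctx.ofc (h : Ctx G A l r) {i : ι} {e} (he : e ∈ F G l r i) : ∃ j, j ≠ i ∧ e ∈ F G l r j := by
  have h1 := mem_F.1 he
  have h2 := h.lr h1.1
  rcases h1.2 with q | q
  · exact ⟨r e, by rw [← q]; exact h2.symm, mem_F.2 ⟨h1.1, Or.inr rfl⟩⟩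
  · exact ⟨l e, by rw [← q]; exact h2, mem_F.2 ⟨h1.1, Or.inl rfl⟩⟩

theorem memFl {e} (he : e ∈ G.edgeSet) : e ∈ F G l r (l e) := mem_F.2 ⟨he, Or.inl rfl⟩

theorem memFr {e} (he : e ∈ G.edgeSet) : e ∈ F G l r (r e) := mem_F.2 ⟨he, Or.inr rfl⟩

/-- a set of faces closed around a vertex contains all faces around it -/
theorem Ctx.around (h : Ctx G A l r) {v a : V} (P : ι → Prop) (ha : G.Adj v a)
    (hP : P (l s(v, a))) (hc : ∀ u, G.Adj v u → (P (l s(v, u)) ↔ P (r s(v, u))))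
    {b : V} (hb : G.Adj v b) : P (l s(v, b)) := by
  have := h.colour ha hb (fun i => if P i then 1 else 0) (by
    intro u hu
    by_cases hq : P (l s(v, u))
    · simp [hq, (hc u hu).1 hq]
    · have hq' : ¬ P (r s(v, u)) := fun hh => hq ((hc u hu).2 hh)
      simp [hq, hq'])
  simp only [hP, if_true] at this
  by_contra hno
  simp [hno] at this

/-- face version of `around` -/
theorem Ctx.aroundF (h : Ctx G A l r) {v a : V} {i : ι} (P : ι → Prop) (ha : s(v, a) ∈ F G l r i)
    (hP : P i) (hc : ∀ u m m', P m → s(v, u) ∈ F G l r m → s(v, u) ∈ F G l r m' → P m')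
    {b : V} {m : ι} (hb : s(v, b) ∈ F G l r m) : P m := by
  have ha' : s(v, a) ∈ G.edgeSet := (mem_F.1 ha).1
  have hb' : s(v, b) ∈ G.edgeSet := (mem_F.1 hb).1
  have := h.around P (v := v) (a := a) ha' (hc a i _ hP ha (memFl ha')) (fun u hu =>
    ⟨fun q => hc u _ _ q (memFl hu) (memFr hu), fun q => hc u _ _ q (memFr hu) (memFl hu)⟩)
    (b := b) hb'
  exact hc b _ _ this (memFl hb') hb

theorem Ctx.D2 (h : Ctx G A l r) {i j : ι} (hij : i ≠ j) {v a b : V}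
    (hai : s(v, a) ∈ F G l r i) (haj : s(v, a) ∈ F G l r j)
    (hbi : s(v, b) ∈ F G l r i) (hbj : s(v, b) ∈ F G l r j)
    (hi : ∀ t, s(v, t) ∈ F G l r i → t = a ∨ t = b)
    (hj : ∀ t, s(v, t) ∈ F G l r j → t = a ∨ t = b) : False := by
  have ha : G.Adj v a := (mem_F.1 hai).1
  obtain ⟨u, hu, hua, hub⟩ := h.deg v (h.hA v a ha) a b
  have key : ∀ b, s(v, b) ∈ F G l r i → s(v, b) ∈ F G l r j →
      (l s(v, b) = i ∨ l s(v, b) = j) ∧ (r s(v, b) = i ∨ r s(v, b) = j) := by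
    intro b h1 h2
    have he := (mem_F.1 h1).1
    exact ⟨only2 h1 h2 hij (memFl he), only2 h1 h2 hij (memFr he)⟩
  have := h.around (fun k => k = i ∨ k = j) ha (key a hai haj).1 (by
    intro t ht
    have ht' : s(v, t) ∈ G.edgeSet := ht
    by_cases hta : t = a ∨ t = b
    · have : s(v, t) ∈ F G l r i ∧ s(v, t) ∈ F G l r j := by
        rcases hta with rfl | rfl
        · exact ⟨hai, haj⟩
        · exact ⟨hbi, hbj⟩
      have := key t this.1 this.2
      tauto
    · constructor
      · rintro (q | q)
        · exact absurd (hi t (q ▸ memFl ht')) hta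
        · exact absurd (hj t (q ▸ memFl ht')) hta
      · rintro (q | q)
        · exact absurd (hi t (q ▸ memFr ht')) hta
        · exact absurd (hj t (q ▸ memFr ht')) hta) hu
  have hu' : s(v, u) ∈ G.edgeSet := hu
  have hno : ¬ (u = a ∨ u = b) := by tauto
  rcases this with q | q
  · exact hno (hi u (q ▸ memFl hu'))
  · exact hno (hj u (q ▸ memFl hu'))

/-- edges at a vertex of a triangle -/
theorem tri_deg {v u x t : V} (hux : u ≠ v) (hxv : x ≠ v) {S : Finset (Sym2 V)}
    (hS : S = {s(v, u), s(u, x), s(v, x)}) (ht : s(v, t) ∈ S) : t = u ∨ t = x := by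
  rw [hS] at ht
  simp only [Finset.mem_insert, Finset.mem_singleton, Sym2.eq_iff] at ht
  tauto

theorem Ctx.size (h : Ctx G A l r) {i : ι} (hne : (F G l r i).Nonempty) :
    (F G l r i).card = 3 ∨ (F G l r i).card = 4 ∨ 6 ≤ (F G l r i).card := by
  have h1 := (h.ev i).three hne
  have h2 := (h.ev i).c5 h.no5
  omega

/-- Facial triangle through a dart. -/
theorem Ctx.tri (h : Ctx G A l r) {i : ι} (hc : (F G l r i).card = 3) {v u : V}
    (hvu : s(v, u) ∈ F G l r i) : ∃ x, G.Adj v u ∧ G.Adj v x ∧ G.Adj u x ∧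
      F G l r i = {s(v, u), s(u, x), s(v, x)} := (h.ev i).tri_at h.no5 hc hvu

/-- distinct facial triangles share at most one edge at a vertex -/
theorem Ctx.tri_ne (h : Ctx G A l r) {i j : ι} (hij : i ≠ j) (hi : (F G l r i).card = 3)
    (hj : (F G l r j).card = 3) {v a b : V} (hab : a ≠ b)
    (hai : s(v, a) ∈ F G l r i) (haj : s(v, a) ∈ F G l r j)
    (hbi : s(v, b) ∈ F G l r i) (hbj : s(v, b) ∈ F G l r j) : False := by
  obtain ⟨x, a1, a2, a3, hS⟩ := h.tri hi hai
  obtain ⟨y, b1, b2, b3, hT⟩ := h.tri hj haj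
  have q1 : b = x := (tri_deg a1.ne' a2.ne' hS hbi).resolve_left hab.symm
  have q2 : b = y := (tri_deg b1.ne' b2.ne' hT hbj).resolve_left hab.symm
  subst q1
  subst q2
  exact h.D2 hij hai haj hbi hbj (fun t ht => tri_deg a1.ne' a2.ne' hS ht)
    (fun t ht => tri_deg b1.ne' b2.ne' hT ht)

theorem quad_deg {v a b c d : V} (h1 : a ≠ b) (h2 : b ≠ c) (h3 : c ≠ d) (h4 : a ≠ d)
    (h5 : a ≠ c) (h6 : b ≠ d) {S : Finset (Sym2 V)}
    (hS : S = {s(a, b), s(b, c), s(c, d), s(a, d)}) {p q : V} (hpq : p ≠ q)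
    (hp : s(v, p) ∈ S) (hq : s(v, q) ∈ S) {t : V} (ht : s(v, t) ∈ S) : t = p ∨ t = q := by
  rw [hS] at hp hq ht
  simp only [Finset.mem_insert, Finset.mem_singleton, Sym2.eq_iff] at hp hq ht
  by_cases e1 : v = a
  · subst e1
    have := h1.symm
    have := h4.symm
    have := h5.symm
    simp_all
    grind
  by_cases e2 : v = b
  · subst e2; simp_all; grind
  by_cases e3 : v = c
  · subst e3; simp_all; grind
  by_cases e4 : v = d
  · subst e4; simp_all; grind
  tauto

theorem Ctx.no34 (h : Ctx G A l r) {i j : ι} (hi : (F G l r i).card = 3)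
    (hj : (F G l r j).card = 4) {e} (hei : e ∈ F G l r i) (hej : e ∈ F G l r j) : False := by
  have hij : i ≠ j := by rintro rfl; omega
  have hs := (h.ev i).symm (h.ev j)
  have hc := card_symm (F G l r i) (F G l r j)
  have hpos : 0 < (F G l r i ∩ F G l r j).card := Finset.card_pos.2 ⟨e, by simp [hei, hej]⟩
  have hle : (F G l r i ∩ F G l r j).card ≤ 3 := by
    rw [← hi]; exact Finset.card_le_card Finset.inter_subset_left
  have hne5 := hs.c5 h.no5
  by_cases h3 : (F G l r i ∩ F G l r j).card = 3
  · have := hs.three (Finset.card_pos.1 (by omega))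
    omega
  have h2 : (F G l r i ∩ F G l r j).card = 2 := by omega
  obtain ⟨e1, e2, hne, hint⟩ := Finset.card_eq_two.1 h2
  have m1 : e1 ∈ F G l r i ∩ F G l r j := by rw [hint]; simp
  have m2 : e2 ∈ F G l r i ∩ F G l r j := by rw [hint]; simp
  rw [Finset.mem_inter] at m1 m2
  induction e1 with | _ v u =>
  obtain ⟨x, a1, a2, a3, hS⟩ := h.tri hi m1.1
  have hq : ∀ {v u x : V}, s(v, u) ∈ F G l r i → s(v, u) ∈ F G l r j → s(v, x) ∈ F G l r i →
      s(v, x) ∈ F G l r j → u ≠ x → False := by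
    intro v u x p1 p2 p3 p4 hux
    obtain ⟨x', a1, a2, a3, hS⟩ := h.tri hi p1
    have q1 : x = x' := (tri_deg a1.ne' a2.ne' hS p3).resolve_left hux.symm
    subst q1
    refine h.D2 hij p1 p2 p3 p4 (fun t ht => tri_deg a1.ne' a2.ne' hS ht) ?_
    rcases (h.ev j).small h.no5 ⟨_, p2⟩ (by omega) with
      ⟨a, b, c, c1, c2, c3, hT⟩ | ⟨a, b, c, d, c1, c2, c3, c4, c5, c6, hT⟩
    · rw [hT, card3 c1.ne c2.ne c3.ne] at hj; omega
    · intro t ht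
      exact quad_deg c1.ne c2.ne c3.ne c4.ne c5 c6 hT hux p2 p4 ht
  have m21 := m2.1
  rw [hS] at m21
  simp only [Finset.mem_insert, Finset.mem_singleton] at m21
  rcases m21 with rfl | rfl | rfl
  · exact hne rfl
  · refine hq (v := u) (u := v) (x := x) ?_ ?_ m2.1 m2.2 a2.ne
    · rw [Sym2.eq_swap]; exact m1.1
    · rw [Sym2.eq_swap]; exact m1.2
  · exact hq m1.1 m1.2 m2.1 m2.2 a3.ne

/-- 33-edges -/
def g33 {ι : Type} (G : SimpleGraph V) (l r : Sym2 V → ι) (e : Sym2 V) : Prop :=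
  e ∈ G.edgeSet ∧ (F G l r (l e)).card = 3 ∧ (F G l r (r e)).card = 3

theorem g33.sz {e} (hg : g33 G l r e) {i : ι} (he : e ∈ F G l r i) : (F G l r i).card = 3 := by
  rcases (mem_F.1 he).2 with q | q
  · rw [← q]; exact hg.2.1
  · rw [← q]; exact hg.2.2

theorem Ctx.g33_of (h : Ctx G A l r) {e} {i j : ι} (hij : i ≠ j) (hi : e ∈ F G l r i) (hj : e ∈ F G l r j)
    (ci : (F G l r i).card = 3) (cj : (F G l r j).card = 3) : g33 G l r e := by
  have he := (mem_F.1 hi).1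
  refine ⟨he, ?_, ?_⟩
  · rcases only2 hi hj hij (memFl he) with q | q <;> rw [q] <;> assumption
  · rcases only2 hi hj hij (memFr he) with q | q <;> rw [q] <;> assumption

theorem Ctx.center (h : Ctx G A l r) {i : ι} {z w u : V} (hwu : w ≠ u)
    (hw : s(z, w) ∈ F G l r i) (hu : s(z, u) ∈ F G l r i) (gw : g33 G l r s(z, w))
    (gu : g33 G l r s(z, u)) :
    ∃ p j k, p ≠ w ∧ p ≠ u ∧ (∀ t, G.Adj z t ↔ t = w ∨ t = u ∨ t = p) ∧ g33 G l r s(z, p) ∧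
      i ≠ j ∧ i ≠ k ∧ j ≠ k ∧ G.Adj w u ∧ G.Adj w p ∧ G.Adj u p ∧
      F G l r i = {s(z, w), s(w, u), s(z, u)} ∧
      F G l r j = {s(z, w), s(w, p), s(z, p)} ∧ F G l r k = {s(z, u), s(u, p), s(z, p)} := by
  have ci := gw.sz hw
  obtain ⟨u', zw, zu, wu, hFi⟩ := h.tri ci hw
  have q1 : u = u' := (tri_deg zw.ne' zu.ne' hFi hu).resolve_left hwu.symm
  subst q1
  obtain ⟨j, hji, hwj⟩ := h.ofc hw
  obtain ⟨k, hki, huk⟩ := h.ofc hu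
  have cj := gw.sz hwj
  have ck := gu.sz huk
  obtain ⟨p, _, zp, wp, hFj⟩ := h.tri cj hwj
  obtain ⟨q, _, zq, uq, hFk⟩ := h.tri ck huk
  have hpj : s(z, p) ∈ F G l r j := by rw [hFj]; simp
  have hqk : s(z, q) ∈ F G l r k := by rw [hFk]; simp
  have hpu : p ≠ u := by
    rintro rfl
    exact h.tri_ne hji.symm ci cj wp.ne hw hwj hu hpj
  have hqw : q ≠ w := by
    rintro rfl
    exact h.tri_ne hki.symm ci ck uq.ne hu huk hw hqk
  have hpq : p = q := by
    by_contra hne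
    exact h.no5 p w u q z wp.symm wu uq zq.symm zp hpu hne hqw.symm zw.ne' zu.ne'
  subst hpq
  have hjk : j ≠ k := by
    rintro rfl
    rcases tri_deg zw.ne' zp.ne' hFj huk with q | q
    · exact hwu q.symm
    · exact hpu q.symm
  refine ⟨p, j, k, hqw, hpu, ?_, h.g33_of hjk hpj hqk cj ck, hji.symm, hki.symm, hjk, wu, wp, uq,
    hFi, hFj, hFk⟩
  have fw : ∀ m, s(z, w) ∈ F G l r m → m = i ∨ m = j := fun m hm => only2 hw hwj hji.symm hm
  have fu : ∀ m, s(z, u) ∈ F G l r m → m = i ∨ m = k := fun m hm => only2 hu huk hki.symm hm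
  have fp : ∀ m, s(z, p) ∈ F G l r m → m = j ∨ m = k := fun m hm => only2 hpj hqk hjk hm
  have back : ∀ t, (s(z, t) ∈ F G l r i ∨ s(z, t) ∈ F G l r j ∨ s(z, t) ∈ F G l r k) →
      t = w ∨ t = u ∨ t = p := by
    rintro t (q | q | q)
    · have := tri_deg zw.ne' zu.ne' hFi q; tauto
    · have := tri_deg zw.ne' zp.ne' hFj q; tauto
    · have := tri_deg zu.ne' zp.ne' hFk q; tauto
  intro t
  constructor
  · intro ht
    have key := h.aroundF (fun m => m = i ∨ m = j ∨ m = k) hw (Or.inl rfl) (by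
      intro b m m' hm hb hm'
      have hbw : b = w ∨ b = u ∨ b = p := by
        apply back
        rcases hm with q | q | q <;> rw [q] at hb
        · exact Or.inl hb
        · exact Or.inr (Or.inl hb)
        · exact Or.inr (Or.inr hb)
      rcases hbw with q | q | q <;> rw [q] at hm'
      · rcases fw _ hm' with q | q
        · exact Or.inl q
        · exact Or.inr (Or.inl q)
      · rcases fu _ hm' with q | q
        · exact Or.inl q
        · exact Or.inr (Or.inr q)
      · exact Or.inr (fp _ hm')) (memFl (show s(z, t) ∈ G.edgeSet from ht))
    have ht' : s(z, t) ∈ G.edgeSet := ht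
    apply back
    rcases key with q | q | q
    · exact Or.inl (q ▸ memFl ht')
    · exact Or.inr (Or.inl (q ▸ memFl ht'))
    · exact Or.inr (Or.inr (q ▸ memFl ht'))
  · rintro (rfl | rfl | rfl) <;> assumption

/-- three vertices closed up to one other vertex: impossible -/
theorem Ctx.no_sep (h : Ctx G A l r) {a b c p : V} (hap : a ≠ p) (ha : a ∈ A)
    (hcl : ∀ s t, (s = a ∨ s = b ∨ s = c) → G.Adj s t → t = a ∨ t = b ∨ t = c ∨ t = p) : False := by
  have := h.cAv p (fun t => t = a ∨ t = b ∨ t = c) ⟨a, ⟨ha, hap⟩, Or.inl rfl⟩ (by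
    rintro v w hv hw hvw hD
    have := hcl v w hD hvw
    have h2 : w ≠ p := hw.2
    tauto)
  have hsub : A ⊆ {a, b, c, p} := by
    intro t ht
    simp only [Finset.mem_insert, Finset.mem_singleton]
    by_cases htp : t = p
    · tauto
    · have := this t ⟨ht, htp⟩
      tauto
  have h1 := Finset.card_le_card hsub
  have h2 : ({a, b, c, p} : Finset V).card ≤ 4 := Finset.card_le_four
  have h3 := h.big
  omega

theorem Ctx.no333 (h : Ctx G A l r) {i : ι} {a b c : V} (hab : s(a, b) ∈ F G l r i)
    (hbc : s(b, c) ∈ F G l r i) (hac : s(a, c) ∈ F G l r i)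
    (g1 : g33 G l r s(a, b)) (g2 : g33 G l r s(b, c)) (g3 : g33 G l r s(a, c)) : False := by
  have n1 : G.Adj a b := (mem_F.1 hab).1
  have n2 : G.Adj b c := (mem_F.1 hbc).1
  have n3 : G.Adj a c := (mem_F.1 hac).1
  have s1 : s(b, a) = s(a, b) := Sym2.eq_swap
  have s2 : s(c, b) = s(b, c) := Sym2.eq_swap
  have s3 : s(c, a) = s(a, c) := Sym2.eq_swap
  obtain ⟨p, _, _, p1, p2, pn, _, _, _, _, _, bp, cp, _⟩ := h.center n2.ne hab hac g1 g3
  obtain ⟨p', _, _, q1, q2, qn, _⟩ := h.center (z := b) n3.ne (s1 ▸ hab) hbc (s1 ▸ g1) g2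
  obtain ⟨p'', _, _, r1, r2, rn, _⟩ := h.center (z := c) n1.ne (s3 ▸ hac) (s2 ▸ hbc) (s3 ▸ g3)
    (s2 ▸ g2)
  have ap : G.Adj a p := (pn p).2 (by tauto)
  have e1 : p = p' := by
    have := (qn p).1 bp
    have := ap.ne'
    tauto
  have e2 : p = p'' := by
    have := (rn p).1 cp
    have := ap.ne'
    tauto
  subst e1
  subst e2
  refine h.no_sep (a := a) (b := b) (c := c) (p := p) ap.ne (h.hA _ _ n1) ?_
  rintro s t (rfl | rfl | rfl) hst
  · have := (pn t).1 hst; tauto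
  · have := (qn t).1 hst; tauto
  · have := (rn t).1 hst; tauto

end

end Dow

namespace Dow

open scoped Classical

noncomputable section

set_option linter.unusedSectionVars false
set_option linter.unusedVariables false

variable {V : Type} [Fintype V]

variable {ι : Type} {G : SimpleGraph V} {A : Finset V} {l r : Sym2 V → ι}

/-- edges as a finset -/
def Ed (G : SimpleGraph V) : Finset (Sym2 V) := Finset.univ.filter (fun e => e ∈ G.edgeSet)

theorem mem_Ed {e} : e ∈ Ed G ↔ e ∈ G.edgeSet := by simp [Ed]

/-- the touched faces -/
def Fc (G : SimpleGraph V) (l r : Sym2 V → ι) : Finset ι := (Ed G).image l ∪ (Ed G).image r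

theorem mem_Fc {i : ι} : i ∈ Fc G l r ↔ (F G l r i).Nonempty := by
  unfold Fc
  simp only [Finset.mem_union, Finset.mem_image, mem_Ed, Finset.Nonempty, mem_F]
  grind

/-- extension by zero -/
def ex0 (G : SimpleGraph V) : ({e // e ∈ Ed G} → ZMod 2) →ₗ[ZMod 2] (Sym2 V → ZMod 2) where
  toFun w e := if h : e ∈ Ed G then w ⟨e, h⟩ else 0
  map_add' x y := by
    funext e
    by_cases h : e ∈ Ed G <;> simp [h]
  map_smul' c x := by
    funext e
    by_cases h : e ∈ Ed G <;> simp [h]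

/-- boundary map -/
def bdl (V : Type) [Fintype V] (B : Finset V) :
    (Sym2 V → ZMod 2) →ₗ[ZMod 2] ({v // v ∈ B} → ZMod 2) where
  toFun z v := bd z v
  map_add' x y := by
    funext v
    simp [bd, Finset.sum_add_distrib]
  map_smul' c x := by
    funext v
    simp [bd, Finset.mul_sum]

/-- coboundary -/
def cobl (G : SimpleGraph V) (l r : Sym2 V → ι) (I : Finset ι) :
    ({i // i ∈ I} → ZMod 2) →ₗ[ZMod 2] ({e // e ∈ Ed G} → ZMod 2) where
  toFun c e := (if h : l e ∈ I then c ⟨_, h⟩ else 0) + (if h : r e ∈ I then c ⟨_, h⟩ else 0)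
  map_add' x y := by
    funext e
    by_cases h : l e ∈ I <;> by_cases h' : r e ∈ I <;> simp [h, h']
    abel
  map_smul' c x := by
    funext e
    by_cases h : l e ∈ I <;> by_cases h' : r e ∈ I <;> simp [h, h']
    ring

theorem Ctx.rank (h : Ctx G A l r) : (Ed G).card + 2 ≤ A.card + (Fc G l r).card := by
  obtain ⟨a0, ha0⟩ : A.Nonempty := Finset.card_pos.1 (by have := h.big; omega)
  obtain ⟨u, hu, -⟩ := h.deg a0 ha0 a0 a0
  have hj0 : l s(a0, u) ∈ Fc G l r := mem_Fc.2 ⟨_, memFl hu⟩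
  set j0 := l s(a0, u)
  let D := (bdl V (A.erase a0)).comp (ex0 G)
  let Φ := cobl G l r ((Fc G l r).erase j0)
  have hsub : LinearMap.ker D ≤ LinearMap.range Φ := by
    intro w hw
    have hw' : ∀ v ∈ A, v ≠ a0 → bd (ex0 G w) v = 0 := by
      intro v hv hne
      have := congrFun (LinearMap.mem_ker.1 hw) ⟨v, Finset.mem_erase.2 ⟨hne, hv⟩⟩
      exact this
    have hz : ∀ e, e ∉ G.edgeSet → ex0 G w e = 0 := by
      intro e he
      have : e ∉ Ed G := fun q => he (mem_Ed.1 q)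
      simp [ex0, this]
    have hout : ∀ v, v ∉ A → bd (ex0 G w) v = 0 := by
      intro v hv
      unfold bd
      refine Finset.sum_eq_zero fun t _ => hz _ fun q => hv (h.hA _ _ q)
    have hcyc : cyc G (ex0 G w) := by
      refine ⟨hz, ?_⟩
      have hh := handshake (ex0 G w) (fun v => hz _ (by simp))
      have h0 : bd (ex0 G w) a0 = 0 := by
        rw [Finset.sum_eq_single a0] at hh
        · exact hh
        · intro b _ hb
          by_cases hbA : b ∈ A
          · exact hw' b hbA hb
          · exact hout b hbA
        · simp
      intro v
      by_cases hv : v ∈ A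
      · by_cases hva : v = a0
        · rw [hva]; exact h0
        · exact hw' v hv hva
      · exact hout v hv
    obtain ⟨c, hc, hcj⟩ := h.hd.exists_normalized hcyc j0 0
    refine ⟨fun i => c i, ?_⟩
    funext e
    have he := mem_Ed.1 e.2
    have h1 : ex0 G w e = w e := by
      have := e.2
      simp [ex0]
    rw [← h1, hc, cob_mem he]
    have hl : l e ∈ Fc G l r := mem_Fc.2 ⟨_, memFl he⟩
    have hr : r e ∈ Fc G l r := mem_Fc.2 ⟨_, memFr he⟩
    show (if h : l e ∈ (Fc G l r).erase j0 then c (l e) else 0) +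
      (if h : r e ∈ (Fc G l r).erase j0 then c (r e) else 0) = _
    by_cases q1 : l e = j0 <;> by_cases q2 : r e = j0 <;> simp [q1, q2, hl, hr, hcj, hj0]
  have h1 := LinearMap.finrank_range_add_finrank_ker D
  have h2 := LinearMap.finrank_range_add_finrank_ker Φ
  have h3 := Submodule.finrank_mono hsub
  have h4 := Submodule.finrank_le (LinearMap.range D)
  rw [Module.finrank_fintype_fun_eq_card, Fintype.card_coe] at h1 h2 h4
  rw [Finset.card_erase_of_mem ha0] at h4
  rw [Finset.card_erase_of_mem hj0] at h2
  have h5 := Finset.card_pos.2 ⟨_, hj0⟩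
  have h6 := h.big
  omega

end

end Dow

namespace Dow

open scoped Classical

noncomputable section

set_option linter.unusedSectionVars false
set_option linter.unusedVariables false

variable {V : Type} [Fintype V]

variable {ι : Type} {G : SimpleGraph V} {A : Finset V} {l r : Sym2 V → ι}

/-- A rim vertex `v` of degree three of a wheel with hub `z` and rim `v,p,q`, next to the large
face `k`. -/
structure TA (G : SimpleGraph V) (l r : Sym2 V → ι) (k : ι) (v z p q : V) : Prop where
  adjv : ∀ t, G.Adj v t ↔ t = z ∨ t = p ∨ t = q
  adjz : ∀ t, G.Adj z t ↔ t = v ∨ t = p ∨ t = q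
  pq : G.Adj p q
  fa : ∃ i j m, i ≠ j ∧ i ≠ m ∧ j ≠ m ∧ F G l r i = {s(z, v), s(v, p), s(z, p)} ∧
    F G l r j = {s(z, v), s(v, q), s(z, q)} ∧ F G l r m = {s(z, p), s(p, q), s(z, q)}
  vp : s(v, p) ∈ F G l r k
  vq : s(v, q) ∈ F G l r k
  big : 6 ≤ (F G l r k).card

/-- type A vertices of the face `k` -/
def AT (G : SimpleGraph V) (l r : Sym2 V → ι) (k : ι) (v : V) : Prop := ∃ z p q, TA G l r k v z p q

variable {k : ι} {v z p q : V}

/-- each edge of the rim triangle has exactly one triangular face -/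
theorem TA.edge (h : Ctx G A l r) (ht : TA G l r k v z p q) {e}
    (he : e ∈ ({s(v, p), s(p, q), s(v, q)} : Finset (Sym2 V))) :
    ¬ g33 G l r e ∧ ∃ a x y, e = s(x, y) ∧ z ≠ x ∧ z ≠ y ∧ x ≠ y ∧
      F G l r a = {s(z, x), s(x, y), s(z, y)} := by
  obtain ⟨i, j, m, hij, him, hjm, hi, hj, hm⟩ := ht.fa
  have zv : G.Adj z v := (ht.adjz v).2 (by tauto)
  have zp : G.Adj z p := (ht.adjz p).2 (by tauto)
  have zq : G.Adj z q := (ht.adjz q).2 (by tauto)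
  have vp : G.Adj v p := (ht.adjv p).2 (by tauto)
  have vq : G.Adj v q := (ht.adjv q).2 (by tauto)
  simp only [Finset.mem_insert, Finset.mem_singleton] at he
  rcases he with rfl | rfl | rfl
  · refine ⟨fun hg => ?_, i, v, p, rfl, zv.ne, zp.ne, vp.ne, hi⟩
    have := hg.sz ht.vp
    have := ht.big
    omega
  · refine ⟨fun hg => ?_, m, p, q, rfl, zp.ne, zq.ne, ht.pq.ne, hm⟩
    have ci : (F G l r i).card = 3 := by rw [hi]; exact card3 zv.ne vp.ne zp.ne
    have cj : (F G l r j).card = 3 := by rw [hj]; exact card3 zv.ne vq.ne zq.ne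
    have cm : (F G l r m).card = 3 := by rw [hm]; exact card3 zp.ne ht.pq.ne zq.ne
    have m1 : s(z, p) ∈ F G l r m := by rw [hm]; simp
    have m2 : s(z, q) ∈ F G l r m := by rw [hm]; simp
    have m3 : s(p, q) ∈ F G l r m := by rw [hm]; simp
    have g1 : g33 G l r s(z, p) := h.g33_of him (by rw [hi]; simp) m1 ci cm
    have g2 : g33 G l r s(z, q) := h.g33_of hjm (by rw [hj]; simp) m2 cj cm
    exact h.no333 m1 m3 m2 g1 hg g2
  · refine ⟨fun hg => ?_, j, v, q, rfl, zv.ne, zq.ne, vq.ne, hj⟩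
    have := hg.sz ht.vq
    have := ht.big
    omega

theorem TA.hub (h : Ctx G A l r) (ht : TA G l r k v z p q) {v' z' p' q' : V} {k' : ι}
    (ht' : TA G l r k' v' z' p' q') {e}
    (he : e ∈ ({s(v, p), s(p, q), s(v, q)} : Finset (Sym2 V)))
    (he' : e ∈ ({s(v', p'), s(p', q'), s(v', q')} : Finset (Sym2 V))) : z = z' := by
  obtain ⟨hg, a, x, y, rfl, zx, zy, xy, hF⟩ := ht.edge h he
  obtain ⟨-, b, x', y', e1, zx', zy', xy', hF'⟩ := ht'.edge h he'
  have ca : (F G l r a).card = 3 := by rw [hF]; exact card3 zx xy zy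
  have cb : (F G l r b).card = 3 := by rw [hF']; exact card3 zx' xy' zy'
  have ea : s(x, y) ∈ F G l r a := by rw [hF]; simp
  have eb : s(x, y) ∈ F G l r b := by rw [hF', ← e1]; simp
  have hab : a = b := by
    by_contra hne
    exact hg (h.g33_of hne ea eb ca cb)
  subst hab
  have e2 : s(z, x) ∈ F G l r a := by rw [hF]; simp
  rw [hF'] at e2
  simp only [Finset.mem_insert, Finset.mem_singleton, Sym2.eq_iff] at e1 e2
  grind

theorem TA.disj (h : Ctx G A l r) (ht : TA G l r k v z p q) {v' z' p' q' : V} {k' : ι}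
    (ht' : TA G l r k' v' z' p' q') (hne : v ≠ v') {e}
    (he : e ∈ ({s(v, p), s(p, q), s(v, q)} : Finset (Sym2 V)))
    (he' : e ∈ ({s(v', p'), s(p', q'), s(v', q')} : Finset (Sym2 V))) : False := by
  have := ht.hub h ht' he he'
  subst this
  have zv : G.Adj z v := (ht.adjz v).2 (by tauto)
  have zp : G.Adj z p := (ht.adjz p).2 (by tauto)
  have zq : G.Adj z q := (ht.adjz q).2 (by tauto)
  have vp : G.Adj v p := (ht.adjv p).2 (by tauto)
  have vq : G.Adj v q := (ht.adjv q).2 (by tauto)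
  have zv' : G.Adj z v' := (ht'.adjz v').2 (by tauto)
  have zp' : G.Adj z p' := (ht'.adjz p').2 (by tauto)
  have zq' : G.Adj z q' := (ht'.adjz q').2 (by tauto)
  have a1 := (ht.adjz v').1 zv'
  have a2 := (ht.adjz p').1 zp'
  have a3 := (ht.adjz q').1 zq'
  rcases a1 with a1 | a1 | a1
  · exact hne a1.symm
  · refine h.no_sep (a := v) (b := v') (c := z) (p := q) vq.ne (h.hA _ _ vp) ?_
    rintro s t (rfl | rfl | rfl) hst
    · have := (ht.adjv t).1 hst; grind
    · have := (ht'.adjv t).1 hst; grind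
    · have := (ht.adjz t).1 hst; grind
  · refine h.no_sep (a := v) (b := v') (c := z) (p := p) vp.ne (h.hA _ _ vp) ?_
    rintro s t (rfl | rfl | rfl) hst
    · have := (ht.adjv t).1 hst; grind
    · have := (ht'.adjv t).1 hst; grind
    · have := (ht.adjz t).1 hst; grind

theorem Ctx.numA (h : Ctx G A l r) (k : ι) (hk : 6 ≤ (F G l r k).card) :
    (A.filter (fun v => AT G l r k v)).card + 6 ≤ (F G l r k).card := by
  have hch : ∀ v, ∃ z p q, AT G l r k v → TA G l r k v z p q := by
    intro v
    by_cases hv : AT G l r k v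
    · obtain ⟨z, p, q, hh⟩ := hv
      exact ⟨z, p, q, fun _ => hh⟩
    · exact ⟨v, v, v, fun q => absurd q hv⟩
  choose fz fp fq hT using hch
  have key : ∀ U : Finset V, (∀ v ∈ U, AT G l r k v) → ∃ Z, Ev G Z ∧
      Z.card + U.card = (F G l r k).card ∧
      ∀ e, (∀ u ∈ U, e ∉ ({s(u, fp u), s(fp u, fq u), s(u, fq u)} : Finset (Sym2 V))) →
        (e ∈ Z ↔ e ∈ F G l r k) := by
    intro U
    induction U using Finset.induction_on with
    | empty => exact fun _ => ⟨F G l r k, h.ev k, by simp, by simp⟩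
    | insert v U hv ih =>
      intro hU
      obtain ⟨Z, hZ, hc, hm⟩ := ih (fun u hu => hU u (Finset.mem_insert_of_mem hu))
      have tv := hT v (hU v (Finset.mem_insert_self _ _))
      generalize hp : fp v = p at *
      generalize hq : fq v = q at *
      generalize fz v = z at *
      have vp : G.Adj v p := (tv.adjv p).2 (by tauto)
      have vq : G.Adj v q := (tv.adjv q).2 (by tauto)
      have hTe := Ev.tri vp tv.pq vq
      have hc3 := card3 vp.ne tv.pq.ne vq.ne
      have hmm : ∀ e ∈ ({s(v, p), s(p, q), s(v, q)} : Finset (Sym2 V)),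
          (e ∈ Z ↔ e ∈ F G l r k) := by
        intro e he
        refine hm e fun u hu he' => ?_
        exact tv.disj h (hT u (hU u (Finset.mem_insert_of_mem hu))) (by rintro rfl; exact hv hu)
          he he'
      have hnpq : s(p, q) ∉ F G l r k := by
        intro hh
        have := h.min hTe ⟨s(v, p), by simp⟩ (j := k) (by
          intro e he
          simp only [Finset.mem_insert, Finset.mem_singleton] at he
          rcases he with rfl | rfl | rfl
          · exact tv.vp
          · exact hh
          · exact tv.vq)
        rw [← this, hc3] at hk
        omega
      have n1 : s(v, p) ∈ Z := (hmm _ (by simp)).2 tv.vp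
      have n2 : s(v, q) ∈ Z := (hmm _ (by simp)).2 tv.vq
      have n3 : s(p, q) ∉ Z := fun hh => hnpq ((hmm _ (by simp)).1 hh)
      have hint : Z ∩ {s(v, p), s(p, q), s(v, q)} = {s(v, p), s(v, q)} := by
        ext e
        simp only [Finset.mem_inter, Finset.mem_insert, Finset.mem_singleton]
        constructor
        · rintro ⟨h1, rfl | rfl | rfl⟩
          · tauto
          · exact absurd h1 n3
          · tauto
        · rintro (rfl | rfl)
          · exact ⟨n1, Or.inl rfl⟩
          · exact ⟨n2, Or.inr (Or.inr rfl)⟩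
      have hcs := card_symm Z {s(v, p), s(p, q), s(v, q)}
      rw [hint, hc3, Finset.card_pair (s_ne (Or.inr tv.pq.ne) (Or.inl vq.ne))] at hcs
      refine ⟨_, hZ.symm hTe, ?_, ?_⟩
      · rw [Finset.card_insert_of_notMem hv]
        omega
      · intro e he
        have e1 := he v (Finset.mem_insert_self _ _)
        rw [hp, hq] at e1
        rw [Finset.mem_symmDiff]
        have := hm e (fun u hu => he u (Finset.mem_insert_of_mem hu))
        tauto
  by_contra hno
  obtain ⟨U, hUs, hUc⟩ := Finset.exists_subset_card_eq
    (s := A.filter (fun v => AT G l r k v)) (n := (F G l r k).card - 5) (by omega)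
  obtain ⟨Z, hZ, hc, -⟩ := key U (fun v hv => (Finset.mem_filter.1 (hUs hv)).2)
  exact hZ.c5 h.no5 (by omega)

end

end Dow

namespace Dow

open scoped Classical

noncomputable section

set_option linter.unusedSectionVars false
set_option linter.unusedVariables false

variable {V : Type} [Fintype V]

variable {ι : Type} {G : SimpleGraph V} {A : Finset V} {l r : Sym2 V → ι}

/-- darts of an edge set -/
def dr (S : Finset (Sym2 V)) : Finset (V × V) := Finset.univ.filter (fun p => s(p.1, p.2) ∈ S)

theorem mem_dr {S : Finset (Sym2 V)} {v u : V} : (v, u) ∈ dr S ↔ s(v, u) ∈ S := by simp [dr]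

theorem card_dr {S : Finset (Sym2 V)} (hS : ∀ v, s(v, v) ∉ S) : (dr S).card = 2 * S.card := by
  rw [Finset.card_eq_sum_card_fiberwise (f := fun p : V × V => s(p.1, p.2)) (t := S)
    (fun p hp => by
      obtain ⟨v, u⟩ := p
      exact mem_dr.1 hp)]
  rw [Finset.sum_const_nat (m := 2), mul_comm]
  intro e he
  induction e with | _ a b =>
  have hab : a ≠ b := by rintro rfl; exact hS _ he
  have : (dr S).filter (fun p => s(p.1, p.2) = s(a, b)) = {(a, b), (b, a)} := by
    ext ⟨x, y⟩
    simp only [Finset.mem_filter, mem_dr, Finset.mem_insert, Finset.mem_singleton, Prod.mk.injEq]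
    constructor
    · rintro ⟨-, h⟩
      rw [Sym2.eq_iff] at h
      exact h
    · rintro (⟨rfl, rfl⟩ | ⟨rfl, rfl⟩)
      · exact ⟨he, rfl⟩
      · exact ⟨Sym2.eq_swap ▸ he, Sym2.eq_swap⟩
  rw [this, Finset.card_pair]
  simp only [ne_eq, Prod.mk.injEq, not_and]
  intro h1
  exact absurd h1 hab

/-- weights inside a triangle -/
def W3 (x α β : Prop) : ℤ := if x then (if α then 12 else 0) else if β then -6 else
  if α then 12 else 0

/-- the other edge of the face at `v` is a 33-edge -/
def Pg (G : SimpleGraph V) (l r : Sym2 V → ι) (i : ι) (v u : V) : Prop :=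
  ∃ x, x ≠ u ∧ s(v, x) ∈ F G l r i ∧ g33 G l r s(v, x)

/-- discharging weights -/
def wt (G : SimpleGraph V) (l r : Sym2 V → ι) (i : ι) (v u : V) : ℤ :=
  if (F G l r i).card = 3 then W3 (g33 G l r s(v, u)) (Pg G l r i v u) (Pg G l r i u v)
  else if (F G l r i).card = 4 then 13 else 24

theorem Pg_tri {i : ι} {a b c : V} (ab : a ≠ b) (bc : b ≠ c) (ac : a ≠ c)
    (hF : F G l r i = {s(a, b), s(b, c), s(a, c)}) : Pg G l r i a b ↔ g33 G l r s(a, c) := by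
  constructor
  · rintro ⟨x, hx, hm, hg⟩
    rcases tri_deg ab.symm ac.symm hF hm with q | q
    · exact absurd q hx
    · exact q ▸ hg
  · intro hg
    exact ⟨c, bc.symm, by rw [hF]; simp, hg⟩

theorem tri_rot (a b c : V) : ({s(a, b), s(b, c), s(a, c)} : Finset (Sym2 V)) =
    {s(b, a), s(a, c), s(b, c)} := by
  rw [Sym2.eq_swap (a := b) (b := a)]
  ext e
  simp only [Finset.mem_insert, Finset.mem_singleton]
  tauto

theorem tri_rot2 (a b c : V) : ({s(a, b), s(b, c), s(a, c)} : Finset (Sym2 V)) =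
    {s(a, c), s(c, b), s(a, b)} := by
  rw [Sym2.eq_swap (a := c) (b := b)]
  ext e
  simp only [Finset.mem_insert, Finset.mem_singleton]
  tauto

theorem wt_tri {i : ι} {a b c : V} (ab : a ≠ b) (bc : b ≠ c) (ac : a ≠ c)
    (hF : F G l r i = {s(a, b), s(b, c), s(a, c)}) :
    wt G l r i a b = W3 (g33 G l r s(a, b)) (g33 G l r s(a, c)) (g33 G l r s(b, c)) := by
  have h1 : (F G l r i).card = 3 := by rw [hF]; exact card3 ab bc ac
  unfold wt
  rw [if_pos h1, propext (Pg_tri ab bc ac hF),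
    propext (Pg_tri ab.symm ac bc (hF.trans (tri_rot a b c)))]

theorem Ctx.tri_sum (h : Ctx G A l r) {i : ι} (hc : (F G l r i).card = 3) :
    ∑ p ∈ dr (F G l r i), wt G l r i p.1 p.2 ≤ 12 := by
  obtain ⟨e, he⟩ := Finset.card_pos.1 (by rw [hc]; omega : 0 < (F G l r i).card)
  induction e with | _ a b =>
  obtain ⟨c, ab, ac, bc, hF⟩ := h.tri hc he
  have hdr : dr (F G l r i) = {(a, b), (b, a), (b, c), (c, b), (a, c), (c, a)} := by
    ext ⟨x, y⟩
    rw [mem_dr, hF]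
    simp only [Finset.mem_insert, Finset.mem_singleton, Prod.mk.injEq, Sym2.eq_iff]
    tauto
  have n1 := ab.ne
  have n2 := bc.ne
  have n3 := ac.ne
  have n1' := ab.ne'
  have n2' := bc.ne'
  have n3' := ac.ne'
  rw [hdr, Finset.sum_insert (by simp; grind), Finset.sum_insert (by simp; grind),
    Finset.sum_insert (by simp; grind), Finset.sum_insert (by simp; grind),
    Finset.sum_insert (by simp; grind), Finset.sum_singleton]
  have hF2 := hF.trans (tri_rot a b c)
  have hF3 := hF2.trans (tri_rot2 b a c)
  have hF4 := hF3.trans (tri_rot b c a)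
  have hF5 := hF4.trans (tri_rot2 c b a)
  have hF6 := hF5.trans (tri_rot c a b)
  dsimp only
  rw [wt_tri n1 n2 n3 hF, wt_tri n1' n3 n2 hF2, wt_tri n2 n3' n1' hF3, wt_tri n2' n1' n3' hF4,
    wt_tri n3 n2' n1 hF6, wt_tri n3' n1 n2' hF5]
  rw [Sym2.eq_swap (a := b) (b := a), Sym2.eq_swap (a := c) (b := b), Sym2.eq_swap (a := c) (b := a)]
  have key : ¬ (g33 G l r s(a, b) ∧ g33 G l r s(b, c) ∧ g33 G l r s(a, c)) := by
    rintro ⟨g1, g2, g3⟩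
    exact h.no333 (i := i) (by rw [hF]; simp) (by rw [hF]; simp) (by rw [hF]; simp) g1 g2 g3
  generalize g33 G l r s(a, b) = P1 at *
  generalize g33 G l r s(b, c) = P2 at *
  generalize g33 G l r s(a, c) = P3 at *
  unfold W3
  by_cases h1 : P1 <;> by_cases h2 : P2 <;> by_cases h3 : P3 <;> simp [h1, h2, h3]
  exact key ⟨h1, h2, h3⟩

theorem Ctx.face_bound (h : Ctx G A l r) {i : ι} (hi : i ∈ Fc G l r) :
    ∑ p ∈ dr (F G l r i), wt G l r i p.1 p.2 +
      36 * ((A.filter (fun v => AT G l r i v)).card : ℤ) ≤ 92 * ((F G l r i).card : ℤ) - 264 := by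
  have hno : ∀ v, s(v, v) ∉ F G l r i := by
    intro v hv
    have : G.Adj v v := (mem_F.1 hv).1
    exact this.ne rfl
  have hemp : (F G l r i).card < 6 → (A.filter (fun v => AT G l r i v)).card = 0 := by
    intro hlt
    rw [Finset.card_eq_zero, Finset.filter_eq_empty_iff]
    rintro v - ⟨z, p, q, hT⟩
    have := hT.big
    omega
  have hcd := card_dr hno
  rcases h.size (mem_Fc.1 hi) with h3 | h4 | h6
  · have := h.tri_sum h3
    rw [hemp (by omega), h3]
    push_cast
    linarith
  · have : ∑ p ∈ dr (F G l r i), wt G l r i p.1 p.2 = ∑ p ∈ dr (F G l r i), (13 : ℤ) := by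
      refine Finset.sum_congr rfl fun p _ => ?_
      simp [wt, h4]
    rw [this, Finset.sum_const, hcd, hemp (by omega), h4]
    norm_num
  · have : ∑ p ∈ dr (F G l r i), wt G l r i p.1 p.2 = ∑ p ∈ dr (F G l r i), (24 : ℤ) := by
      refine Finset.sum_congr rfl fun p _ => ?_
      have n3 : (F G l r i).card ≠ 3 := by omega
      have n4 : (F G l r i).card ≠ 4 := by omega
      simp [wt, n3, n4]
    have hn := h.numA i h6
    rw [this, Finset.sum_const, hcd]
    simp only [nsmul_eq_mul]
    push_cast
    have hn' : ((A.filter (fun v => AT G l r i v)).card : ℤ) + 6 ≤ ((F G l r i).card : ℤ) := by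
      exact_mod_cast hn
    have h6' : (6 : ℤ) ≤ ((F G l r i).card : ℤ) := by exact_mod_cast h6
    linarith

/-- contribution of a dart -/
def ct (G : SimpleGraph V) (l r : Sym2 V → ι) (v u : V) : ℤ :=
  wt G l r (l s(v, u)) v u + wt G l r (r s(v, u)) v u

/-- neighbours -/
def N (G : SimpleGraph V) (v : V) : Finset V := Finset.univ.filter (fun u => G.Adj v u)

theorem mem_N {v u : V} : u ∈ N G v ↔ G.Adj v u := by simp [N]

theorem Ctx.faces_of (h : Ctx G A l r) {e} (he : e ∈ G.edgeSet) (g : ι → ℤ) :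
    ∑ i ∈ (Fc G l r).filter (fun i => e ∈ F G l r i), g i = g (l e) + g (r e) := by
  have : (Fc G l r).filter (fun i => e ∈ F G l r i) = {l e, r e} := by
    ext i
    simp only [Finset.mem_filter, Finset.mem_insert, Finset.mem_singleton]
    constructor
    · rintro ⟨-, hi⟩
      rcases (mem_F.1 hi).2 with q | q
      · exact Or.inl q.symm
      · exact Or.inr q.symm
    · rintro (rfl | rfl)
      · exact ⟨mem_Fc.2 ⟨_, memFl he⟩, memFl he⟩
      · exact ⟨mem_Fc.2 ⟨_, memFr he⟩, memFr he⟩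
  rw [this, Finset.sum_pair (h.lr he)]

theorem Ctx.exch (h : Ctx G A l r) :
    ∑ i ∈ Fc G l r, ∑ p ∈ dr (F G l r i), wt G l r i p.1 p.2 =
      ∑ v ∈ A, ∑ u ∈ N G v, ct G l r v u := by
  have h1 : ∑ i ∈ Fc G l r, ∑ p ∈ dr (F G l r i), wt G l r i p.1 p.2 =
      ∑ p : V × V, ∑ i ∈ (Fc G l r).filter (fun i => s(p.1, p.2) ∈ F G l r i),
        wt G l r i p.1 p.2 := by
    simp only [dr, Finset.sum_filter]
    rw [Finset.sum_comm]
  rw [h1, Fintype.sum_prod_type, ← Finset.sum_subset (Finset.subset_univ A)]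
  · refine Finset.sum_congr rfl fun v hv => ?_
    rw [← Finset.sum_subset (Finset.subset_univ (N G v))]
    · refine Finset.sum_congr rfl fun u hu => ?_
      exact h.faces_of (e := s(v, u)) (mem_N.1 hu) (fun i => wt G l r i v u)
    · intro u _ hu
      refine Finset.sum_eq_zero fun i hi => ?_
      exact absurd (mem_N.2 (mem_F.1 (Finset.mem_filter.1 hi).2).1) hu
  · intro v _ hv
    refine Finset.sum_eq_zero fun u _ => Finset.sum_eq_zero fun i hi => ?_
    exact absurd (h.hA _ _ (mem_F.1 (Finset.mem_filter.1 hi).2).1) hv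

theorem Ctx.sum_card (h : Ctx G A l r) :
    ∑ i ∈ Fc G l r, ((F G l r i).card : ℤ) = 2 * ((Ed G).card : ℤ) := by
  have h1 : ∑ i ∈ Fc G l r, ((F G l r i).card : ℤ) =
      ∑ e : Sym2 V, ∑ i ∈ (Fc G l r).filter (fun i => e ∈ F G l r i), (1 : ℤ) := by
    simp only [Finset.sum_filter]
    rw [Finset.sum_comm]
    refine Finset.sum_congr rfl fun i _ => ?_
    rw [← Finset.sum_filter]
    simp
  rw [h1, ← Finset.sum_subset (Finset.subset_univ (Ed G))]
  · rw [Finset.sum_congr rfl (fun e he => h.faces_of (mem_Ed.1 he) (fun _ => 1))]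
    simp
    ring
  · intro e _ he
    refine Finset.sum_eq_zero fun i hi => ?_
    exact absurd (mem_Ed.2 (mem_F.1 (Finset.mem_filter.1 hi).2).1) he

theorem Ctx.count (h : Ctx G A l r) (hv : ∀ v ∈ A, (72 : ℤ) ≤ ∑ u ∈ N G v, ct G l r v u +
    if ∃ k ∈ Fc G l r, AT G l r k v then 36 else 0) : 5 * (Ed G).card + 33 ≤ 12 * A.card := by
  have h1 := Finset.sum_le_sum hv
  rw [Finset.sum_add_distrib, ← h.exch] at h1
  have h2 : ∑ v ∈ A, (if ∃ k ∈ Fc G l r, AT G l r k v then (36 : ℤ) else 0) ≤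
      ∑ k ∈ Fc G l r, 36 * ((A.filter (fun v => AT G l r k v)).card : ℤ) := by
    have : ∀ k ∈ Fc G l r, 36 * ((A.filter (fun v => AT G l r k v)).card : ℤ) =
        ∑ v ∈ A, if AT G l r k v then (36 : ℤ) else 0 := by
      intro k _
      rw [← Finset.sum_filter]
      simp
      ring
    rw [Finset.sum_congr rfl this, Finset.sum_comm]
    refine Finset.sum_le_sum fun v _ => ?_
    split_ifs with hk
    · obtain ⟨k, hk, ha⟩ := hk
      have := Finset.single_le_sum (s := Fc G l r)
        (f := fun k => if AT G l r k v then (36 : ℤ) else 0)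
        (fun k _ => by split_ifs <;> norm_num) hk
      simpa [ha] using this
    · exact Finset.sum_nonneg fun k _ => by split_ifs <;> norm_num
  have h3 := Finset.sum_le_sum (fun i (hi : i ∈ Fc G l r) => h.face_bound hi)
  rw [Finset.sum_add_distrib, Finset.sum_sub_distrib, ← Finset.mul_sum (a := (92 : ℤ)),
    h.sum_card] at h3
  have h4 := h.rank
  simp only [Finset.sum_const, nsmul_eq_mul] at h1 h3
  have h4' : ((Ed G).card : ℤ) + 2 ≤ (A.card : ℤ) + ((Fc G l r).card : ℤ) := by exact_mod_cast h4
  have : 5 * ((Ed G).card : ℤ) + 33 ≤ 12 * (A.card : ℤ) := by linarith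
  exact_mod_cast this

end

end Dow

namespace Dow

open scoped Classical

noncomputable section

set_option linter.unusedSectionVars false
set_option linter.unusedVariables false

variable {V : Type} [Fintype V]

variable {ι : Type} {G : SimpleGraph V} {A : Finset V} {l r : Sym2 V → ι}

theorem W3_ge (x α β : Prop) : -6 ≤ W3 x α β := by
  unfold W3
  split_ifs <;> norm_num

theorem W3_nonneg {x : Prop} (hx : x) (α β : Prop) : 0 ≤ W3 x α β := by
  unfold W3
  rw [if_pos hx]
  split_ifs <;> norm_num

/-- mixed edges: exactly one triangular face -/
def mx (G : SimpleGraph V) (l r : Sym2 V → ι) (e : Sym2 V) : Prop :=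
  e ∈ G.edgeSet ∧ ¬ ((F G l r (l e)).card = 3 ↔ (F G l r (r e)).card = 3)

theorem Ctx.ct2 (h : Ctx G A l r) {v u : V} {i j : ι} (hij : i ≠ j) (hi : s(v, u) ∈ F G l r i)
    (hj : s(v, u) ∈ F G l r j) : ct G l r v u = wt G l r i v u + wt G l r j v u := by
  have he := (mem_F.1 hi).1
  have hlr := h.lr he
  unfold ct
  rcases (mem_F.1 hi).2 with q1 | q1 <;> rcases (mem_F.1 hj).2 with q2 | q2
  · exact absurd (q1.symm.trans q2) hij
  · rw [q1, q2]
  · rw [q1, q2, add_comm]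
  · exact absurd (q1.symm.trans q2) hij

theorem Ctx.mx_faces (h : Ctx G A l r) {e} (hm : mx G l r e) : ∃ i k, i ≠ k ∧ e ∈ F G l r i ∧
    e ∈ F G l r k ∧ (F G l r i).card = 3 ∧ 6 ≤ (F G l r k).card := by
  have he := hm.1
  have key : ∀ {i k : ι}, e ∈ F G l r i → e ∈ F G l r k → (F G l r i).card = 3 →
      (F G l r k).card ≠ 3 → 6 ≤ (F G l r k).card := by
    intro i k hi hk ci ck
    rcases h.size ⟨_, hk⟩ with q | q | q
    · exact absurd q ck
    · exact (h.no34 ci q hi hk).elim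
    · exact q
  have hm2 := hm.2
  by_cases h1 : (F G l r (l e)).card = 3
  · have h2 : (F G l r (r e)).card ≠ 3 := by tauto
    exact ⟨_, _, h.lr he, memFl he, memFr he, h1, key (memFl he) (memFr he) h1 h2⟩
  · have h2 : (F G l r (r e)).card = 3 := by tauto
    exact ⟨_, _, (h.lr he).symm, memFr he, memFl he, h2, key (memFr he) (memFl he) h2 h1⟩

theorem wt_big {k : ι} (hk : 6 ≤ (F G l r k).card) (v u : V) : wt G l r k v u = 24 := by
  unfold wt
  rw [if_neg (by omega), if_neg (by omega)]

theorem Ctx.ct_mx (h : Ctx G A l r) {v u : V} (hm : mx G l r s(v, u)) : 18 ≤ ct G l r v u := by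
  obtain ⟨i, k, hik, hi, hk, ci, ck⟩ := h.mx_faces hm
  rw [h.ct2 hik hi hk, wt_big ck]
  unfold wt
  rw [if_pos ci]
  have := W3_ge (g33 G l r s(v, u)) (Pg G l r i v u) (Pg G l r i u v)
  linarith

theorem ct_33 {v u : V} (hg : g33 G l r s(v, u)) : 0 ≤ ct G l r v u := by
  unfold ct wt
  rw [if_pos hg.2.1, if_pos hg.2.2]
  exact add_nonneg (W3_nonneg hg _ _) (W3_nonneg hg _ _)

theorem Ctx.wt_n3 (h : Ctx G A l r) {i : ι} (v u : V) (hi : (F G l r i).card ≠ 3) :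
    13 ≤ wt G l r i v u ∧ ((F G l r i).card ≠ 4 → wt G l r i v u = 24) := by
  unfold wt
  rw [if_neg hi]
  split_ifs with h4
  · exact ⟨le_refl _, fun q => absurd h4 q⟩
  · exact ⟨by norm_num, fun _ => rfl⟩

/-- edges that are neither 33 nor mixed -/
theorem Ctx.ct_n (h : Ctx G A l r) {v u : V} (hvu : G.Adj v u) (hg : ¬ g33 G l r s(v, u))
    (hm : ¬ mx G l r s(v, u)) : 26 ≤ ct G l r v u ∧ (37 ≤ ct G l r v u ∨
      ((F G l r (l s(v, u))).card = 4)) := by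
  have he : s(v, u) ∈ G.edgeSet := hvu
  have h1 : (F G l r (l s(v, u))).card ≠ 3 := by
    intro q
    apply hm
    refine ⟨he, fun hh => hg ⟨he, q, hh.1 q⟩⟩
  have h2 : (F G l r (r s(v, u))).card ≠ 3 := by
    intro q
    apply hm
    refine ⟨he, fun hh => hg ⟨he, hh.2 q, q⟩⟩
  have w1 := h.wt_n3 v u h1
  have w2 := h.wt_n3 v u h2
  unfold ct
  refine ⟨by linarith [w1.1, w2.1], ?_⟩
  by_cases h4 : (F G l r (l s(v, u))).card = 4
  · exact Or.inr h4
  · left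
    have := w1.2 h4
    linarith [w2.1]

theorem Ctx.ct_nonneg (h : Ctx G A l r) {v u : V} (hvu : G.Adj v u) : 0 ≤ ct G l r v u := by
  by_cases hg : g33 G l r s(v, u)
  · exact ct_33 hg
  by_cases hm : mx G l r s(v, u)
  · linarith [h.ct_mx hm]
  · linarith [(h.ct_n hvu hg hm).1]

theorem Ctx.three (h : Ctx G A l r) {v : V} (hv : v ∈ A) : 3 ≤ (N G v).card := by
  obtain ⟨a, ha, -⟩ := h.deg v hv v v
  obtain ⟨b, hb, hba, -⟩ := h.deg v hv a a
  obtain ⟨c, hc, hca, hcb⟩ := h.deg v hv a b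
  have : ({a, b, c} : Finset V) ⊆ N G v := by
    intro t ht
    simp only [Finset.mem_insert, Finset.mem_singleton] at ht
    rw [mem_N]
    rcases ht with rfl | rfl | rfl <;> assumption
  have h2 := Finset.card_le_card this
  rw [Finset.card_eq_three.2 ⟨a, b, c, hba.symm, hca.symm, hcb.symm, rfl⟩] at h2
  exact h2

theorem Ctx.mx_even (h : Ctx G A l r) (v : V) :
    Even ((N G v).filter (fun u => mx G l r s(v, u))).card := by
  have hc := (h.hd.1 (fun i => if (F G l r i).card = 3 then 1 else 0)).2 v
  unfold bd at hc
  have : ∀ u, cob G l r (fun i => if (F G l r i).card = 3 then 1 else 0) s(v, u) =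
      if u ∈ (N G v).filter (fun u => mx G l r s(v, u)) then 1 else 0 := by
    intro u
    simp only [Finset.mem_filter, mem_N]
    unfold mx
    by_cases hu : G.Adj v u
    · have he : s(v, u) ∈ G.edgeSet := hu
      rw [cob_mem he]
      by_cases h1 : (F G l r (l s(v, u))).card = 3 <;>
        by_cases h2 : (F G l r (r s(v, u))).card = 3 <;> simp [hu, h1, h2, z2self]
    · rw [cob_nmem (not_mem_of_not_adj hu)]
      simp [hu]
  rw [Finset.sum_congr rfl (fun u _ => this u), ← Finset.sum_filter] at hc
  simp only [Finset.filter_mem_eq_inter, Finset.univ_inter, Finset.sum_const, nsmul_eq_mul,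
    mul_one] at hc
  exact (ZMod.natCast_eq_zero_iff_even).1 hc

theorem sum_ge {S T : Finset V} {f : V → ℤ} (hT : T ⊆ S) (h0 : ∀ u ∈ S, 0 ≤ f u) (m : ℤ)
    (hm : ∀ u ∈ T, m ≤ f u) : (T.card : ℤ) * m ≤ ∑ u ∈ S, f u := by
  calc (T.card : ℤ) * m = ∑ u ∈ T, m := by simp
    _ ≤ ∑ u ∈ T, f u := Finset.sum_le_sum hm
    _ ≤ _ := Finset.sum_le_sum_of_subset_of_nonneg hT (fun u hu _ => h0 u hu)

theorem Ctx.vertex0 (h : Ctx G A l r) {v : V} (hv : v ∈ A)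
    (h0 : ∀ u, G.Adj v u → ¬ mx G l r s(v, u)) : 72 ≤ ∑ u ∈ N G v, ct G l r v u := by
  have h3 := h.three hv
  have h3' : (3 : ℤ) ≤ ((N G v).card : ℤ) := by exact_mod_cast h3
  have hnn : ∀ u ∈ N G v, 0 ≤ ct G l r v u := fun u hu => h.ct_nonneg (mem_N.1 hu)
  by_cases hex : ∃ u, G.Adj v u ∧ g33 G l r s(v, u)
  · obtain ⟨u0, hu0, hg0⟩ := hex
    have hall : ∀ {b m}, s(v, b) ∈ F G l r m → (F G l r m).card = 3 := by
      intro b m hb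
      refine h.aroundF (fun m => (F G l r m).card = 3) (memFl hg0.1) hg0.2.1 ?_ hb
      intro u m m' hm hu hu'
      by_cases hmm : m = m'
      · rw [← hmm]; exact hm
      by_contra hne
      have he := (mem_F.1 hu).1
      apply h0 u he
      refine ⟨he, ?_⟩
      rcases (mem_F.1 hu).2 with q1 | q1 <;> rcases (mem_F.1 hu').2 with q2 | q2
      · exact absurd (q1.symm.trans q2) hmm
      · rw [q1, q2]; tauto
      · rw [q1, q2]; tauto
      · exact absurd (q1.symm.trans q2) hmm
    have hg : ∀ {u}, G.Adj v u → g33 G l r s(v, u) := fun {u} hu => ⟨hu, hall (memFl hu), hall (memFr hu)⟩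
    have hP : ∀ {u i}, s(v, u) ∈ F G l r i → wt G l r i v u = 12 := by
      intro u i hi
      have hp : Pg G l r i v u := by
        obtain ⟨x, hx, hxi⟩ := (h.ev i).oth hi
        exact ⟨x, hx, hxi, hg (mem_F.1 hxi).1⟩
      unfold wt W3
      rw [if_pos (hall hi), if_pos (hg (mem_F.1 hi).1), if_pos hp]
    have := sum_ge (Finset.Subset.refl (N G v)) hnn 24 (by
      intro u hu
      have he : s(v, u) ∈ G.edgeSet := mem_N.1 hu
      unfold ct
      rw [hP (memFl he), hP (memFr he)]
      norm_num)
    linarith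
  · have := sum_ge (Finset.Subset.refl (N G v)) hnn 26 (by
      intro u hu
      have hu' := mem_N.1 hu
      exact (h.ct_n hu' (fun q => hex ⟨u, hu', q⟩) (h0 u hu')).1)
    linarith

theorem Ctx.typeA (h : Ctx G A l r) {v z p q : V} {i j : ι} (hij : i ≠ j) (hpq : p ≠ q)
    (gz : g33 G l r s(v, z)) (mp : mx G l r s(v, p))
    (hadj : ∀ t, G.Adj v t ↔ t = z ∨ t = p ∨ t = q)
    (hi : F G l r i = {s(v, z), s(z, p), s(v, p)}) (hj : F G l r j = {s(v, z), s(z, q), s(v, q)})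
    (gp : g33 G l r s(z, p)) : ∃ k ∈ Fc G l r, AT G l r k v := by
  have vz : G.Adj v z := (hadj z).2 (by tauto)
  have vp : G.Adj v p := (hadj p).2 (by tauto)
  have vq : G.Adj v q := (hadj q).2 (by tauto)
  have hzi : s(z, v) ∈ F G l r i := by rw [hi, Sym2.eq_swap]; simp
  have hpi : s(z, p) ∈ F G l r i := by rw [hi]; simp
  have hzj : s(z, v) ∈ F G l r j := by rw [hj, Sym2.eq_swap]; simp
  obtain ⟨q', j', m, n1, n2, hz, gq', hij', him, hjm, _, vq', pq', hFi, hFj, hFm⟩ :=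
    h.center vp.ne hzi hpi (Sym2.eq_swap ▸ gz) gp
  have hzj' : s(z, v) ∈ F G l r j' := by rw [hFj]; simp
  have ejj : j = j' := by
    rcases only2 hzi hzj' hij' hzj with q | q
    · exact absurd q.symm hij
    · exact q
  subst ejj
  have eqq : q = q' := by
    have m1 : s(v, q) ∈ F G l r j := by rw [hj]; simp
    have m2 := tri_deg (v := v) (u := z) (x := q') vz.ne' n1 (hFj.trans (tri_rot z v q')) m1
    rcases m2 with e | e
    · subst e
      rw [Finset.ext_iff] at hj
      have := (hj s(q, q')).1 (by rw [hFj]; simp)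
      have zq' : G.Adj q q' := (hz q').2 (by tauto)
      simp only [Finset.mem_insert, Finset.mem_singleton, Sym2.eq_iff] at this
      have := zq'.ne
      grind
    · exact e
  subst eqq
  obtain ⟨i', k, hik, hi', hk, ci, ck⟩ := h.mx_faces mp
  refine ⟨k, mem_Fc.2 ⟨_, hk⟩, z, p, q, hadj, hz, pq', ⟨i, j, m, hij, him, hjm, hFi, hFj, hFm⟩,
    hk, ?_, ck⟩
  obtain ⟨c, hc, hck⟩ := (h.ev k).oth hk
  rcases (hadj c).1 (mem_F.1 hck).1 with e | e | e
  · subst e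
    have := gz.sz hck
    omega
  · exact absurd e hc
  · exact e ▸ hck

theorem Ctx.ct_rim (h : Ctx G A l r) {v z p : V} {i : ι} (vz : v ≠ z) (vp : v ≠ p) (zp : z ≠ p)
    (gz : g33 G l r s(v, z)) (mp : mx G l r s(v, p))
    (hi : F G l r i = {s(v, z), s(z, p), s(v, p)}) (gp : ¬ g33 G l r s(z, p)) :
    36 ≤ ct G l r v p := by
  obtain ⟨i', k, hik, hi', hk, ci, ck⟩ := h.mx_faces mp
  have hip : s(v, p) ∈ F G l r i := by rw [hi]; simp
  have c3 : (F G l r i).card = 3 := by rw [hi]; exact card3 vz zp vp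
  have ngp : ¬ g33 G l r s(v, p) := by
    intro hg
    have := hg.sz hk
    omega
  have e : i' = i := by
    by_contra hne
    exact ngp (h.g33_of hne hi' hip ci c3)
  subst e
  rw [h.ct2 hik hi' hk, wt_big ck, wt_tri vp zp.symm vz (hi.trans (tri_rot2 v z p)),
    Sym2.eq_swap (a := p) (b := z)]
  unfold W3
  rw [if_neg ngp, if_neg gp, if_pos gz]
  norm_num

end

end Dow

namespace Dow

open scoped Classical

noncomputable section

set_option linter.unusedSectionVars false
set_option linter.unusedVariables false

variable {V : Type} [Fintype V]

variable {ι : Type} {G : SimpleGraph V} {A : Finset V} {l r : Sym2 V → ι}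

theorem sum_ge_fin {S T : Finset V} {f : V → ℤ} (hT : T ⊆ S) (h0 : ∀ u ∈ S, 0 ≤ f u) :
    ∑ u ∈ T, f u ≤ ∑ u ∈ S, f u :=
  Finset.sum_le_sum_of_subset_of_nonneg hT (fun u hu _ => h0 u hu)

/-- the neighbour next to a 33-edge, when no further 33-edge bounds the same face -/
theorem Ctx.vertex2a (h : Ctx G A l r) {v p q : V} (hv : v ∈ A) (hpq : p ≠ q)
    (mp : mx G l r s(v, p)) (mq : mx G l r s(v, q))
    (hoth : ∀ u, G.Adj v u → u ≠ p → u ≠ q → g33 G l r s(v, u)) :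
    72 ≤ ∑ u ∈ N G v, ct G l r v u + if ∃ k ∈ Fc G l r, AT G l r k v then 36 else 0 := by
  have hnn : ∀ u ∈ N G v, 0 ≤ ct G l r v u := fun u hu => h.ct_nonneg (mem_N.1 hu)
  have ng : ∀ {u}, mx G l r s(v, u) → ¬ g33 G l r s(v, u) := by
    intro u hm hg
    exact hm.2 (iff_of_true hg.2.1 hg.2.2)
  -- the third vertex of a triangle at a 33-edge is `p` or `q`
  have third : ∀ {z i}, g33 G l r s(v, z) → s(v, z) ∈ F G l r i →
      ∃ x, (x = p ∨ x = q) ∧ G.Adj z x ∧ F G l r i = {s(v, z), s(z, x), s(v, x)} := by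
    intro z i gz hzi
    obtain ⟨x, vz, vx, zx, hF⟩ := h.tri (gz.sz hzi) hzi
    refine ⟨x, ?_, zx, hF⟩
    by_contra hne
    push Not at hne
    have gx := hoth x vx hne.1 hne.2
    obtain ⟨t, _, _, t1, t2, ht, gt, _⟩ := h.center zx.ne hzi (by rw [hF]; simp) gz gx
    have vp : G.Adj v p := mp.1
    rcases (ht p).1 vp with e | e | e
    · subst e; exact ng mp gz
    · subst e; exact ng mp gx
    · subst e; exact ng mp gt
  obtain ⟨z, vz, hzp, hzq⟩ := h.deg v hv p q
  have gz := hoth z vz hzp hzq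
  obtain ⟨x, hx, zx, hFi⟩ := third gz (memFl gz.1)
  obtain ⟨y, hy, zy, hFj⟩ := third gz (memFr gz.1)
  have hij := h.lr gz.1
  have hxy : x ≠ y := by
    rintro rfl
    exact h.tri_ne hij gz.2.1 gz.2.2 (v := v) (a := z) (b := x) zx.ne (by rw [hFi]; simp)
      (by rw [hFj]; simp) (by rw [hFi]; simp) (by rw [hFj]; simp)
  have mX : mx G l r s(v, x) := by rcases hx with rfl | rfl <;> assumption
  have mY : mx G l r s(v, y) := by rcases hy with rfl | rfl <;> assumption
  have hpqxy : ∀ t, (t = p ∨ t = q) ↔ (t = x ∨ t = y) := by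
    intro t
    rcases hx with rfl | rfl <;> rcases hy with rfl | rfl <;> tauto
  have hoth' : ∀ u, G.Adj v u → u ≠ x → u ≠ y → g33 G l r s(v, u) := by
    intro u hu h1 h2
    have := (hpqxy u)
    exact hoth u hu (by tauto) (by tauto)
  generalize l s(v, z) = i at *
  generalize r s(v, z) = j at *
  have vx : G.Adj v x := mX.1
  have vy : G.Adj v y := mY.1
  have uniq : ∀ {t m m'}, mx G l r s(v, t) → s(v, t) ∈ F G l r m → s(v, t) ∈ F G l r m' →
      (F G l r m).card = 3 → (F G l r m').card = 3 → m = m' := by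
    intro t m m' ht h1 h2 c1 c2
    by_contra hne
    exact ng ht (h.g33_of hne h1 h2 c1 c2)
  have ci : (F G l r i).card = 3 := by rw [hFi]; exact card3 vz.ne zx.ne vx.ne
  have cj : (F G l r j).card = 3 := by rw [hFj]; exact card3 vz.ne zy.ne vy.ne
  have xi : s(v, x) ∈ F G l r i := by rw [hFi]; simp
  have yj : s(v, y) ∈ F G l r j := by rw [hFj]; simp
  have hadj : ∀ t, G.Adj v t ↔ t = z ∨ t = x ∨ t = y := by
    intro t
    constructor
    · intro vt
      by_cases htx : t = x
      · tauto
      by_cases hty : t = y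
      · tauto
      left
      have gt := hoth' t vt htx hty
      obtain ⟨s, hs, ts, hF⟩ := third gt (memFl gt.1)
      have cl := gt.2.1
      have hsl : s(v, s) ∈ F G l r (l s(v, t)) := by rw [hF]; simp
      have htl := memFl (l := l) (r := r) gt.1
      rcases (hpqxy s).1 hs with e | e
      · subst e
        have := uniq mX hsl xi cl ci
        rw [this] at htl
        exact (tri_deg vz.ne' vx.ne' hFi htl).resolve_right htx
      · subst e
        have := uniq mY hsl yj cl cj
        rw [this] at htl
        exact (tri_deg vz.ne' vy.ne' hFj htl).resolve_right hty
    · rintro (rfl | rfl | rfl) <;> assumption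
  have hs : ct G l r v x + ct G l r v y ≤ ∑ u ∈ N G v, ct G l r v u := by
    rw [← Finset.sum_pair hxy]
    refine sum_ge_fin ?_ hnn
    intro t ht
    simp only [Finset.mem_insert, Finset.mem_singleton] at ht
    rw [mem_N]
    rcases ht with rfl | rfl <;> assumption
  have c1 := h.ct_mx mX
  have c2 := h.ct_mx mY
  by_cases g1 : g33 G l r s(z, x)
  · rw [if_pos (h.typeA hij hxy gz mX hadj hFi hFj g1)]
    linarith
  by_cases g2 : g33 G l r s(z, y)
  · rw [if_pos (h.typeA hij.symm hxy.symm gz mY (fun t => (hadj t).trans (by tauto)) hFj hFi g2)]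
    linarith
  have d1 := h.ct_rim vz.ne vx.ne zx.ne gz mX hFi g1
  have d2 := h.ct_rim vz.ne vy.ne zy.ne gz mY hFj g2
  split_ifs <;> linarith

theorem Ctx.vertex (h : Ctx G A l r) {v : V} (hv : v ∈ A) :
    72 ≤ ∑ u ∈ N G v, ct G l r v u + if ∃ k ∈ Fc G l r, AT G l r k v then 36 else 0 := by
  have hnn : ∀ u ∈ N G v, 0 ≤ ct G l r v u := fun u hu => h.ct_nonneg (mem_N.1 hu)
  have hev := h.mx_even v
  set M := (N G v).filter (fun u => mx G l r s(v, u)) with hM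
  have memM : ∀ u, u ∈ M ↔ mx G l r s(v, u) := by
    intro u
    rw [hM, Finset.mem_filter, mem_N]
    exact ⟨fun q => q.2, fun q => ⟨q.1, q⟩⟩
  have hMN : M ⊆ N G v := Finset.filter_subset _ _
  have hif : (0 : ℤ) ≤ if ∃ k ∈ Fc G l r, AT G l r k v then 36 else 0 := by
    split_ifs <;> norm_num
  by_cases hM0 : M.card = 0
  · have := h.vertex0 hv (fun u hu hm => by
      have := (memM u).2 hm
      rw [Finset.card_eq_zero] at hM0
      rw [hM0] at this
      simp at this)
    linarith
  by_cases hM4 : 4 ≤ M.card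
  · have := sum_ge hMN hnn 18 (fun u hu => h.ct_mx ((memM u).1 hu))
    have h4 : (4 : ℤ) ≤ (M.card : ℤ) := by exact_mod_cast hM4
    linarith
  have hM2 : M.card = 2 := by
    obtain ⟨m, hm⟩ := hev
    omega
  obtain ⟨p, q, hpq, hMpq⟩ := Finset.card_eq_two.1 hM2
  have mp : mx G l r s(v, p) := (memM p).1 (by rw [hMpq]; simp)
  have mq : mx G l r s(v, q) := (memM q).1 (by rw [hMpq]; simp)
  have hnm : ∀ u, mx G l r s(v, u) → u = p ∨ u = q := by
    intro u hu
    have := (memM u).2 hu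
    rw [hMpq] at this
    simpa using this
  by_cases hall : ∀ u, G.Adj v u → u ≠ p → u ≠ q → g33 G l r s(v, u)
  · exact h.vertex2a hv hpq mp mq hall
  push Not at hall
  obtain ⟨u, vu, hup, huq, hg⟩ := hall
  have hmu : ¬ mx G l r s(v, u) := fun hm => by
    rcases hnm u hm with e | e
    · exact hup e
    · exact huq e
  have cu := h.ct_n vu hg hmu
  have vp : G.Adj v p := mp.1
  have vq : G.Adj v q := mq.1
  have c1 := h.ct_mx mp
  have c2 := h.ct_mx mq
  rcases cu.2 with c37 | c4
  · have hs : ∑ t ∈ ({p, q, u} : Finset V), ct G l r v t ≤ ∑ u ∈ N G v, ct G l r v u := by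
      refine sum_ge_fin ?_ hnn
      intro t ht
      simp only [Finset.mem_insert, Finset.mem_singleton] at ht
      rw [mem_N]
      rcases ht with rfl | rfl | rfl <;> assumption
    rw [Finset.sum_insert (by simp; tauto), Finset.sum_pair huq.symm] at hs
    linarith
  · obtain ⟨t, htu, ht⟩ := (h.ev (l s(v, u))).oth (memFl (show s(v, u) ∈ G.edgeSet from vu))
    have vt : G.Adj v t := (mem_F.1 ht).1
    have gt : ¬ g33 G l r s(v, t) := by
      intro hgt
      have := hgt.sz ht
      omega
    have mt : ¬ mx G l r s(v, t) := by
      intro hm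
      obtain ⟨i, k, -, hi, -, ci, -⟩ := h.mx_faces hm
      exact h.no34 ci c4 hi ht
    have htp : t ≠ p := by rintro rfl; exact mt mp
    have htq : t ≠ q := by rintro rfl; exact mt mq
    have ctt := (h.ct_n vt gt mt).1
    have hs : ∑ t ∈ ({p, q, u, t} : Finset V), ct G l r v t ≤ ∑ u ∈ N G v, ct G l r v u := by
      refine sum_ge_fin ?_ hnn
      intro t ht
      simp only [Finset.mem_insert, Finset.mem_singleton] at ht
      rw [mem_N]
      rcases ht with rfl | rfl | rfl | rfl <;> assumption
    rw [Finset.sum_insert (by simp; tauto), Finset.sum_insert (by simp; tauto),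
      Finset.sum_pair htu.symm] at hs
    linarith [cu.1]

theorem Ctx.final (h : Ctx G A l r) : 5 * (Ed G).card + 33 ≤ 12 * A.card :=
  h.count (fun v hv => h.vertex hv)

end

end Dow

namespace Dow

open scoped Classical

noncomputable section

set_option linter.unusedSectionVars false
set_option linter.unusedVariables false

variable {V : Type} [Fintype V]

variable {ι : Type} {G : SimpleGraph V} {A : Finset V} {l r : Sym2 V → ι}

/-- the graph of the edges inside `A` -/
def IG (G : SimpleGraph V) (A : Finset V) : SimpleGraph V where
  Adj u v := G.Adj u v ∧ u ∈ A ∧ v ∈ A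
  symm := ⟨fun u v h => ⟨h.1.symm, h.2.2, h.2.1⟩⟩
  loopless := ⟨fun u h => h.1.ne rfl⟩

theorem IG_le (G : SimpleGraph V) (A : Finset V) : IG G A ≤ G := fun u v h => h.1

theorem mem_EI {u v : V} : s(u, v) ∈ Ed (IG G A) ↔ G.Adj u v ∧ u ∈ A ∧ v ∈ A := by
  rw [mem_Ed, SimpleGraph.mem_edgeSet]
  rfl

/-- short paths inside `A` -/
def P2 (G : SimpleGraph V) (A : Finset V) (x y : V) : Prop := ∃ m ∈ A, G.Adj x m ∧ G.Adj m y

/-- short paths inside `A` -/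
def P3 (G : SimpleGraph V) (A : Finset V) (x y : V) : Prop :=
  ∃ m ∈ A, ∃ m' ∈ A, G.Adj x m ∧ G.Adj m m' ∧ G.Adj m' y ∧ m ≠ y ∧ m' ≠ x

/-- the claim for small graphs attaining equality -/
def Eq2 (G : SimpleGraph V) (A : Finset V) : Prop :=
  3 ∣ A.card - 1 ∧ ∀ x ∈ A, ∀ y ∈ A, x ≠ y → (A.card ≤ 4 → G.Adj x y) ∧
    (A.card ≤ 7 → P2 G A x y) ∧ (A.card ≤ 10 → P3 G A x y)

/-- the inductive claim -/
def Cl (G : SimpleGraph V) (A : Finset V) : Prop :=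
  (A.card ≤ 11 → (Ed (IG G A)).card + 2 ≤ 2 * A.card ∧
    ((Ed (IG G A)).card + 2 = 2 * A.card → Eq2 G A)) ∧
  (12 ≤ A.card → 5 * (Ed (IG G A)).card + 33 ≤ 12 * A.card)

theorem cl_low (h5 : No5 G) {v a b : V} (hv : v ∈ A) (hc : 2 ≤ A.card)
    (hab : ∀ u, (IG G A).Adj v u → u = a ∨ u = b) (ih : Cl G (A.erase v)) : Cl G A := by
  have hcard := Finset.card_erase_of_mem hv
  set X := ({s(v, a), s(v, b)} : Finset (Sym2 V)).filter (fun e => e ∈ Ed (IG G A)) with hX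
  have hsub : Ed (IG G A) ⊆ Ed (IG G (A.erase v)) ∪ X := by
    intro e he
    induction e with | _ x y =>
    have h1 := mem_EI.1 he
    rw [Finset.mem_union]
    by_cases hx : x = v
    · subst hx
      right
      rw [hX, Finset.mem_filter]
      refine ⟨?_, he⟩
      rcases hab y h1 with e | e <;> subst e <;> simp
    by_cases hy : y = v
    · subst hy
      right
      rw [hX, Finset.mem_filter]
      refine ⟨?_, he⟩
      have h2 : (IG G A).Adj y x := ⟨h1.1.symm, h1.2.2, h1.2.1⟩
      rw [Sym2.eq_swap]
      rcases hab x h2 with e | e <;> subst e <;> simp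
    left
    exact mem_EI.2 ⟨h1.1, Finset.mem_erase.2 ⟨hx, h1.2.1⟩, Finset.mem_erase.2 ⟨hy, h1.2.2⟩⟩
  have h1 := (Finset.card_le_card hsub).trans (Finset.card_union_le _ _)
  have h2 : X.card ≤ 2 := (Finset.card_filter_le _ _).trans Finset.card_le_two
  have hne10 : ¬ (Eq2 G (A.erase v) ∧ A.card = 12) := by
    rintro ⟨⟨h3, -⟩, h12⟩
    rw [hcard, h12] at h3
    omega
  constructor
  · intro hn
    have ih1 := ih.1 (by omega)
    refine ⟨by omega, fun heq => ?_⟩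
    exfalso
    have hE := ih1.2 (by omega)
    have hX2 : X.card = 2 := by omega
    have hpair : X = {s(v, a), s(v, b)} := by
      refine Finset.eq_of_subset_of_card_le (Finset.filter_subset _ _) ?_
      rw [hX2]
      exact Finset.card_le_two
    have ha : s(v, a) ∈ X := by rw [hpair]; simp
    have hb : s(v, b) ∈ X := by rw [hpair]; simp
    have ha' := mem_EI.1 (Finset.mem_filter.1 ha).2
    have hb' := mem_EI.1 (Finset.mem_filter.1 hb).2
    have hne : a ≠ b := by
      rintro rfl
      rw [hpair] at hX2
      simp at hX2
    obtain ⟨m, hm, m', hm', q1, q2, q3, q4, q5⟩ := (hE.2 a (Finset.mem_erase.2 ⟨ha'.1.ne', ha'.2.2⟩) b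
      (Finset.mem_erase.2 ⟨hb'.1.ne', hb'.2.2⟩) hne).2.2 (by omega)
    exact h5 v a m m' b ha'.1 q1 q2 q3 hb'.1.symm (Finset.ne_of_mem_erase hm).symm
      (Finset.ne_of_mem_erase hm').symm q5.symm hne q4
  · intro hn
    by_cases h12 : A.card = 12
    · have ih1 := ih.1 (by omega)
      by_cases heq : (Ed (IG G (A.erase v))).card + 2 = 2 * (A.erase v).card
      · exact absurd ⟨ih1.2 heq, h12⟩ hne10
      · omega
    · have := ih.2 (by omega)
      omega

theorem cl_split {B B' : Finset V} (hB : B.Nonempty) (hB' : B'.Nonempty) (hU : B ∪ B' = A)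
    (hI : (B ∩ B').card ≤ 1) (hcr : ∀ x y, x ∈ A → y ∈ A → G.Adj x y → (x ∈ B ∧ y ∈ B) ∨ (x ∈ B' ∧ y ∈ B'))
    (i1 : Cl G B) (i2 : Cl G B') (p1 : B.card < A.card) (p2 : B'.card < A.card) : Cl G A := by
  have hcard := Finset.card_union_add_card_inter B B'
  rw [hU] at hcard
  have c1 := Finset.card_pos.2 hB
  have c2 := Finset.card_pos.2 hB'
  have hsub : Ed (IG G A) ⊆ Ed (IG G B) ∪ Ed (IG G B') := by
    intro e he
    induction e with | _ x y =>
    have h1 := mem_EI.1 he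
    rw [Finset.mem_union, mem_EI, mem_EI]
    have := hcr x y h1.2.1 h1.2.2 h1.1
    tauto
  have h1 := (Finset.card_le_card hsub).trans (Finset.card_union_le _ _)
  have a1 := i1.1
  have a2 := i2.1
  have b1 := i1.2
  have b2 := i2.2
  refine ⟨fun hn => ?_, fun hn => ?_⟩
  · have a1' := a1 (by omega)
    have a2' := a2 (by omega)
    refine ⟨by omega, fun heq => ?_⟩
    have e1 := a1'.2 (by omega)
    have e2 := a2'.2 (by omega)
    have hI1 : (B ∩ B').card = 1 := by omega
    obtain ⟨c, hc⟩ := Finset.card_eq_one.1 hI1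
    have hcB : c ∈ B ∧ c ∈ B' := by
      rw [← Finset.mem_inter, hc]; simp
    have huni : ∀ t, t ∈ B → t ∈ B' → t = c := by
      intro t h1 h2
      have : t ∈ B ∩ B' := Finset.mem_inter.2 ⟨h1, h2⟩
      rw [hc] at this
      simpa using this
    have sB : B ⊆ A := hU ▸ Finset.subset_union_left
    have sB' : B' ⊆ A := hU ▸ Finset.subset_union_right
    obtain ⟨d1, f1⟩ := e1
    obtain ⟨d2, f2⟩ := e2
    refine ⟨by omega, ?_⟩
    -- paths inside one part
    have same : ∀ {D : Finset V}, D ⊆ A → D.card ≤ A.card →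
        (∀ x ∈ D, ∀ y ∈ D, x ≠ y → (D.card ≤ 4 → G.Adj x y) ∧
          (D.card ≤ 7 → P2 G D x y) ∧ (D.card ≤ 10 → P3 G D x y)) →
        ∀ x ∈ D, ∀ y ∈ D, x ≠ y → (A.card ≤ 4 → G.Adj x y) ∧
          (A.card ≤ 7 → P2 G A x y) ∧ (A.card ≤ 10 → P3 G A x y) := by
      intro D hD hDc f x hx y hy hxy
      have := f x hx y hy hxy
      refine ⟨fun q => this.1 (by omega), fun q => ?_, fun q => ?_⟩
      · obtain ⟨m, hm, hh⟩ := this.2.1 (by omega)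
        exact ⟨m, hD hm, hh⟩
      · obtain ⟨m, hm, m', hm', hh⟩ := this.2.2 (by omega)
        exact ⟨m, hD hm, m', hD hm', hh⟩
    -- paths across
    have cross : ∀ {D D' : Finset V}, D ⊆ A → D' ⊆ A → D.card + D'.card = A.card + 1 →
        3 ∣ D.card - 1 → 3 ∣ D'.card - 1 → c ∈ D → c ∈ D' → (∀ t, t ∈ D → t ∈ D' → t = c) →
        (∀ x ∈ D, ∀ y ∈ D, x ≠ y → (D.card ≤ 4 → G.Adj x y) ∧
          (D.card ≤ 7 → P2 G D x y) ∧ (D.card ≤ 10 → P3 G D x y)) →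
        (∀ x ∈ D', ∀ y ∈ D', x ≠ y → (D'.card ≤ 4 → G.Adj x y) ∧
          (D'.card ≤ 7 → P2 G D' x y) ∧ (D'.card ≤ 10 → P3 G D' x y)) →
        ∀ x ∈ D, ∀ y ∈ D', x ≠ c → y ≠ c → (A.card ≤ 4 → G.Adj x y) ∧
          (A.card ≤ 7 → P2 G A x y) ∧ (A.card ≤ 10 → P3 G A x y) := by
      intro D D' hD hD' hs t1 t2 hcD hcD' hu f f' x hx y hy hxc hyc
      have g := f x hx c hcD hxc
      have g' := f' c hcD' y hy hyc.symm
      have k1 : 2 ≤ D.card := Finset.one_lt_card.2 ⟨x, hx, c, hcD, hxc⟩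
      have k2 : 2 ≤ D'.card := Finset.one_lt_card.2 ⟨y, hy, c, hcD', hyc⟩
      refine ⟨fun q => by omega, fun q => ?_, fun q => ?_⟩
      · exact ⟨c, hD hcD, g.1 (by omega), g'.1 (by omega)⟩
      · by_cases hd : D.card ≤ 4
        · obtain ⟨m, hm, w1, w2⟩ := g'.2.1 (by omega)
          refine ⟨c, hD hcD, m, hD' hm, g.1 hd, w1, w2, hyc.symm, ?_⟩
          rintro rfl
          exact hxc (hu _ hx hm)
        · obtain ⟨m, hm, w1, w2⟩ := g.2.1 (by omega)
          refine ⟨m, hD hm, c, hD hcD, w1, w2, g'.1 (by omega), ?_, hxc.symm⟩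
          rintro rfl
          exact hyc (hu _ hm hy)
    intro x hx y hy hxy
    rw [← hU, Finset.mem_union] at hx hy
    have s1 := same sB p1.le f1
    have s2 := same sB' p2.le f2
    by_cases hxc : x = c
    · subst hxc
      rcases hy with hy | hy
      · exact s1 x hcB.1 y hy hxy
      · exact s2 x hcB.2 y hy hxy
    by_cases hyc : y = c
    · subst hyc
      rcases hx with hx | hx
      · exact s1 x hx y hcB.1 hxy
      · exact s2 x hx y hcB.2 hxy
    rcases hx with hx | hx <;> rcases hy with hy | hy
    · exact s1 x hx y hy hxy
    · exact cross sB sB' (by omega) d1 d2 hcB.1 hcB.2 huni f1 f2 x hx y hy hxc hyc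
    · exact cross sB' sB (by omega) d2 d1 hcB.2 hcB.1 (fun t h1 h2 => huni t h2 h1) f2 f1 x hx y hy hxc hyc
    · exact s2 x hx y hy hxy
  · by_cases q1 : B.card ≤ 11 <;> by_cases q2 : B'.card ≤ 11
    · have := (a1 q1).1
      have := (a2 q2).1
      omega
    · have := (a1 q1).1
      have := b2 (by omega)
      omega
    · have := b1 (by omega)
      have := (a2 q2).1
      omega
    · have := b1 (by omega)
      have := b2 (by omega)
      omega

theorem cl_two (hp : G.IsPlanar) (h5 : No5 G) (hc : 2 ≤ A.card)
    (hdeg : ∀ v ∈ A, ∀ a b, ∃ u, (IG G A).Adj v u ∧ u ≠ a ∧ u ≠ b)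
    (cA : Cj (IG G A) (A : Set V)) (cAv : ∀ v, Cj (IG G A) ((A : Set V) \ {v})) : Cl G A := by
  by_cases h4 : 5 ≤ A.card
  · obtain ⟨ι, _, l, r, hd⟩ := hasDual_of_planar _ (IG G A) rfl (planar_mono hp (IG_le G A))
    have hctx : Ctx (IG G A) A l r := by
      refine ⟨hd, fun u v h => h.2.1, cA, cAv, hdeg, ?_, h4⟩
      intro a b c d e h1 h2 h3 h4 h5' 
      exact h5 a b c d e h1.1 h2.1 h3.1 h4.1 h5'.1
    have := hctx.final
    exact ⟨fun hn => ⟨by omega, fun q => by omega⟩, fun _ => this⟩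
  · have hno : ∀ v, s(v, v) ∉ Ed (IG G A) := by
      intro v hv
      exact (mem_EI.1 hv).1.ne rfl
    have h1 := card_dr hno
    have h2 : dr (Ed (IG G A)) ⊆ A.offDiag := by
      rintro ⟨x, y⟩ hxy
      have := mem_EI.1 (mem_dr.1 hxy)
      rw [Finset.mem_offDiag]
      exact ⟨this.2.1, this.2.2, this.1.ne⟩
    have h3 := Finset.card_le_card h2
    rw [Finset.offDiag_card] at h3
    have hc4 : A.card = 4 := by
      obtain ⟨v, hv⟩ := Finset.card_pos.1 (by omega : 0 < A.card)
      obtain ⟨a, ha, -⟩ := hdeg v hv v v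
      obtain ⟨b, hb, hba, -⟩ := hdeg v hv a a
      obtain ⟨c, hc, hca, hcb⟩ := hdeg v hv a b
      have : ({v, a, b, c} : Finset V) ⊆ A := by
        intro t ht
        simp only [Finset.mem_insert, Finset.mem_singleton] at ht
        rcases ht with rfl | rfl | rfl | rfl
        · exact hv
        · exact ha.2.2
        · exact hb.2.2
        · exact hc.2.2
      have hle := Finset.card_le_card this
      rw [Finset.card_insert_of_notMem (by
        simp only [Finset.mem_insert, Finset.mem_singleton]
        have := ha.ne
        have := hb.ne
        have := hc.ne
        tauto), Finset.card_eq_three.2 ⟨a, b, c, hba.symm, hca.symm, hcb.symm, rfl⟩] at hle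
      omega
    rw [hc4] at h3
    refine ⟨fun _ => ⟨by omega, fun _ => ⟨by rw [hc4], ?_⟩⟩, fun q => by omega⟩
    have hadj : ∀ x ∈ A, ∀ y ∈ A, x ≠ y → G.Adj x y := by
      intro x hx y hy hxy
      by_contra hno
      have hN : N (IG G A) x ⊆ (A.erase x).erase y := by
        intro t ht
        have ht' := mem_N.1 ht
        refine Finset.mem_erase.2 ⟨?_, Finset.mem_erase.2 ⟨ht'.ne', ht'.2.2⟩⟩
        rintro rfl
        exact hno ht'.1
      have k1 := Finset.card_le_card hN
      rw [Finset.card_erase_of_mem (Finset.mem_erase.2 ⟨hxy.symm, hy⟩),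
        Finset.card_erase_of_mem hx, hc4] at k1
      obtain ⟨a, ha, -⟩ := hdeg x hx x x
      obtain ⟨b, hb, hba, -⟩ := hdeg x hx a a
      obtain ⟨c, hc, hca, hcb⟩ := hdeg x hx a b
      have k2 : ({a, b, c} : Finset V) ⊆ N (IG G A) x := by
        intro t ht
        simp only [Finset.mem_insert, Finset.mem_singleton] at ht
        rw [mem_N]
        rcases ht with rfl | rfl | rfl <;> assumption
      have k3 := Finset.card_le_card k2
      rw [Finset.card_eq_three.2 ⟨a, b, c, hba.symm, hca.symm, hcb.symm, rfl⟩] at k3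
      omega
    intro x hx y hy hxy
    have hin : ((A.erase x).erase y).card = 2 := by
      rw [Finset.card_erase_of_mem (Finset.mem_erase.2 ⟨hxy.symm, hy⟩),
        Finset.card_erase_of_mem hx, hc4]
    obtain ⟨m, m', hmm, he⟩ := Finset.card_eq_two.1 hin
    have hm : m ∈ (A.erase x).erase y := by rw [he]; simp
    have hm' : m' ∈ (A.erase x).erase y := by rw [he]; simp
    simp only [Finset.mem_erase] at hm hm'
    exact ⟨fun _ => hadj x hx y hy hxy,
      fun _ => ⟨m, hm.2.2, hadj x hx m hm.2.2 hm.2.1.symm, hadj m hm.2.2 y hy hm.1⟩,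
      fun _ => ⟨m, hm.2.2, m', hm'.2.2, hadj x hx m hm.2.2 hm.2.1.symm,
        hadj m hm.2.2 m' hm'.2.2 hmm, hadj m' hm'.2.2 y hy hm'.1, hm.1, hm'.2.1⟩⟩

theorem cl_all (hp : G.IsPlanar) (h5 : No5 G) : ∀ (k : ℕ) (A : Finset V), A.card = k →
    1 ≤ A.card → Cl G A := by
  intro k
  induction k using Nat.strong_induction_on with
  | _ k ih =>
  intro A hk h1
  by_cases hc : A.card = 1
  · have hE : (Ed (IG G A)).card = 0 := by
      rw [Finset.card_eq_zero, Finset.eq_empty_iff_forall_notMem]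
      intro e he
      induction e with | _ x y =>
      have := mem_EI.1 he
      exact this.1.ne (Finset.card_le_one.1 hc.le x this.2.1 y this.2.2)
    refine ⟨fun _ => ⟨by omega, fun _ => ⟨by rw [hc]; simp, ?_⟩⟩, fun q => by omega⟩
    intro x hx y hy hxy
    exact absurd (Finset.card_le_one.1 hc.le x hx y hy) hxy
  have h2 : 2 ≤ A.card := by omega
  by_cases hdeg : ∀ v ∈ A, ∀ a b, ∃ u, (IG G A).Adj v u ∧ u ≠ a ∧ u ≠ b
  swap
  · push Not at hdeg
    obtain ⟨v, hv, a, b, hab⟩ := hdeg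
    have hcard := Finset.card_erase_of_mem hv
    exact cl_low h5 hv h2 (fun u hu => or_iff_not_imp_left.2 (hab u hu))
      (ih _ (by omega) (A.erase v) rfl (by omega))
  by_cases cA : Cj (IG G A) (A : Set V)
  swap
  · obtain ⟨D, hDA, ⟨x, hx⟩, ⟨w, hwA, hw⟩, hcl⟩ := not_Cj cA
    have hxA : x ∈ A := hDA x hx
    have b1 : (A.filter D).card < A.card := Finset.card_lt_card
      (Finset.filter_ssubset.2 ⟨w, hwA, hw⟩)
    have b2 : (A.filter (fun v => ¬ D v)).card < A.card := Finset.card_lt_card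
      (Finset.filter_ssubset.2 ⟨x, hxA, not_not.2 hx⟩)
    have n1 : (A.filter D).Nonempty := ⟨x, Finset.mem_filter.2 ⟨hxA, hx⟩⟩
    have n2 : (A.filter (fun v => ¬ D v)).Nonempty := ⟨w, Finset.mem_filter.2 ⟨hwA, hw⟩⟩
    refine cl_split n1 n2 (Finset.filter_union_filter_not_eq _ _) ?_ ?_
      (ih _ (by omega) _ rfl (Finset.card_pos.2 n1)) (ih _ (by omega) _ rfl (Finset.card_pos.2 n2))
      b1 b2
    · rw [Finset.card_le_one]
      intro s hs t ht
      simp only [Finset.mem_inter, Finset.mem_filter] at hs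
      exact absurd hs.1.2 hs.2.2
    · intro s t hs ht hst
      simp only [Finset.mem_filter]
      have k1 := hcl s t
      have k2 := hcl t s
      have k3 : (IG G A).Adj s t := ⟨hst, hs, ht⟩
      have k4 := k3.symm
      by_cases ds : D s
      · exact Or.inl ⟨⟨hs, ds⟩, ht, k1 ds ht k3⟩
      · exact Or.inr ⟨⟨hs, ds⟩, ht, fun dt => ds (k2 dt hs k4)⟩
  by_cases cAv : ∀ v, Cj (IG G A) ((A : Set V) \ {v})
  · exact cl_two hp h5 h2 hdeg cA cAv
  push Not at cAv
  obtain ⟨v, hv⟩ := cAv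
  obtain ⟨D, hDA, ⟨x, hx⟩, ⟨w, hwA, hw⟩, hcl⟩ := not_Cj hv
  have hxA : x ∈ A := (hDA x hx).1
  have hxv : x ≠ v := (hDA x hx).2
  have hwA' : w ∈ A := hwA.1
  have hwv : w ≠ v := hwA.2
  set B := A.filter (fun t => t = v ∨ D t) with hB
  set B' := A.filter (fun t => t = v ∨ ¬ D t) with hB'
  have b1 : B.card < A.card := Finset.card_lt_card
    (Finset.filter_ssubset.2 ⟨w, hwA', by tauto⟩)
  have b2 : B'.card < A.card := Finset.card_lt_card
    (Finset.filter_ssubset.2 ⟨x, hxA, by tauto⟩)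
  have n1 : B.Nonempty := ⟨x, Finset.mem_filter.2 ⟨hxA, Or.inr hx⟩⟩
  have n2 : B'.Nonempty := ⟨w, Finset.mem_filter.2 ⟨hwA', Or.inr hw⟩⟩
  refine cl_split n1 n2 ?_ ?_ ?_
    (ih _ (by omega) _ rfl (Finset.card_pos.2 n1)) (ih _ (by omega) _ rfl (Finset.card_pos.2 n2))
    b1 b2
  · ext t
    simp only [hB, hB', Finset.mem_union, Finset.mem_filter]
    tauto
  · rw [Finset.card_le_one]
    intro s hs t ht
    simp only [hB, hB', Finset.mem_inter, Finset.mem_filter] at hs ht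
    have e1 : s = v := hs.1.2.elim id fun q => hs.2.2.elim id fun q' => absurd q q'
    have e2 : t = v := ht.1.2.elim id fun q => ht.2.2.elim id fun q' => absurd q q'
    rw [e1, e2]
  · intro s t hs ht hst
    simp only [hB, hB', Finset.mem_filter]
    have k1 := hcl s t
    have k2 := hcl t s
    have k3 : (IG G A).Adj s t := ⟨hst, hs, ht⟩
    have k4 := k3.symm
    by_cases es : s = v
    · by_cases dt : D t
      · exact Or.inl ⟨⟨hs, Or.inl es⟩, ht, Or.inr dt⟩
      · exact Or.inr ⟨⟨hs, Or.inl es⟩, ht, Or.inr dt⟩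
    by_cases et : t = v
    · by_cases ds : D s
      · exact Or.inl ⟨⟨hs, Or.inr ds⟩, ht, Or.inl et⟩
      · exact Or.inr ⟨⟨hs, Or.inr ds⟩, ht, Or.inl et⟩
    have ms : s ∈ (A : Set V) \ {v} := ⟨hs, es⟩
    have mt : t ∈ (A : Set V) \ {v} := ⟨ht, et⟩
    by_cases ds : D s
    · exact Or.inl ⟨⟨hs, Or.inr ds⟩, ht, Or.inr (k1 ds mt k3)⟩
    · exact Or.inr ⟨⟨hs, Or.inr ds⟩, ht, Or.inr fun dt => ds (k2 dt ms k4)⟩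

theorem no5_of_no_cycle (h : ¬ ∃ (a : V) (c : G.Walk a a), c.IsCycle ∧ c.length = 5) : No5 G := by
  intro a b c d e ab bc cd de ea nac nad nbd nbe nce
  apply h
  have n1 := ab.ne
  have n2 := bc.ne
  have n3 := cd.ne
  have n4 := de.ne
  have n5 := ea.ne
  refine ⟨a, .cons ab (.cons bc (.cons cd (.cons de (.cons ea .nil)))), ?_, rfl⟩
  rw [SimpleGraph.Walk.cons_isCycle_iff]
  constructor
  · simp only [SimpleGraph.Walk.cons_isPath_iff, SimpleGraph.Walk.support_cons,
      SimpleGraph.Walk.support_nil, List.mem_cons, List.not_mem_nil]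
    simp
    tauto
  · simp only [SimpleGraph.Walk.edges_cons, SimpleGraph.Walk.edges_nil, List.mem_cons,
      List.not_mem_nil, Sym2.eq_iff]
    tauto

theorem main (n : ℕ) (hn : 11 ≤ n) (G : SimpleGraph V) (hcard : Fintype.card V = n)
    (hplanar : G.IsPlanar) (he : ((12 * n - 33 : ℚ)) / 5 < (G.edgeSet.ncard : ℚ)) :
    ∃ (a : V) (c : G.Walk a a), c.IsCycle ∧ c.length = 5 := by
  by_contra hno
  have h5 := no5_of_no_cycle hno
  have hU : (Finset.univ : Finset V).card = n := by rw [Finset.card_univ, hcard]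
  have hcl := cl_all hplanar h5 _ (Finset.univ : Finset V) rfl (by omega)
  have hE : (Ed (IG G Finset.univ)).card = G.edgeSet.ncard := by
    rw [← Set.ncard_coe_finset]
    congr 1
    ext e
    induction e with | _ x y =>
    rw [Finset.mem_coe, mem_EI]
    simp
  have he' : 12 * n < 5 * G.edgeSet.ncard + 33 := by
    rw [div_lt_iff₀ (by norm_num)] at he
    have : (12 * n : ℚ) < 5 * G.edgeSet.ncard + 33 := by linarith
    exact_mod_cast this
  unfold Cl at hcl
  rw [hE, hU] at hcl
  by_cases h11 : n ≤ 11
  · have h1 := hcl.1 h11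
    have : n = 11 := by omega
    subst this
    have h2 := h1.2 (by omega)
    have h3 := h2.1
    rw [hU] at h3
    omega
  · have := hcl.2 (by omega)
    omega

end

end Dow

/-- Dowden: every planar graph on `n ≥ 11` vertices with more than
`(12n - 33)/5` edges contains a 5-cycle. -/
theorem stmt10 (n : ℕ) (hn : 11 ≤ n) {V : Type} [Fintype V]
    (G : SimpleGraph V) (hcard : Fintype.card V = n) (hplanar : G.IsPlanar)
    (he : ((12 * n - 33 : ℚ)) / 5 < (G.edgeSet.ncard : ℚ)) :
    ∃ (a : V) (c : G.Walk a a), c.IsCycle ∧ c.length = 5 :=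
  Dow.main n hn G hcard hplanar he
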